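/- arXiv:2108.10961 — 3 statements merged into one kernel-verified Lean document; each statement's English description precedes it below -/
import Mathlib

section
/- Let m ≥ n ≥ 1, ε, τ > 0, and let μ = m_μ·N(0,Σμ) on R^m and ν = m_ν·N(0,Σν) on R^n be unbalanced Gaussian measures with m_μ, m_ν > 0 and Σμ = diag(λ_{μ,1},…,λ_{μ,m}), Σν = diag(λ_{ν,1},…,λ_{ν,n}) diagonal with positive non-increasing entries. Define g_{ε,τ,+}(x,y;a,b) := x² + y² + (τ+ε)(x/a + y/b − log(xy/(ab)) − 2) − 2[xy − ε/2]^+ + ε[log(xy) − log(ε/2)]^+ and h_{ε,τ}(x;a) := x² + (τ+ε)(x/a − log(x/a) − 1); let (φ_k,ϕ_k) minimize g_{ε,τ,+}(·,·;λ_{μ,k},λ_{ν,k}) over x,y > 0 for k = 1,…,n, let φ_k minimize h_{ε,τ}(·;λ_{μ,k}) over x > 0 for k = n+1,…,m, and set Υ* := Σ_{k=1}^{n} g_{ε,τ,+}(φ_k,ϕ_k;λ_{μ,k},λ_{ν,k}) + Σ_{k=n+1}^{m} h_{ε,τ}(φ_k;λ_{μ,k}) and m_{π*}² := (m_μ m_ν)^{2τ/(2τ+ε)}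 (m_μ m_ν)^{2ε/(2τ+ε)} exp(−Υ*/(2τ+ε)). Then UIGW_{ε,τ}(μ,ν) = m_{π*}² Υ* + τ·(kl(m_{π*}² ‖ m_μ²) + kl(m_{π*}² ‖ m_ν²)) + ε·kl(m_{π*}² ‖ m_μ² m_ν²), and the infimum is attained at π* = m_{π*}·N(0,Σ_{π*}), where Σ_{π*} has diagonal blocks Σ_x* = diag(φ_1,…,φ_m), Σ_y* = diag(ϕ_1,…,ϕ_n) and off-diagonal block K*_{xy} = diag(ψ_1,…,ψ_n) with ψ_k = ([1 − ε/(2 φ_k ϕ_k)]^+ · φ_k ϕ_k)^{1/2}. -/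
open MeasureTheory Matrix ENNReal

/-- Density (w.r.t. Lebesgue measure) of the centered Gaussian with covariance `S`. -/
noncomputable def gaussianPdf {ι : Type*} [Fintype ι] [DecidableEq ι]
    (S : Matrix ι ι ℝ) (x : ι → ℝ) : ℝ≥0∞ :=
  ENNReal.ofReal (Real.exp (-(x ⬝ᵥ (S⁻¹ *ᵥ x)) / 2) /
    Real.sqrt ((2 * Real.pi) ^ (Fintype.card ι) * S.det))

/-- The centered Gaussian measure `N(0, S)` on `ι → ℝ` with covariance matrix `S`. -/
noncomputable def gaussianMeasure {ι : Type*} [Fintype ι] [DecidableEq ι]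
    (S : Matrix ι ι ℝ) : Measure (ι → ℝ) :=
  MeasureTheory.volume.withDensity (gaussianPdf S)

/-- Generalized Kullback–Leibler divergence between positive measures:
`KL(α‖β) = ∫ log (dα/dβ) dα + β(univ) - α(univ)`.
For probability measures this is the usual Kullback–Leibler divergence. -/
noncomputable def KLgen {X : Type*} [MeasurableSpace X] (α β : Measure X) : ℝ :=
  (∫ x, Real.log ((α.rnDeriv β x).toReal) ∂α) + (β Set.univ).toReal - (α Set.univ).toReal

/-- Abel summation: a nonnegative antitone weight preserves nonpositivity of partial sums. -/
lemma sum_mul_nonpos_of_antitone {n : ℕ} (a d : Fin n → ℝ) (ha : Antitone a)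
    (ha0 : ∀ i, 0 ≤ a i)
    (hd : ∀ p : ℕ, ∑ i : Fin n, (if (i : ℕ) < p then d i else 0) ≤ 0) :
    ∑ i, a i * d i ≤ 0 := by
  induction n with
  | zero => simp
  | succ n ih =>
    have h1 := ih (fun i => a i.castSucc - a (Fin.last n)) (fun i => d i.castSucc)
      (fun i j hij => by simpa using ha (by simpa using hij))
      (fun i => by simpa using ha (Fin.le_last _))
      (fun p => by
        rcases le_or_gt p n with hp | hp
        · have := hd p
          rw [Fin.sum_univ_castSucc] at this
          simpa [hp.not_gt] using this
        · have := hd n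
          rw [Fin.sum_univ_castSucc] at this
          have h2 : ∀ i : Fin n, (i : ℕ) < p := fun i => by omega
          simpa [h2] using this)
    have h2 : ∑ i, d i ≤ 0 := by simpa only [Fin.is_lt, if_true] using hd (n + 1)
    have h3 : ∑ i, a i * d i = ∑ i : Fin n, (a i.castSucc - a (Fin.last n)) * d i.castSucc
        + a (Fin.last n) * ∑ i, d i := by
      rw [Fin.sum_univ_castSucc, Fin.sum_univ_castSucc (f := d), mul_add, Finset.mul_sum,
        ← add_assoc, ← Finset.sum_add_distrib]
      congr 1
      exact Finset.sum_congr rfl fun i _ => by ring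
    rw [h3]
    have := mul_nonneg (ha0 (Fin.last n)) (neg_nonneg.2 h2)
    linarith

/-- Two-dimensional Abel summation. -/
lemma sum_mul_mul_nonpos_of_antitone {m n : ℕ} (a : Fin m → ℝ) (b : Fin n → ℝ)
    (D : Fin m → Fin n → ℝ) (ha : Antitone a) (ha0 : ∀ i, 0 ≤ a i)
    (hb : Antitone b) (hb0 : ∀ i, 0 ≤ b i)
    (hD : ∀ p q : ℕ,
      ∑ i : Fin m, ∑ j : Fin n, (if (i : ℕ) < p then (if (j : ℕ) < q then D i j else 0) else 0) ≤ 0) :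
    ∑ i, ∑ j, a i * b j * D i j ≤ 0 := by
  have h1 : ∑ i, ∑ j, a i * b j * D i j = ∑ i, a i * ∑ j, b j * D i j := by
    refine Finset.sum_congr rfl fun i _ => ?_
    rw [Finset.mul_sum]
    exact Finset.sum_congr rfl fun j _ => by ring
  rw [h1]
  refine sum_mul_nonpos_of_antitone a _ ha ha0 fun p => ?_
  have h2 : ∑ i : Fin m, (if (i : ℕ) < p then ∑ j, b j * D i j else 0)
      = ∑ j, b j * ∑ i : Fin m, (if (i : ℕ) < p then D i j else 0) := by
    simp_rw [Finset.mul_sum]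
    rw [Finset.sum_comm]
    refine Finset.sum_congr rfl fun i _ => ?_
    split_ifs <;> simp
  rw [h2]
  refine sum_mul_nonpos_of_antitone b _ hb hb0 fun q => ?_
  refine le_trans (le_of_eq ?_) (hD p q)
  rw [Finset.sum_comm]
  refine Finset.sum_congr rfl fun j _ => ?_
  split_ifs <;> simp

lemma sum_ite_lt_one {n : ℕ} (q : ℕ) :
    ∑ k : Fin n, (if (k : ℕ) < q then (1 : ℝ) else 0) = (min q n : ℕ) := by
  rw [Finset.sum_boole, Fin.card_filter_val_lt, min_comm]

/-- Weights in `[0, 1]` of total mass at most `q` select at most the `q` largest values. -/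
lemma sum_mul_le_sum_lt {n : ℕ} (r w : Fin n → ℝ) (hr : Antitone r) (hr0 : ∀ k, 0 ≤ r k)
    (hw0 : ∀ k, 0 ≤ w k) (hw1 : ∀ k, w k ≤ 1) (q : ℕ) (hw : ∑ k, w k ≤ q) :
    ∑ k, r k * w k ≤ ∑ k : Fin n, (if (k : ℕ) < q then r k else 0) := by
  have key := sum_mul_nonpos_of_antitone r
    (fun k => w k - if (k : ℕ) < q then 1 else 0) hr hr0 (fun p => ?_)
  · have : ∑ k, r k * (w k - if (k : ℕ) < q then 1 else 0)
        = ∑ k, r k * w k - ∑ k : Fin n, (if (k : ℕ) < q then r k else 0) := by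
      rw [← Finset.sum_sub_distrib]
      refine Finset.sum_congr rfl fun k _ => ?_
      split_ifs <;> ring
    linarith
  · by_cases hpq : p ≤ q
    · refine Finset.sum_nonpos fun k _ => ?_
      by_cases hk : (k : ℕ) < p
      · simp [hk, hk.trans_le hpq, hw1 k]
      · simp [hk]
    · by_cases hqn : q ≤ n
      · have h1 : ∑ k : Fin n, (if (k : ℕ) < p then (w k - if (k : ℕ) < q then 1 else 0) else 0)
          ≤ ∑ k, w k - ∑ k : Fin n, (if (k : ℕ) < q then (1 : ℝ) else 0) := by
          rw [← Finset.sum_sub_distrib]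
          refine Finset.sum_le_sum fun k _ => ?_
          by_cases hk : (k : ℕ) < p
          · simp [hk]
          · have : ¬ (k : ℕ) < q := by omega
            simp [hk, this, hw0 k]
        rw [sum_ite_lt_one, min_eq_left hqn] at h1
        linarith
      · refine Finset.sum_nonpos fun k _ => ?_
        have h3 : (k : ℕ) < q := by omega
        by_cases hk : (k : ℕ) < p
        · simp [hk, h3, hw1 k]
        · simp [hk]

/-- Spectral theorem with eigenvalues in decreasing order. -/
lemma exists_antitone_spectral {n : ℕ} (A : Matrix (Fin n) (Fin n) ℝ) (hA : A.IsHermitian) :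
    ∃ (U : Matrix (Fin n) (Fin n) ℝ) (a : Fin n → ℝ), Uᵀ * U = 1 ∧ U * Uᵀ = 1 ∧ Antitone a ∧
      A = U * diagonal a * Uᵀ := by
  classical
  let V : Matrix (Fin n) (Fin n) ℝ := hA.eigenvectorUnitary
  have hV1 : Vᵀ * V = 1 := by
    have := Unitary.coe_star_mul_self hA.eigenvectorUnitary
    simpa [V, star_eq_conjTranspose] using this
  have hV2 : V * Vᵀ = 1 := mul_eq_one_comm.1 hV1
  have hsp : A = V * diagonal hA.eigenvalues * Vᵀ := by
    have := hA.spectral_theorem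
    simpa [V, star_eq_conjTranspose, Unitary.conjStarAlgAut_apply, Function.comp_def] using this
  let σ : Equiv.Perm (Fin n) := Tuple.sort (fun i => - hA.eigenvalues i)
  have hσ : Antitone (hA.eigenvalues ∘ σ) := fun i j hij => by
    have := Tuple.monotone_sort (fun i => - hA.eigenvalues i) hij
    simpa using this
  refine ⟨V.submatrix id σ, hA.eigenvalues ∘ σ, ?_, ?_, hσ, ?_⟩
  · rw [transpose_submatrix]
    have := submatrix_mul_equiv Vᵀ V σ (Equiv.refl _) σ
    simp only [Equiv.coe_refl] at this
    rw [this, hV1]; simp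
  · rw [transpose_submatrix]
    have := submatrix_mul_equiv V Vᵀ id σ id
    rw [this, hV2]; simp
  · have h1 : diagonal (hA.eigenvalues ∘ σ) = (diagonal hA.eigenvalues).submatrix σ σ := by
      simp
    rw [h1, transpose_submatrix, submatrix_mul_equiv, submatrix_mul_equiv]
    simpa using hsp

/-- A matrix is described by the partial sums of its squared entries being dominated by
partial sums of its squared singular values. -/
lemma sum_sq_corner_le {m n : ℕ} (R : Matrix (Fin m) (Fin n) ℝ) (Q : Matrix (Fin n) (Fin n) ℝ)
    (r : Fin n → ℝ) (hQ1 : Qᵀ * Q = 1) (hQ2 : Q * Qᵀ = 1) (hr : Antitone r)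
    (hR : Rᵀ * R = Q * diagonal r * Qᵀ) (p q : ℕ) :
    ∑ i : Fin m, ∑ j : Fin n, (if (i : ℕ) < p then (if (j : ℕ) < q then R i j ^ 2 else 0) else 0)
      ≤ ∑ k : Fin n, (if (k : ℕ) < min p q then r k else 0) := by
  set P := R * Q with hP
  have hPP : Pᵀ * P = diagonal r := by
    rw [hP, transpose_mul, Matrix.mul_assoc, ← Matrix.mul_assoc Rᵀ, hR]
    simp only [Matrix.mul_assoc, hQ1, Matrix.mul_one]
    rw [← Matrix.mul_assoc, hQ1, Matrix.one_mul]
  have hRP : R = P * Qᵀ := by rw [hP, Matrix.mul_assoc, hQ2, Matrix.mul_one]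
  have hPkl : ∀ k l, ∑ i, P i k * P i l = if k = l then r k else 0 := fun k l => by
    have := congrFun (congrFun hPP k) l
    simpa [Matrix.mul_apply, diagonal_apply] using this
  have hPk : ∀ k, ∑ i, P i k ^ 2 = r k := fun k => by
    simpa [sq] using hPkl k k
  have hr0 : ∀ k, 0 ≤ r k := fun k => by
    rw [← hPk]; positivity
  have hQk : ∀ k, ∑ j, Q j k ^ 2 = 1 := fun k => by
    have := congrFun (congrFun hQ1 k) k
    simpa [Matrix.mul_apply, sq] using this
  have hQj : ∀ j, ∑ k, Q j k ^ 2 = 1 := fun k => by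
    have := congrFun (congrFun hQ2 k) k
    simpa [Matrix.mul_apply, sq] using this
  have hcol : ∀ j, ∑ i, R i j ^ 2 = ∑ k, r k * Q j k ^ 2 := fun j => by
    have := congrFun (congrFun hR j) j
    rw [Matrix.mul_apply, Matrix.mul_apply] at this
    simp only [transpose_apply, mul_diagonal, ← sq] at this
    rw [this]
    exact Finset.sum_congr rfl fun k _ => by ring
  have hrow : ∀ i, ∑ j, R i j ^ 2 = ∑ k, P i k ^ 2 := fun i => by
    have h1 : R * Rᵀ = P * Pᵀ := by
      rw [hP, transpose_mul, Matrix.mul_assoc, ← Matrix.mul_assoc Q, hQ2, Matrix.one_mul]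
    have := congrFun (congrFun h1 i) i
    simpa [Matrix.mul_apply, ← sq] using this
  rcases le_total p q with hpq | hpq
  · rw [min_eq_left hpq]
    let w : Fin n → ℝ := fun k => ∑ i : Fin m, if (i : ℕ) < p then P i k ^ 2 / r k else 0
    have hbessel : ∀ i, ∑ k, P i k ^ 2 / r k ≤ 1 := fun i => by
      set t := ∑ k, P i k ^ 2 / r k with ht
      let y : Fin n → ℝ := fun k => P i k / r k
      have h1 : (P *ᵥ y) i = t := by
        simp only [mulVec, dotProduct, ht, y]
        exact Finset.sum_congr rfl fun k _ => by ring
      have h2 : ∑ i', (P *ᵥ y) i' ^ 2 = t := by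
        have : ∑ i', (P *ᵥ y) i' ^ 2 = y ⬝ᵥ (Pᵀ * P) *ᵥ y := by
          rw [← mulVec_mulVec y Pᵀ P, dotProduct_mulVec, vecMul_transpose]
          simp only [dotProduct, sq]
        rw [this, hPP]
        simp only [mulVec_diagonal, dotProduct, ht, y]
        refine Finset.sum_congr rfl fun k _ => ?_
        by_cases hk : r k = 0
        · simp [hk]
        · field_simp
      have h3 : t ^ 2 ≤ t := by
        rw [← h1, h1]
        conv_rhs => rw [← h2]
        rw [← h1]
        exact Finset.single_le_sum (f := fun i' => (P *ᵥ y) i' ^ 2)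
          (fun i' _ => sq_nonneg _) (Finset.mem_univ i)
      nlinarith
    have hw := sum_mul_le_sum_lt r w hr hr0 ?_ ?_ p ?_
    · refine le_trans ?_ hw
      calc ∑ i : Fin m, ∑ j : Fin n, (if (i : ℕ) < p then (if (j : ℕ) < q then R i j ^ 2 else 0) else 0)
          ≤ ∑ i : Fin m, (if (i : ℕ) < p then ∑ k, P i k ^ 2 else 0) := by
            refine Finset.sum_le_sum fun i _ => ?_
            split_ifs with hi
            · rw [← hrow]
              refine Finset.sum_le_sum fun j _ => ?_
              split_ifs
              · exact le_rfl
              · positivity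
            · simp
        _ = ∑ k, r k * w k := by
            simp only [w, Finset.mul_sum]
            rw [Finset.sum_comm]
            refine Finset.sum_congr rfl fun i _ => ?_
            split_ifs with hi
            · refine Finset.sum_congr rfl fun k _ => ?_
              by_cases hk : r k = 0
              · have := hPk k
                rw [hk, Finset.sum_eq_zero_iff_of_nonneg (fun i _ => sq_nonneg _)] at this
                simp [hk, this i]
              · field_simp
            · simp
        _ ≤ _ := le_rfl
    · intro k
      refine Finset.sum_nonneg fun i _ => ?_
      split_ifs
      · exact div_nonneg (sq_nonneg _) (hr0 k)
      · exact le_rfl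
    · intro k
      calc w k ≤ ∑ i, P i k ^ 2 / r k := by
            refine Finset.sum_le_sum fun i _ => ?_
            split_ifs
            · exact le_rfl
            · exact div_nonneg (sq_nonneg _) (hr0 k)
        _ = r k / r k := by rw [← Finset.sum_div, hPk]
        _ ≤ 1 := div_self_le_one _
    · calc ∑ k, w k = ∑ i : Fin m, (if (i : ℕ) < p then ∑ k, P i k ^ 2 / r k else 0) := by
            simp only [w]
            rw [Finset.sum_comm]
            refine Finset.sum_congr rfl fun i _ => ?_
            split_ifs <;> simp
        _ ≤ ∑ i : Fin m, (if (i : ℕ) < p then (1 : ℝ) else 0) := by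
            refine Finset.sum_le_sum fun i _ => ?_
            split_ifs
            · exact hbessel i
            · exact le_rfl
        _ = (min p m : ℕ) := sum_ite_lt_one p
        _ ≤ p := by exact_mod_cast min_le_left _ _
  · rw [min_eq_right hpq]
    let w : Fin n → ℝ := fun k => ∑ j : Fin n, if (j : ℕ) < q then Q j k ^ 2 else 0
    have hw := sum_mul_le_sum_lt r w hr hr0 ?_ ?_ q ?_
    · refine le_trans ?_ hw
      calc ∑ i : Fin m, ∑ j : Fin n, (if (i : ℕ) < p then (if (j : ℕ) < q then R i j ^ 2 else 0) else 0)
          ≤ ∑ i, ∑ j : Fin n, (if (j : ℕ) < q then R i j ^ 2 else 0) := by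
            refine Finset.sum_le_sum fun i _ => Finset.sum_le_sum fun j _ => ?_
            split_ifs
            · exact le_rfl
            · exact le_rfl
            · positivity
            · exact le_rfl
        _ = ∑ j : Fin n, (if (j : ℕ) < q then ∑ i, R i j ^ 2 else 0) := by
            rw [Finset.sum_comm]
            refine Finset.sum_congr rfl fun i _ => ?_
            split_ifs <;> simp
        _ = ∑ k, r k * w k := by
            simp only [w, Finset.mul_sum, hcol]
            rw [Finset.sum_comm]
            refine Finset.sum_congr rfl fun i _ => ?_
            split_ifs <;> simp
    · intro k
      refine Finset.sum_nonneg fun i _ => ?_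
      split_ifs <;> positivity
    · intro k
      rw [← hQk k]
      refine Finset.sum_le_sum fun i _ => ?_
      split_ifs
      · exact le_rfl
      · positivity
    · calc ∑ k, w k = ∑ j : Fin n, (if (j : ℕ) < q then ∑ k, Q j k ^ 2 else 0) := by
            simp only [w]
            rw [Finset.sum_comm]
            refine Finset.sum_congr rfl fun i _ => ?_
            split_ifs <;> simp
        _ = ∑ j : Fin n, (if (j : ℕ) < q then (1 : ℝ) else 0) := by
            simp only [hQj]
        _ = (min q n : ℕ) := sum_ite_lt_one q
        _ ≤ q := by exact_mod_cast min_le_left _ _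

/-- Horn-type bound for the trace `tr (A R B Rᵀ)`. -/
lemma sum_mul_mul_sq_le {m n : ℕ} (hmn : n ≤ m) (R : Matrix (Fin m) (Fin n) ℝ)
    (Q : Matrix (Fin n) (Fin n) ℝ) (r : Fin n → ℝ) (hQ1 : Qᵀ * Q = 1) (hQ2 : Q * Qᵀ = 1)
    (hr : Antitone r) (hR : Rᵀ * R = Q * diagonal r * Qᵀ) (a : Fin m → ℝ) (b : Fin n → ℝ)
    (ha : Antitone a) (ha0 : ∀ i, 0 ≤ a i) (hb : Antitone b) (hb0 : ∀ i, 0 ≤ b i) :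
    ∑ i, ∑ j, a i * b j * R i j ^ 2 ≤ ∑ k, a (Fin.castLE hmn k) * b k * r k := by
  have hdiag : ∀ (f : Fin m → Fin n → ℝ),
      ∑ i : Fin m, ∑ j : Fin n, (if (i : ℕ) = (j : ℕ) then f i j else 0) = ∑ k, f (Fin.castLE hmn k) k := by
    intro f
    rw [Finset.sum_comm]
    refine Finset.sum_congr rfl fun j _ => ?_
    rw [Finset.sum_eq_single (Fin.castLE hmn j)]
    · simp
    · intro i _ hi
      rw [if_neg]
      intro h
      exact hi (Fin.ext (by simpa using h))
    · simp
  have key := sum_mul_mul_nonpos_of_antitone a b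
    (fun i j => R i j ^ 2 - if (i : ℕ) = (j : ℕ) then r j else 0) ha ha0 hb hb0 (fun p q => ?_)
  · have h1 := hdiag (fun i j => a i * b j * r j)
    have : ∑ i, ∑ j, a i * b j * (R i j ^ 2 - if (i : ℕ) = (j : ℕ) then r j else 0)
        = ∑ i, ∑ j, a i * b j * R i j ^ 2
          - ∑ i : Fin m, ∑ j : Fin n, (if (i : ℕ) = (j : ℕ) then a i * b j * r j else 0) := by
      simp only [← Finset.sum_sub_distrib]
      refine Finset.sum_congr rfl fun i _ => Finset.sum_congr rfl fun j _ => ?_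
      split_ifs <;> ring
    linarith
  · have h1 := hdiag (fun i j => if (i : ℕ) < p then (if (j : ℕ) < q then r j else 0) else 0)
    have h2 := sum_sq_corner_le R Q r hQ1 hQ2 hr hR p q
    have h3 : ∑ k : Fin n, (if ((Fin.castLE hmn k : Fin m) : ℕ) < p then
        (if (k : ℕ) < q then r k else 0) else 0)
        = ∑ k : Fin n, (if (k : ℕ) < min p q then r k else 0) := by
      refine Finset.sum_congr rfl fun k _ => ?_
      simp only [Fin.val_castLE, lt_min_iff, ite_and]
    have h4 : ∑ i : Fin m, ∑ j : Fin n, (if (i : ℕ) < p then (if (j : ℕ) < q then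
        (R i j ^ 2 - if (i : ℕ) = (j : ℕ) then r j else 0) else 0) else 0)
        = ∑ i : Fin m, ∑ j : Fin n, (if (i : ℕ) < p then (if (j : ℕ) < q then
          R i j ^ 2 else 0) else 0)
          - ∑ i : Fin m, ∑ j : Fin n, (if (i : ℕ) = (j : ℕ) then
            (if (i : ℕ) < p then (if (j : ℕ) < q then r j else 0) else 0) else 0) := by
      simp only [← Finset.sum_sub_distrib]
      refine Finset.sum_congr rfl fun i _ => Finset.sum_congr rfl fun j _ => ?_
      split_ifs <;> ring
    linarith

/-- Von Neumann-type lower bound for the trace against an increasing diagonal. -/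
lemma sum_div_le_sum_diag_div {n : ℕ} (U : Matrix (Fin n) (Fin n) ℝ) (a l : Fin n → ℝ)
    (hU1 : Uᵀ * U = 1) (ha : Antitone a) (ha0 : ∀ i, 0 ≤ a i)
    (hl : Antitone l) (hl0 : ∀ i, 0 < l i) :
    ∑ i, a i / l i ≤ ∑ i, (U * diagonal a * Uᵀ) i i / l i := by
  set C := ∑ i, 1 / l i
  have hC : ∀ i, 1 / l i ≤ C := fun i =>
    Finset.single_le_sum (f := fun i => 1 / l i) (fun j _ => (one_div_pos.2 (hl0 j)).le)
      (Finset.mem_univ i)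
  have key := sum_mul_mul_sq_le le_rfl U 1 (fun _ => 1) (by simp) (by simp)
    (fun _ _ _ => le_rfl) (by simp [hU1]) (fun i => C - 1 / l i) a
    (fun i j hij => sub_le_sub_left (one_div_le_one_div_of_le (hl0 j) (hl hij)) C)
    (fun i => sub_nonneg.2 (hC i)) ha ha0
  have hcol : ∀ k, ∑ i, U i k ^ 2 = 1 := fun k => by
    have := congrFun (congrFun hU1 k) k
    simpa [Matrix.mul_apply, sq] using this
  have h1 : ∑ i, (U * diagonal a * Uᵀ) i i / l i = ∑ i, ∑ k, 1 / l i * a k * U i k ^ 2 := by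
    refine Finset.sum_congr rfl fun i _ => ?_
    rw [Matrix.mul_apply, Finset.sum_div]
    refine Finset.sum_congr rfl fun k _ => ?_
    rw [mul_diagonal, transpose_apply]
    ring
  have h2 : ∑ i, ∑ k, (C - 1 / l i) * a k * U i k ^ 2
      = C * ∑ k, a k - ∑ i, ∑ k, 1 / l i * a k * U i k ^ 2 := by
    have : C * ∑ k, a k = ∑ i, ∑ k, C * a k * U i k ^ 2 := by
      rw [Finset.sum_comm, Finset.mul_sum]
      refine Finset.sum_congr rfl fun k _ => ?_
      rw [← Finset.mul_sum, hcol, mul_one]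
    rw [this]
    simp only [← Finset.sum_sub_distrib]
    exact Finset.sum_congr rfl fun i _ => Finset.sum_congr rfl fun k _ => by ring
  have h3 : ∑ k, (C - 1 / l k) * a k * 1 = C * ∑ k, a k - ∑ k, a k / l k := by
    rw [Finset.mul_sum, ← Finset.sum_sub_distrib]
    exact Finset.sum_congr rfl fun k _ => by ring
  simp only [Fin.castLE_rfl, id] at key
  rw [h2, h3] at key
  rw [h1]
  linarith

lemma two_mul_add_log_le {ε r z : ℝ} (hε : 0 < ε) (hz : 0 < z) (hr0 : 0 ≤ r) (hr1 : r < 1) :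
    2 * (z * r) + ε * Real.log (1 - r)
      ≤ 2 * max (z - ε / 2) 0 - ε * max (Real.log z - Real.log (ε / 2)) 0 := by
  have hr : 0 < 1 - r := by linarith
  rcases le_total z (ε / 2) with h | h
  · rw [max_eq_right (by linarith), max_eq_right (by
      have := Real.log_le_log hz h; linarith)]
    have h1 := Real.log_le_sub_one_of_pos hr
    have h2 : z * r ≤ ε / 2 * r := mul_le_mul_of_nonneg_right h hr0
    nlinarith
  · rw [max_eq_left (by linarith), max_eq_left (by
      have := Real.log_le_log (by positivity) h; linarith)]
    have h1 := Real.log_le_sub_one_of_pos (x := (1 - r) * (z / (ε / 2))) (by positivity)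
    rw [Real.log_mul hr.ne' (by positivity), Real.log_div hz.ne' (by positivity)] at h1
    have h3 := mul_le_mul_of_nonneg_left h1 hε.le
    have h4 : ε * ((1 - r) * (z / (ε / 2)) - 1) = 2 * z * (1 - r) - ε := by field_simp
    linarith

lemma two_mul_add_log_eq {ε z : ℝ} (hε : 0 < ε) (hz : 0 < z) :
    2 * (z * max (1 - ε / (2 * z)) 0) + ε * Real.log (1 - max (1 - ε / (2 * z)) 0)
      = 2 * max (z - ε / 2) 0 - ε * max (Real.log z - Real.log (ε / 2)) 0 := by
  rcases le_total z (ε / 2) with h | h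
  · have h1 : 1 - ε / (2 * z) ≤ 0 := by
      rw [sub_nonpos, one_le_div (by positivity)]; linarith
    rw [max_eq_right h1, max_eq_right (by linarith), max_eq_right (by
      have := Real.log_le_log hz h; linarith)]
    simp
  · have h1 : 0 ≤ 1 - ε / (2 * z) := by
      rw [sub_nonneg, div_le_one (by positivity)]; linarith
    rw [max_eq_left h1, max_eq_left (by linarith), max_eq_left (by
      have := Real.log_le_log (by positivity) h; linarith)]
    have h2 : 1 - (1 - ε / (2 * z)) = ε / 2 / z := by field_simp; ring
    rw [h2, Real.log_div (by positivity) hz.ne']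
    field_simp
    ring

section Blocks

variable {m n : ℕ}

/-- The normalized cross-covariance `a_i^{-1/2} K_ij b_j^{-1/2}`. -/
noncomputable def normalizedCross (a : Fin m → ℝ) (b : Fin n → ℝ) (K : Matrix (Fin m) (Fin n) ℝ) :
    Matrix (Fin m) (Fin n) ℝ :=
  Matrix.of fun i j => K i j / (Real.sqrt (a i) * Real.sqrt (b j))

lemma fromBlocks_eq_normalizedCross (a : Fin m → ℝ) (b : Fin n → ℝ)
    (K : Matrix (Fin m) (Fin n) ℝ) (ha : ∀ i, 0 < a i) (hb : ∀ j, 0 < b j) :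
    fromBlocks (diagonal a) K Kᵀ (diagonal b)
      = (diagonal (Sum.elim (fun i => Real.sqrt (a i)) fun j => Real.sqrt (b j)))ᴴ
        * fromBlocks 1 (normalizedCross a b K) (normalizedCross a b K)ᵀ 1
        * diagonal (Sum.elim (fun i => Real.sqrt (a i)) fun j => Real.sqrt (b j)) := by
  ext i j
  rw [mul_diagonal, diagonal_conjTranspose, diagonal_mul]
  have ha' := fun i => (Real.sqrt_pos.2 (ha i)).ne'
  have hb' := fun i => (Real.sqrt_pos.2 (hb i)).ne'
  rcases i with i | i <;> rcases j with j | j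
  · by_cases h : i = j
    · subst h; simp [Real.mul_self_sqrt (ha i).le]
    · simp [h]
  · simp only [fromBlocks_apply₁₂, normalizedCross, Sum.elim_inl, Sum.elim_inr, of_apply,
      Pi.star_apply, star_trivial]
    have := ha' i
    have := hb' j
    field_simp
  · simp only [fromBlocks_apply₂₁, normalizedCross, Sum.elim_inl, Sum.elim_inr, of_apply,
      Pi.star_apply, star_trivial, transpose_apply]
    have := ha' j
    have := hb' i
    field_simp
  · by_cases h : i = j
    · subst h; simp [Real.mul_self_sqrt (hb i).le]
    · simp [h]

lemma det_fromBlocks_diagonal (a : Fin m → ℝ) (b : Fin n → ℝ)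
    (K : Matrix (Fin m) (Fin n) ℝ) (ha : ∀ i, 0 < a i) (hb : ∀ j, 0 < b j) :
    (fromBlocks (diagonal a) K Kᵀ (diagonal b)).det
      = (∏ i, a i) * (∏ j, b j)
        * (1 - (normalizedCross a b K)ᵀ * normalizedCross a b K).det := by
  rw [fromBlocks_eq_normalizedCross a b K ha hb, det_mul, det_mul, det_fromBlocks_one₁₁,
    det_conjTranspose, det_diagonal, star_trivial]
  simp only [Fintype.prod_sum_type, Sum.elim_inl, Sum.elim_inr]
  have h1 : ∏ i, a i = (∏ i, Real.sqrt (a i)) * ∏ i, Real.sqrt (a i) := by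
    rw [← Finset.prod_mul_distrib]
    exact Finset.prod_congr rfl fun i _ => (Real.mul_self_sqrt (ha i).le).symm
  have h2 : ∏ i, b i = (∏ i, Real.sqrt (b i)) * ∏ i, Real.sqrt (b i) := by
    rw [← Finset.prod_mul_distrib]
    exact Finset.prod_congr rfl fun i _ => (Real.mul_self_sqrt (hb i).le).symm
  rw [h1, h2]
  ring

lemma posSemidef_one_sub_normalizedCross (a : Fin m → ℝ) (b : Fin n → ℝ)
    (K : Matrix (Fin m) (Fin n) ℝ) (ha : ∀ i, 0 < a i) (hb : ∀ j, 0 < b j) :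
    (fromBlocks (diagonal a) K Kᵀ (diagonal b)).PosSemidef
      ↔ (1 - (normalizedCross a b K)ᵀ * normalizedCross a b K).PosSemidef := by
  have h0 := fromBlocks_eq_normalizedCross a b K ha hb
  set D := diagonal (Sum.elim (fun i => Real.sqrt (a i)) fun j => Real.sqrt (b j)) with hD
  have hu : IsUnit D := by
    rw [isUnit_iff_isUnit_det, hD, det_diagonal, isUnit_iff_ne_zero, Finset.prod_ne_zero_iff]
    rintro (i | i) -
    · exact (Real.sqrt_pos.2 (ha i)).ne'
    · exact (Real.sqrt_pos.2 (hb i)).ne'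
  have : Invertible (1 : Matrix (Fin m) (Fin m) ℝ) := invertibleOne
  have h1 := PosDef.fromBlocks₁₁ (A := (1 : Matrix (Fin m) (Fin m) ℝ))
    (normalizedCross a b K) (1 : Matrix (Fin n) (Fin n) ℝ) PosDef.one
  rw [inv_one, Matrix.mul_one, conjTranspose_eq_transpose_of_trivial] at h1
  rw [h0, ← h1]
  exact Matrix.IsUnit.posSemidef_star_left_conjugate_iff hu

end Blocks

lemma sum_sq_eq_trace {m n : ℕ} (K : Matrix (Fin m) (Fin n) ℝ) :
    ∑ i, ∑ j, K i j ^ 2 = (K * Kᵀ).trace := by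
  simp [Matrix.trace, Matrix.mul_apply, sq]

lemma sum_sq_orthogonal_conj {m n : ℕ} (K : Matrix (Fin m) (Fin n) ℝ)
    (U : Matrix (Fin m) (Fin m) ℝ) (V : Matrix (Fin n) (Fin n) ℝ)
    (hU : Uᵀ * U = 1) (hV : Vᵀ * V = 1) :
    ∑ i, ∑ j, (U * K * Vᵀ) i j ^ 2 = ∑ i, ∑ j, K i j ^ 2 := by
  rw [sum_sq_eq_trace, sum_sq_eq_trace]
  have : U * K * Vᵀ * (U * K * Vᵀ)ᵀ = U * (K * Kᵀ) * Uᵀ := by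
    rw [transpose_mul, transpose_mul, transpose_transpose]
    simp only [Matrix.mul_assoc]
    rw [← Matrix.mul_assoc Vᵀ, hV, Matrix.one_mul]
  rw [this, trace_mul_comm, ← Matrix.mul_assoc, hU, Matrix.one_mul]

lemma sum_sq_diagonal {n : ℕ} (a : Fin n → ℝ) :
    ∑ i, ∑ j, (diagonal a) i j ^ 2 = ∑ i, a i ^ 2 := by
  simp [diagonal_apply, ite_pow]

lemma det_orthogonal_conj {ι : Type*} [Fintype ι] [DecidableEq ι] (U A : Matrix ι ι ℝ)
    (hU : Uᵀ * U = 1) : (U * A * Uᵀ).det = A.det := by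
  rw [det_mul, det_mul, mul_comm (det U), mul_assoc, ← det_mul, mul_eq_one_comm.1 hU, det_one,
    mul_one]

/-- Diagonalization of a positive definite matrix by ordered positive eigenvalues. -/
lemma PosDef.exists_antitone_spectral {n : ℕ} {A : Matrix (Fin n) (Fin n) ℝ} (hA : A.PosDef) :
    ∃ (U : Matrix (Fin n) (Fin n) ℝ) (a : Fin n → ℝ), Uᵀ * U = 1 ∧ U * Uᵀ = 1 ∧ Antitone a ∧
      (∀ i, 0 < a i) ∧ A = U * diagonal a * Uᵀ := by
  obtain ⟨U, a, hU1, hU2, ha, hA'⟩ := _root_.exists_antitone_spectral A hA.1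
  refine ⟨U, a, hU1, hU2, ha, ?_, hA'⟩
  have hu : IsUnit U := IsUnit.of_mul_eq_one _ hU2
  have h : (Uᵀ * A * U).PosDef := by
    have := hA.conjTranspose_mul_mul_same (mulVec_injective_of_isUnit hu)
    simpa using this
  have h2 : Uᵀ * A * U = diagonal a := by
    rw [hA']
    simp only [Matrix.mul_assoc, hU1, Matrix.mul_one]
    rw [← Matrix.mul_assoc, hU1, Matrix.one_mul]
  rw [h2, posDef_diagonal_iff] at h
  exact h

/-- Reduction of a positive definite block matrix to scalar data: ordered eigenvalues of the
diagonal blocks and squared canonical correlations. -/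
lemma exists_block_spectral_data {m n : ℕ} (hmn : n ≤ m) (A : Matrix (Fin m) (Fin m) ℝ)
    (B : Matrix (Fin n) (Fin n) ℝ) (K : Matrix (Fin m) (Fin n) ℝ) (hA : A.PosDef)
    (hB : B.PosDef) (hS : (fromBlocks A K Kᵀ B).PosDef) :
    ∃ (a : Fin m → ℝ) (b r : Fin n → ℝ), (∀ i, 0 < a i) ∧ (∀ j, 0 < b j) ∧ (∀ j, 0 ≤ r j) ∧
      (∀ j, r j < 1) ∧ ∑ i, ∑ j, A i j ^ 2 = ∑ i, a i ^ 2 ∧ ∑ i, ∑ j, B i j ^ 2 = ∑ j, b j ^ 2 ∧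
      ∑ i, ∑ j, K i j ^ 2 ≤ ∑ k, a (Fin.castLE hmn k) * b k * r k ∧
      A.det = ∏ i, a i ∧ B.det = ∏ j, b j ∧
      (fromBlocks A K Kᵀ B).det = (∏ i, a i) * (∏ j, b j) * ∏ j, (1 - r j) ∧
      (∀ l : Fin m → ℝ, Antitone l → (∀ i, 0 < l i) → ∑ i, a i / l i ≤ ∑ i, A i i / l i) ∧
      (∀ l : Fin n → ℝ, Antitone l → (∀ i, 0 < l i) → ∑ i, b i / l i ≤ ∑ i, B i i / l i) := by
  obtain ⟨U, a, hU1, hU2, ha, ha0, hAU⟩ := PosDef.exists_antitone_spectral hA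
  obtain ⟨V, b, hV1, hV2, hb, hb0, hBV⟩ := PosDef.exists_antitone_spectral hB
  set K' := Uᵀ * K * V with hK'
  have hK : K = U * K' * Vᵀ := by
    rw [hK']
    simp only [Matrix.mul_assoc, hV2, Matrix.mul_one]
    rw [← Matrix.mul_assoc, hU2, Matrix.one_mul]
  set W : Matrix (Fin m ⊕ Fin n) (Fin m ⊕ Fin n) ℝ := fromBlocks U 0 0 V with hW
  have hW1 : Wᵀ * W = 1 := by
    simp [hW, fromBlocks_transpose, fromBlocks_multiply, hU1, hV1]
  have hW2 : W * Wᵀ = 1 := mul_eq_one_comm.1 hW1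
  have hS' : fromBlocks A K Kᵀ B = W * fromBlocks (diagonal a) K' K'ᵀ (diagonal b) * Wᵀ := by
    have hKt : Kᵀ = V * K'ᵀ * Uᵀ := by
      rw [hK]; simp [transpose_mul, Matrix.mul_assoc]
    rw [hW, fromBlocks_transpose, fromBlocks_multiply, fromBlocks_multiply]
    simp [← hAU, ← hBV, ← hK, ← hKt]
  have hSd : (fromBlocks (diagonal a) K' K'ᵀ (diagonal b)).PosSemidef := by
    have h1 := hS.posSemidef.conjTranspose_mul_mul_same W
    have h2 : Wᴴ * fromBlocks A K Kᵀ B * W = fromBlocks (diagonal a) K' K'ᵀ (diagonal b) := by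
      rw [hS', conjTranspose_eq_transpose_of_trivial]
      simp only [Matrix.mul_assoc, hW1, Matrix.mul_one]
      rw [← Matrix.mul_assoc, hW1, Matrix.one_mul]
    rwa [h2] at h1
  set R := normalizedCross a b K' with hRdef
  have hpsd : (1 - Rᵀ * R).PosSemidef := (posSemidef_one_sub_normalizedCross a b K' ha0 hb0).1 hSd
  obtain ⟨Q, r, hQ1, hQ2, hr, hR⟩ := _root_.exists_antitone_spectral (Rᵀ * R) (by
    simpa using isHermitian_conjTranspose_mul_self R)
  have hcore : 1 - Rᵀ * R = Q * diagonal (fun j => 1 - r j) * Qᵀ := by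
    have : diagonal (fun j => 1 - r j) = 1 - diagonal r := by
      rw [← diagonal_one, diagonal_sub]
    rw [this, Matrix.mul_sub, Matrix.sub_mul, Matrix.mul_one, hQ2, hR]
  have hdet1 : (1 - Rᵀ * R).det = ∏ j, (1 - r j) := by
    rw [hcore, det_orthogonal_conj _ _ hQ1, det_diagonal]
  have hdetS : (fromBlocks A K Kᵀ B).det = (∏ i, a i) * (∏ j, b j) * ∏ j, (1 - r j) := by
    rw [hS', det_orthogonal_conj _ _ hW1, det_fromBlocks_diagonal a b K' ha0 hb0, ← hdet1]
  have hr0 : ∀ j, 0 ≤ r j := by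
    have h1 := (posSemidef_conjTranspose_mul_self R).conjTranspose_mul_mul_same Q
    have h2 : Qᴴ * (Rᴴ * R) * Q = diagonal r := by
      rw [conjTranspose_eq_transpose_of_trivial, conjTranspose_eq_transpose_of_trivial, hR]
      simp only [Matrix.mul_assoc, hQ1, Matrix.mul_one]
      rw [← Matrix.mul_assoc, hQ1, Matrix.one_mul]
    rw [h2, posSemidef_diagonal_iff] at h1
    exact h1
  have hr1 : ∀ j, r j < 1 := fun j => by
    have h1 := hpsd.conjTranspose_mul_mul_same Q
    have h2 : Qᴴ * (1 - Rᵀ * R) * Q = diagonal (fun j => 1 - r j) := by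
      rw [conjTranspose_eq_transpose_of_trivial, hcore]
      simp only [Matrix.mul_assoc, hQ1, Matrix.mul_one]
      rw [← Matrix.mul_assoc, hQ1, Matrix.one_mul]
    rw [h2, posSemidef_diagonal_iff] at h1
    have h3 : (1 - r j) ≠ 0 := by
      have := hS.det_pos.ne'
      rw [hdetS] at this
      exact (Finset.prod_ne_zero_iff.1 (right_ne_zero_of_mul this)) j (Finset.mem_univ j)
    have := lt_of_le_of_ne (h1 j) h3.symm
    linarith
  refine ⟨a, b, r, ha0, hb0, hr0, hr1, ?_, ?_, ?_, ?_, ?_, hdetS, ?_, ?_⟩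
  · rw [hAU, sum_sq_orthogonal_conj _ _ _ hU1 hU1, sum_sq_diagonal]
  · rw [hBV, sum_sq_orthogonal_conj _ _ _ hV1 hV1, sum_sq_diagonal]
  · rw [hK, sum_sq_orthogonal_conj _ _ _ hU1 hV1]
    refine le_trans (le_of_eq ?_) (sum_mul_mul_sq_le hmn R Q r hQ1 hQ2 hr hR a b ha
      (fun i => (ha0 i).le) hb (fun i => (hb0 i).le))
    refine Finset.sum_congr rfl fun i _ => Finset.sum_congr rfl fun j _ => ?_
    simp only [hRdef, normalizedCross, of_apply, div_pow, mul_pow, Real.sq_sqrt (ha0 i).le,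
      Real.sq_sqrt (hb0 j).le]
    have := (ha0 i).ne'
    have := (hb0 j).ne'
    field_simp
  · rw [hAU, det_orthogonal_conj _ _ hU1, det_diagonal]
  · rw [hBV, det_orthogonal_conj _ _ hV1, det_diagonal]
  · intro l hl hl0
    conv_rhs => rw [hAU]
    exact sum_div_le_sum_diag_div U a l hU1 ha (fun i => (ha0 i).le) hl hl0
  · intro l hl hl0
    conv_rhs => rw [hBV]
    exact sum_div_le_sum_diag_div V b l hV1 hb (fun i => (hb0 i).le) hl hl0

lemma sum_fin_eq_castLE_add {m n : ℕ} (hmn : n ≤ m) (f : Fin m → ℝ) :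
    ∑ i, f i = ∑ k : Fin n, f (Fin.castLE hmn k)
      + ∑ k ∈ Finset.univ.filter (fun k : Fin m => n ≤ (k : ℕ)), f k := by
  obtain ⟨d, rfl⟩ := Nat.exists_eq_add_of_le hmn
  rw [Finset.sum_filter, Fin.sum_univ_add, Fin.sum_univ_add]
  have h1 : ∀ x : Fin n, ¬ n ≤ (x : ℕ) := fun x => x.is_lt.not_ge
  simp [Fin.castAdd, h1]

/-- The finite-dimensional objective, as a function of the second-moment blocks. -/
noncomputable def gaussianObjective {m n : ℕ} (ε τ : ℝ) (lμ : Fin m → ℝ) (lν : Fin n → ℝ)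
    (A : Matrix (Fin m) (Fin m) ℝ) (B : Matrix (Fin n) (Fin n) ℝ)
    (K : Matrix (Fin m) (Fin n) ℝ) : ℝ :=
  ∑ i, ∑ j, A i j ^ 2 + ∑ i, ∑ j, B i j ^ 2 - 2 * ∑ i, ∑ j, K i j ^ 2
    + τ * (∑ i, A i i / lμ i - Real.log A.det + ∑ i, Real.log (lμ i) - m)
    + τ * (∑ j, B j j / lν j - Real.log B.det + ∑ j, Real.log (lν j) - n)
    + ε * (∑ i, A i i / lμ i + ∑ j, B j j / lν j - Real.log (fromBlocks A K Kᵀ B).det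
      + ∑ i, Real.log (lμ i) + ∑ j, Real.log (lν j) - m - n)

section Objective

variable {m n : ℕ} (hmn : n ≤ m) (ε τ : ℝ) (lμ : Fin m → ℝ) (lν : Fin n → ℝ)

/-- Regrouping of the objective coordinate by coordinate. -/
lemma objective_regroup (hlμpos : ∀ i, 0 < lμ i) (hlνpos : ∀ j, 0 < lν j)
    (g : ℝ → ℝ → ℝ → ℝ → ℝ)
    (hg : ∀ x y a b, g x y a b = x ^ 2 + y ^ 2
      + (τ + ε) * (x / a + y / b - Real.log (x * y / (a * b)) - 2)
      - 2 * max (x * y - ε / 2) 0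
      + ε * max (Real.log (x * y) - Real.log (ε / 2)) 0)
    (h : ℝ → ℝ → ℝ)
    (hh : ∀ x a, h x a = x ^ 2 + (τ + ε) * (x / a - Real.log (x / a) - 1))
    (a : Fin m → ℝ) (b : Fin n → ℝ) (ha : ∀ i, 0 < a i) (hb : ∀ j, 0 < b j) :
    ∑ k : Fin n, g (a (Fin.castLE hmn k)) (b k) (lμ (Fin.castLE hmn k)) (lν k)
      + ∑ k ∈ Finset.univ.filter (fun k : Fin m => n ≤ (k : ℕ)), h (a k) (lμ k)
      = ∑ i, a i ^ 2 + ∑ j, b j ^ 2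
        - ∑ k : Fin n, (2 * max (a (Fin.castLE hmn k) * b k - ε / 2) 0
          - ε * max (Real.log (a (Fin.castLE hmn k) * b k) - Real.log (ε / 2)) 0)
        + (τ + ε) * (∑ i, a i / lμ i - ∑ i, Real.log (a i) + ∑ i, Real.log (lμ i) - m)
        + (τ + ε) * (∑ j, b j / lν j - ∑ j, Real.log (b j) + ∑ j, Real.log (lν j) - n) := by
  have h1 : ∀ k : Fin n, g (a (Fin.castLE hmn k)) (b k) (lμ (Fin.castLE hmn k)) (lν k)
      = h (a (Fin.castLE hmn k)) (lμ (Fin.castLE hmn k)) + (b k ^ 2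
        + (τ + ε) * (b k / lν k - Real.log (b k) + Real.log (lν k) - 1)
        - (2 * max (a (Fin.castLE hmn k) * b k - ε / 2) 0
          - ε * max (Real.log (a (Fin.castLE hmn k) * b k) - Real.log (ε / 2)) 0)) := by
    intro k
    have e1 := (ha (Fin.castLE hmn k)).ne'
    have e2 := (hb k).ne'
    have e3 := (hlμpos (Fin.castLE hmn k)).ne'
    have e4 := (hlνpos k).ne'
    rw [hg, hh, Real.log_div (mul_ne_zero e1 e2) (mul_ne_zero e3 e4), Real.log_mul e3 e4,
      Real.log_div e1 e3, Real.log_mul e1 e2]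
    ring
  have h2 : ∑ i, h (a i) (lμ i) = ∑ i, a i ^ 2
      + (τ + ε) * (∑ i, a i / lμ i - ∑ i, Real.log (a i) + ∑ i, Real.log (lμ i) - m) := by
    have : ∀ i, h (a i) (lμ i) = a i ^ 2
        + (τ + ε) * (a i / lμ i - Real.log (a i) + Real.log (lμ i) - 1) := fun i => by
      rw [hh, Real.log_div (ha i).ne' (hlμpos i).ne']; ring
    simp only [this, Finset.sum_add_distrib, Finset.sum_sub_distrib, ← Finset.mul_sum]
    simp
  have h3 := sum_fin_eq_castLE_add hmn (fun i => h (a i) (lμ i))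
  simp only [h1, Finset.sum_add_distrib, Finset.sum_sub_distrib, ← Finset.mul_sum] at h2 h3 ⊢
  simp only [Finset.sum_const, Finset.card_univ, Fintype.card_fin, nsmul_eq_mul, mul_one] at h2 h3 ⊢
  linarith

lemma le_gaussianObjective (hε : 0 < ε) (hτ : 0 < τ)
    (hlμpos : ∀ i, 0 < lμ i) (hlνpos : ∀ j, 0 < lν j)
    (hlμmono : Antitone lμ) (hlνmono : Antitone lν)
    (g : ℝ → ℝ → ℝ → ℝ → ℝ)
    (hg : ∀ x y a b, g x y a b = x ^ 2 + y ^ 2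
      + (τ + ε) * (x / a + y / b - Real.log (x * y / (a * b)) - 2)
      - 2 * max (x * y - ε / 2) 0
      + ε * max (Real.log (x * y) - Real.log (ε / 2)) 0)
    (h : ℝ → ℝ → ℝ)
    (hh : ∀ x a, h x a = x ^ 2 + (τ + ε) * (x / a - Real.log (x / a) - 1))
    (xv : Fin m → ℝ) (yv : Fin n → ℝ)
    (hgmin : ∀ k : Fin n, ∀ x y : ℝ, 0 < x → 0 < y →
      g (xv (Fin.castLE hmn k)) (yv k) (lμ (Fin.castLE hmn k)) (lν k)
        ≤ g x y (lμ (Fin.castLE hmn k)) (lν k))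
    (hhmin : ∀ k : Fin m, n ≤ (k : ℕ) → ∀ x : ℝ, 0 < x → h (xv k) (lμ k) ≤ h x (lμ k))
    (A : Matrix (Fin m) (Fin m) ℝ)
    (B : Matrix (Fin n) (Fin n) ℝ) (K : Matrix (Fin m) (Fin n) ℝ) (hA : A.PosDef)
    (hB : B.PosDef) (hS : (fromBlocks A K Kᵀ B).PosDef) :
    ∑ k : Fin n, g (xv (Fin.castLE hmn k)) (yv k) (lμ (Fin.castLE hmn k)) (lν k)
      + ∑ k ∈ Finset.univ.filter (fun k : Fin m => n ≤ (k : ℕ)), h (xv k) (lμ k)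
      ≤ gaussianObjective ε τ lμ lν A B K := by
  obtain ⟨a, b, r, ha, hb, hr0, hr1, hA2, hB2, hK2, hAd, hBd, hSd, hAl, hBl⟩ :=
    exists_block_spectral_data hmn A B K hA hB hS
  have h1 : ∑ k : Fin n, g (xv (Fin.castLE hmn k)) (yv k) (lμ (Fin.castLE hmn k)) (lν k)
      + ∑ k ∈ Finset.univ.filter (fun k : Fin m => n ≤ (k : ℕ)), h (xv k) (lμ k)
      ≤ ∑ k : Fin n, g (a (Fin.castLE hmn k)) (b k) (lμ (Fin.castLE hmn k)) (lν k)
      + ∑ k ∈ Finset.univ.filter (fun k : Fin m => n ≤ (k : ℕ)), h (a k) (lμ k) :=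
    add_le_add (Finset.sum_le_sum fun k _ => hgmin k _ _ (ha _) (hb _))
      (Finset.sum_le_sum fun k hk => hhmin k (Finset.mem_filter.1 hk).2 _ (ha _))
  rw [objective_regroup hmn ε τ lμ lν hlμpos hlνpos g hg h hh a b ha hb] at h1
  refine h1.trans ?_
  have hla : Real.log (∏ i, a i) = ∑ i, Real.log (a i) :=
    Real.log_prod fun i _ => (ha i).ne'
  have hlb : Real.log (∏ i, b i) = ∑ i, Real.log (b i) :=
    Real.log_prod fun i _ => (hb i).ne'
  have hlr : Real.log (∏ j, (1 - r j)) = ∑ j, Real.log (1 - r j) :=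
    Real.log_prod fun i _ => (sub_pos.2 (hr1 i)).ne'
  have hpa : 0 < ∏ i, a i := Finset.prod_pos fun i _ => ha i
  have hpb : 0 < ∏ i, b i := Finset.prod_pos fun i _ => hb i
  have hpr : 0 < ∏ j, (1 - r j) := Finset.prod_pos fun i _ => sub_pos.2 (hr1 i)
  have hsc : ∑ k : Fin n, (2 * (a (Fin.castLE hmn k) * b k * r k) + ε * Real.log (1 - r k))
      ≤ ∑ k : Fin n, (2 * max (a (Fin.castLE hmn k) * b k - ε / 2) 0
          - ε * max (Real.log (a (Fin.castLE hmn k) * b k) - Real.log (ε / 2)) 0) :=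
    Finset.sum_le_sum fun k _ =>
      two_mul_add_log_le hε (mul_pos (ha _) (hb _)) (hr0 k) (hr1 k)
  rw [Finset.sum_add_distrib, ← Finset.mul_sum, ← Finset.mul_sum] at hsc
  rw [gaussianObjective, hA2, hB2, hAd, hBd, hSd, Real.log_mul (by positivity) hpr.ne',
    Real.log_mul hpa.ne' hpb.ne', hla, hlb, hlr]
  have e1 := mul_le_mul_of_nonneg_left (hAl lμ hlμmono hlμpos) (add_pos hτ hε).le
  have e2 := mul_le_mul_of_nonneg_left (hBl lν hlνmono hlνpos) (add_pos hτ hε).le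
  linarith

/-- Optimal squared canonical correlations. -/
noncomputable def optimalCross (xv : Fin m → ℝ) (yv : Fin n → ℝ) : Matrix (Fin m) (Fin n) ℝ :=
  Matrix.of fun i j => if (i : ℕ) = (j : ℕ) then
    Real.sqrt (max (1 - ε / (2 * xv i * yv j)) 0 * (xv i * yv j)) else 0

variable {ε} (xv : Fin m → ℝ) (yv : Fin n → ℝ)

lemma sum_ite_val_eq (hmn : n ≤ m) (f : Fin m → ℝ) (j : Fin n) :
    ∑ i : Fin m, (if (i : ℕ) = (j : ℕ) then f i else 0) = f (Fin.castLE hmn j) := by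
  rw [Finset.sum_eq_single (Fin.castLE hmn j)]
  · simp
  · intro i _ hi
    exact if_neg fun h => hi (Fin.ext (by simpa using h))
  · simp

include hmn in
lemma normalizedCross_optimalCross (hx : ∀ i, 0 < xv i) (hy : ∀ j, 0 < yv j) :
    (normalizedCross xv yv (optimalCross ε xv yv))ᵀ * normalizedCross xv yv (optimalCross ε xv yv)
      = diagonal fun k => max (1 - ε / (2 * (xv (Fin.castLE hmn k) * yv k))) 0 := by
  ext j k
  rw [Matrix.mul_apply]
  have h1 : ∀ i, normalizedCross xv yv (optimalCross ε xv yv) i j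
      = if (i : ℕ) = (j : ℕ) then Real.sqrt (max (1 - ε / (2 * (xv i * yv j))) 0) else 0 := by
    intro i
    simp only [normalizedCross, optimalCross, of_apply]
    split_ifs with h
    · rw [Real.sqrt_mul (le_max_right _ _), Real.sqrt_mul (hx i).le, mul_div_assoc, div_self,
        mul_one, mul_assoc]
      exact (mul_pos (Real.sqrt_pos.2 (hx i)) (Real.sqrt_pos.2 (hy j))).ne'
    · simp
  simp only [transpose_apply, h1, ite_mul, zero_mul]
  rw [sum_ite_val_eq hmn (fun i => Real.sqrt (max (1 - ε / (2 * (xv i * yv j))) 0) *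
    normalizedCross xv yv (optimalCross ε xv yv) i k)]
  by_cases hjk : j = k
  · subst hjk
    rw [h1, diagonal_apply_eq, if_pos (by simp), Real.mul_self_sqrt (le_max_right _ _)]
  · rw [diagonal_apply_ne _ hjk]
    simp only [normalizedCross, optimalCross, of_apply]
    rw [if_neg (by simpa [Fin.ext_iff] using hjk)]
    simp

lemma optimal_corr_lt_one (hε : 0 < ε) {z : ℝ} (hz : 0 < z) :
    max (1 - ε / (2 * z)) 0 < 1 := by
  have : 0 < ε / (2 * z) := by positivity
  exact max_lt (by linarith) one_pos

include hmn in
lemma det_optimal (hx : ∀ i, 0 < xv i) (hy : ∀ j, 0 < yv j) :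
    (fromBlocks (diagonal xv) (optimalCross ε xv yv) (optimalCross ε xv yv)ᵀ (diagonal yv)).det
      = (∏ i, xv i) * (∏ j, yv j)
        * ∏ k, (1 - max (1 - ε / (2 * (xv (Fin.castLE hmn k) * yv k))) 0) := by
  rw [det_fromBlocks_diagonal _ _ _ hx hy, normalizedCross_optimalCross hmn xv yv hx hy,
    ← diagonal_one, diagonal_sub, det_diagonal]

include hmn in
lemma posDef_optimal (hε : 0 < ε) (hx : ∀ i, 0 < xv i) (hy : ∀ j, 0 < yv j) :
    (fromBlocks (diagonal xv) (optimalCross ε xv yv) (optimalCross ε xv yv)ᵀ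
      (diagonal yv)).PosDef := by
  rw [PosSemidef.posDef_iff_isUnit, isUnit_iff_isUnit_det, isUnit_iff_ne_zero,
    det_optimal hmn xv yv hx hy]
  · refine (mul_pos (mul_pos (Finset.prod_pos fun i _ => hx i) (Finset.prod_pos fun i _ => hy i))
      (Finset.prod_pos fun k _ => sub_pos.2 ?_)).ne'
    exact optimal_corr_lt_one hε (mul_pos (hx _) (hy _))
  · rw [posSemidef_one_sub_normalizedCross _ _ _ hx hy,
      normalizedCross_optimalCross hmn xv yv hx hy, ← diagonal_one, diagonal_sub,
      posSemidef_diagonal_iff]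
    exact fun k => sub_nonneg.2 (optimal_corr_lt_one hε (mul_pos (hx _) (hy _))).le

lemma gaussianObjective_optimal (hε : 0 < ε)
    (hlμpos : ∀ i, 0 < lμ i) (hlνpos : ∀ j, 0 < lν j)
    (g : ℝ → ℝ → ℝ → ℝ → ℝ)
    (hg : ∀ x y a b, g x y a b = x ^ 2 + y ^ 2
      + (τ + ε) * (x / a + y / b - Real.log (x * y / (a * b)) - 2)
      - 2 * max (x * y - ε / 2) 0
      + ε * max (Real.log (x * y) - Real.log (ε / 2)) 0)
    (h : ℝ → ℝ → ℝ)
    (hh : ∀ x a, h x a = x ^ 2 + (τ + ε) * (x / a - Real.log (x / a) - 1))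
    (hx : ∀ i, 0 < xv i) (hy : ∀ j, 0 < yv j) :
    gaussianObjective ε τ lμ lν (diagonal xv) (diagonal yv) (optimalCross ε xv yv)
      = ∑ k : Fin n, g (xv (Fin.castLE hmn k)) (yv k) (lμ (Fin.castLE hmn k)) (lν k)
      + ∑ k ∈ Finset.univ.filter (fun k : Fin m => n ≤ (k : ℕ)), h (xv k) (lμ k) := by
  rw [objective_regroup hmn ε τ lμ lν hlμpos hlνpos g hg h hh xv yv hx hy, gaussianObjective,
    det_optimal hmn xv yv hx hy, sum_sq_diagonal, sum_sq_diagonal, det_diagonal, det_diagonal]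
  have hz : ∀ k, 0 < xv (Fin.castLE hmn k) * yv k := fun k => mul_pos (hx _) (hy _)
  have hla : Real.log (∏ i, xv i) = ∑ i, Real.log (xv i) :=
    Real.log_prod fun i _ => (hx i).ne'
  have hlb : Real.log (∏ i, yv i) = ∑ i, Real.log (yv i) :=
    Real.log_prod fun i _ => (hy i).ne'
  have hr1 := fun k => sub_pos.2 (optimal_corr_lt_one hε (hz k))
  have hlr := Real.log_prod (s := Finset.univ) fun k _ => (hr1 k).ne'
  have hpa : 0 < ∏ i, xv i := Finset.prod_pos fun i _ => hx i
  have hpb : 0 < ∏ i, yv i := Finset.prod_pos fun i _ => hy i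
  have hpr := Finset.prod_pos (s := Finset.univ) fun k _ => hr1 k
  rw [Real.log_mul (by positivity) hpr.ne', Real.log_mul hpa.ne' hpb.ne', hla, hlb, hlr]
  have hK : ∑ i, ∑ j, (optimalCross ε xv yv) i j ^ 2 = ∑ k, xv (Fin.castLE hmn k) * yv k
      * max (1 - ε / (2 * (xv (Fin.castLE hmn k) * yv k))) 0 := by
    rw [Finset.sum_comm]
    refine Finset.sum_congr rfl fun j _ => ?_
    rw [← sum_ite_val_eq hmn (fun i => xv i * yv j * max (1 - ε / (2 * (xv i * yv j))) 0)]
    refine Finset.sum_congr rfl fun i _ => ?_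
    simp only [optimalCross, of_apply]
    split_ifs
    · rw [Real.sq_sqrt (mul_nonneg (le_max_right _ _) (mul_pos (hx i) (hy j)).le), mul_assoc 2]
      ring
    · simp
  rw [hK]
  simp only [← fun k => two_mul_add_log_eq hε (hz k), Finset.sum_add_distrib, ← Finset.mul_sum,
    diagonal_apply_eq]
  ring

end Objective

lemma measurable_gaussianPdf {ι : Type*} [Fintype ι] [DecidableEq ι] (S : Matrix ι ι ℝ) :
    Measurable (gaussianPdf S) := by
  unfold gaussianPdf
  refine ENNReal.measurable_ofReal.comp (Continuous.measurable ?_)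
  simp only [dotProduct, mulVec]
  fun_prop

lemma gaussianPdf_one {ι : Type*} [Fintype ι] [DecidableEq ι] (x : ι → ℝ) :
    gaussianPdf (1 : Matrix ι ι ℝ) x
      = ENNReal.ofReal (∏ i, ProbabilityTheory.gaussianPDFReal 0 1 (x i)) := by
  unfold gaussianPdf ProbabilityTheory.gaussianPDFReal
  congr 1
  simp only [inv_one, one_mulVec, det_one, mul_one, sub_zero, NNReal.coe_one]
  rw [Finset.prod_mul_distrib, ← Real.exp_sum, Finset.prod_const, Finset.card_univ,
    inv_pow, div_eq_inv_mul, ← Finset.sum_div, Finset.sum_neg_distrib]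
  congr 2
  · rw [Real.sqrt_eq_iff_eq_sq (by positivity) (by positivity), pow_right_comm,
      Real.sq_sqrt (by positivity)]
  · simp [dotProduct, sq]

lemma gaussianMeasure_one {ι : Type*} [Fintype ι] [DecidableEq ι] :
    gaussianMeasure (1 : Matrix ι ι ℝ)
      = Measure.pi (fun _ : ι => ProbabilityTheory.gaussianReal 0 1) := by
  symm
  refine Measure.pi_eq fun s hs => ?_
  unfold gaussianMeasure
  rw [withDensity_apply _ (MeasurableSet.univ_pi hs), volume_pi, Measure.restrict_pi_pi]
  simp_rw [gaussianPdf_one]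
  have hint : ∀ i, Integrable (ProbabilityTheory.gaussianPDFReal 0 1)
      ((volume : Measure ℝ).restrict (s i)) := fun i =>
    (ProbabilityTheory.integrable_gaussianPDFReal 0 1).restrict
  rw [← ofReal_integral_eq_lintegral_ofReal (Integrable.fintype_prod hint)
    (ae_of_all _ fun x => Finset.prod_nonneg fun i _ =>
      ProbabilityTheory.gaussianPDFReal_nonneg 0 1 (x i)), integral_fintype_prod_eq_prod,
    ENNReal.ofReal_prod_of_nonneg fun i _ => integral_nonneg fun x =>
      ProbabilityTheory.gaussianPDFReal_nonneg 0 1 x]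
  refine Finset.prod_congr rfl fun i _ => ?_
  rw [ProbabilityTheory.gaussianReal_apply_eq_integral 0 one_ne_zero]

lemma map_mulVec_gaussianMeasure_one {ι : Type*} [Fintype ι] [DecidableEq ι]
    (R : Matrix ι ι ℝ) (hR : R.det ≠ 0) :
    (gaussianMeasure (1 : Matrix ι ι ℝ)).map (fun x => R *ᵥ x)
      = gaussianMeasure (R * Rᵀ) := by
  have hmeas : Measurable fun x : ι → ℝ => R *ᵥ x :=
    (Continuous.matrix_mulVec continuous_const continuous_id).measurable
  have hvol := Real.map_matrix_volume_pi_eq_smul_volume_pi hR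
  have hunit : IsUnit R.det := isUnit_iff_ne_zero.mpr hR
  ext s hs
  unfold gaussianMeasure
  rw [Measure.map_apply hmeas hs, withDensity_apply _ (hmeas hs), withDensity_apply _ hs]
  have hpdf : ∀ x : ι → ℝ, gaussianPdf (1 : Matrix ι ι ℝ) x
      = ENNReal.ofReal |R.det| * gaussianPdf (R * Rᵀ) (R *ᵥ x) := by
    intro x
    unfold gaussianPdf
    rw [← ENNReal.ofReal_mul (abs_nonneg _)]
    congr 1
    have h1 : (R * Rᵀ)⁻¹ *ᵥ (R *ᵥ x) = (Rᵀ)⁻¹ *ᵥ x := by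
      rw [mulVec_mulVec, Matrix.mul_inv_rev, Matrix.mul_assoc, nonsing_inv_mul _ hunit,
        Matrix.mul_one]
    have h2 : (R *ᵥ x) ⬝ᵥ ((Rᵀ)⁻¹ *ᵥ x) = x ⬝ᵥ x := by
      rw [dotProduct_comm, dotProduct_mulVec, vecMul_mulVec, ← transpose_nonsing_inv,
        transpose_transpose, nonsing_inv_mul _ hunit, vecMul_one]
    have h3 : Real.sqrt ((2 * Real.pi) ^ Fintype.card ι * (R * Rᵀ).det)
        = |R.det| * Real.sqrt ((2 * Real.pi) ^ Fintype.card ι) := by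
      rw [det_mul, det_transpose, mul_comm, Real.sqrt_mul (mul_self_nonneg _),
        Real.sqrt_mul_self_eq_abs]
    rw [h1, h2, h3]
    have : |R.det| ≠ 0 := abs_ne_zero.mpr hR
    simp only [inv_one, one_mulVec, det_one, mul_one]
    field_simp
  simp_rw [hpdf]
  rw [lintegral_const_mul (f := fun x => gaussianPdf (R * Rᵀ) (R *ᵥ x)) _
      ((measurable_gaussianPdf _).comp hmeas),
    ← setLIntegral_map hs (measurable_gaussianPdf _) hmeas]
  have : (fun x : ι → ℝ => R *ᵥ x) = ⇑(toLin' R) := by ext; simp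
  rw [this, hvol, Measure.restrict_smul, lintegral_smul_measure, smul_eq_mul, ← mul_assoc,
    ← ENNReal.ofReal_mul (abs_nonneg _), ← abs_mul, mul_inv_cancel₀ hR]
  simp

lemma map_toLp_gaussianMeasure {ι : Type*} [Fintype ι] [DecidableEq ι]
    {S : Matrix ι ι ℝ} (hS : S.PosDef) :
    (gaussianMeasure S).map (WithLp.toLp 2) = ProbabilityTheory.multivariateGaussian 0 S := by
  open scoped MatrixOrder in
  set R := CFC.sqrt S with hRdef
  have hRR : R * R = S := CFC.sqrt_mul_sqrt_self _ hS.posSemidef.nonneg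
  have hRT : Rᵀ = R := by
    have := (CFC.sqrt_nonneg S).isSelfAdjoint
    rwa [IsSelfAdjoint, star_eq_conjTranspose, conjTranspose_eq_transpose_of_trivial] at this
  have hdet : R.det ≠ 0 := by
    intro h0
    have := hS.det_pos
    rw [← hRR, det_mul, h0] at this
    simp at this
  have hmeas : Measurable fun x : ι → ℝ => R *ᵥ x :=
    (Continuous.matrix_mulVec continuous_const continuous_id).measurable
  have h1 := map_mulVec_gaussianMeasure_one R hdet
  rw [hRT, hRR, gaussianMeasure_one] at h1
  rw [← h1, ProbabilityTheory.multivariateGaussian, ← ProbabilityTheory.map_pi_eq_stdGaussian,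
    Measure.map_map (by fun_prop) hmeas, Measure.map_map (by fun_prop) (by fun_prop)]
  congr 1
  ext x i
  simp [hRdef]

lemma gaussianMeasure_eq_map_ofLp {ι : Type*} [Fintype ι] [DecidableEq ι]
    {S : Matrix ι ι ℝ} (hS : S.PosDef) :
    gaussianMeasure S = (ProbabilityTheory.multivariateGaussian 0 S).map WithLp.ofLp := by
  rw [← map_toLp_gaussianMeasure hS, Measure.map_map (by fun_prop) (by fun_prop)]
  exact Measure.map_id.symm

lemma isProbabilityMeasure_gaussianMeasure {ι : Type*} [Fintype ι] [DecidableEq ι]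
    {S : Matrix ι ι ℝ} (hS : S.PosDef) : IsProbabilityMeasure (gaussianMeasure S) := by
  rw [gaussianMeasure_eq_map_ofLp hS]
  exact Measure.isProbabilityMeasure_map (Measurable.aemeasurable (by fun_prop))

lemma memLp_eval_multivariateGaussian {ι : Type*} [Fintype ι] [DecidableEq ι]
    (S : Matrix ι ι ℝ) (i : ι) :
    MemLp (fun x : EuclideanSpace ℝ ι => x i) 2
      (ProbabilityTheory.multivariateGaussian 0 S) :=
  (ProbabilityTheory.IsGaussian.memLp_two_id
    (μ := ProbabilityTheory.multivariateGaussian 0 S)).continuousLinearMap_comp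
      (EuclideanSpace.proj (𝕜 := ℝ) i)

lemma integrable_mul_gaussianMeasure {ι : Type*} [Fintype ι] [DecidableEq ι]
    {S : Matrix ι ι ℝ} (hS : S.PosDef) (i j : ι) :
    Integrable (fun x : ι → ℝ => x i * x j) (gaussianMeasure S) := by
  rw [gaussianMeasure_eq_map_ofLp hS, integrable_map_measure
    (Measurable.aestronglyMeasurable (by fun_prop)) (Measurable.aemeasurable (by fun_prop))]
  exact (memLp_eval_multivariateGaussian S i).integrable_mul (memLp_eval_multivariateGaussian S j)

lemma integral_mul_gaussianMeasure {ι : Type*} [Fintype ι] [DecidableEq ι]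
    {S : Matrix ι ι ℝ} (hS : S.PosDef) (i j : ι) :
    ∫ x, x i * x j ∂(gaussianMeasure S) = S i j := by
  have hmean : ∀ k : ι, ∫ x : EuclideanSpace ℝ ι, x k
      ∂(ProbabilityTheory.multivariateGaussian 0 S) = 0 := by
    intro k
    have := ContinuousLinearMap.integral_comp_comm (EuclideanSpace.proj (𝕜 := ℝ) k)
      (ProbabilityTheory.IsGaussian.integrable_id
        (μ := ProbabilityTheory.multivariateGaussian 0 S))
    simpa using this
  have hcov := ProbabilityTheory.covariance_eval_multivariateGaussian
    (μ := (0 : EuclideanSpace ℝ ι)) hS.posSemidef i j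
  rw [ProbabilityTheory.covariance_eq_sub (memLp_eval_multivariateGaussian S i)
    (memLp_eval_multivariateGaussian S j), hmean, zero_mul, sub_zero] at hcov
  rw [gaussianMeasure_eq_map_ofLp hS, integral_map (Measurable.aemeasurable (by fun_prop))
    (Measurable.aestronglyMeasurable (by fun_prop))]
  exact hcov

lemma map_comp_gaussianMeasure {ι κ : Type*} [Fintype ι] [DecidableEq ι] [Fintype κ]
    [DecidableEq κ] {S : Matrix ι ι ℝ} (hS : S.PosDef) (e : κ → ι) (he : e.Injective) :
    (gaussianMeasure S).map (fun x => x ∘ e) = gaussianMeasure (S.submatrix e e) := by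
  have hSe : (S.submatrix e e).PosDef := hS.submatrix he
  have hmeas : Measurable fun x : ι → ℝ => x ∘ e := by
    unfold Function.comp; fun_prop
  have hprob := isProbabilityMeasure_gaussianMeasure hS
  refine (MeasurableEquiv.toLp 2 (κ → ℝ)).map_measurableEquiv_injective ?_
  change (Measure.map _ _).map (WithLp.toLp 2) = Measure.map (WithLp.toLp 2) _
  rw [map_toLp_gaussianMeasure hSe]
  have := Measure.isProbabilityMeasure_map (μ := gaussianMeasure S) hmeas.aemeasurable
  have := Measure.isProbabilityMeasure_map (μ := (gaussianMeasure S).map fun x => x ∘ e)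
    (Measurable.aemeasurable (f := WithLp.toLp (V := κ → ℝ) 2) (by fun_prop))
  refine Measure.ext_of_charFun (E := EuclideanSpace ℝ κ) (funext fun t => ?_)
  set C : Matrix κ ι ℝ := (1 : Matrix ι ι ℝ).submatrix e id with hC
  have hCx : ∀ x : ι → ℝ, x ∘ e = C *ᵥ x := by
    intro x; ext k; simp [hC, mulVec, dotProduct, Matrix.one_apply]
  have hCS : S.submatrix e e = C * S * Cᵀ := by
    ext k l; simp [hC, Matrix.mul_apply, Matrix.one_apply]
  rw [ProbabilityTheory.charFun_multivariateGaussian hSe.posSemidef, charFun_apply,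
    integral_map (Measurable.aemeasurable (by fun_prop))
      (Measurable.aestronglyMeasurable (by fun_prop)),
    integral_map hmeas.aemeasurable (Measurable.aestronglyMeasurable (by fun_prop))]
  have h2 := ProbabilityTheory.charFun_multivariateGaussian
    (μ := (0 : EuclideanSpace ℝ ι)) hS.posSemidef (WithLp.toLp 2 (Cᵀ *ᵥ t.ofLp))
  rw [← map_toLp_gaussianMeasure hS, charFun_apply,
    integral_map (Measurable.aemeasurable (by fun_prop))
      (Measurable.aestronglyMeasurable (by fun_prop))] at h2
  convert h2 using 2
  · ext x
    congr 3
    rw [EuclideanSpace.inner_eq_star_dotProduct, EuclideanSpace.inner_eq_star_dotProduct]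
    simp only [star_trivial, hCx]
    rw [dotProduct_mulVec, mulVec_transpose]
  · simp only [inner_zero_right, Complex.ofReal_zero, zero_mul, hCS]
    congr 4
    rw [mulVec_transpose, ← dotProduct_mulVec, mulVec_mulVec, ← mulVec_transpose,
      mulVec_mulVec]

lemma gaussianPdf_diagonal_sumElim {m n : ℕ} (l : Fin m → ℝ) (k : Fin n → ℝ)
    (hl : ∀ i, 0 < l i) (hk : ∀ j, 0 < k j) (x : Fin m → ℝ) (y : Fin n → ℝ) :
    gaussianPdf (diagonal (Sum.elim l k)) (Sum.elim x y)
      = gaussianPdf (diagonal l) x * gaussianPdf (diagonal k) y := by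
  have hinv : ∀ {κ : Type} [Fintype κ] [DecidableEq κ] (d z : κ → ℝ), (∀ i, 0 < d i) →
      z ⬝ᵥ ((diagonal d)⁻¹ *ᵥ z) = ∑ i, z i * (z i / d i) := by
    intro κ _ _ d z hd
    have : (diagonal d)⁻¹ = diagonal (fun i => (d i)⁻¹) := by
      refine inv_eq_right_inv ?_
      rw [diagonal_mul_diagonal, ← diagonal_one]
      congr 1; ext i; exact mul_inv_cancel₀ (hd i).ne'
    rw [this]
    simp [dotProduct, mulVec_diagonal, div_eq_inv_mul]
  unfold gaussianPdf
  rw [hinv _ _ (by rintro (i | j) <;> simp [hl, hk]), hinv _ _ hl, hinv _ _ hk,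
    ← ENNReal.ofReal_mul (by positivity)]
  congr 1
  rw [div_mul_div_comm, ← Real.exp_add, det_diagonal, det_diagonal, det_diagonal,
    Fintype.prod_sum_type, Fintype.sum_sum_type, Fintype.card_sum,
    ← Real.sqrt_mul (mul_nonneg (by positivity) (Finset.prod_nonneg fun i _ => (hl i).le))]
  simp only [Sum.elim_inl, Sum.elim_inr]
  congr 2
  · ring
  · rw [pow_add]; ring

lemma map_prod_gaussianMeasure_diagonal {m n : ℕ} (l : Fin m → ℝ) (k : Fin n → ℝ)
    (hl : ∀ i, 0 < l i) (hk : ∀ j, 0 < k j) :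
    ((gaussianMeasure (diagonal l)).prod (gaussianMeasure (diagonal k))).map
        (MeasurableEquiv.sumPiEquivProdPi (fun _ : Fin m ⊕ Fin n => ℝ)).symm
      = gaussianMeasure (diagonal (Sum.elim l k)) := by
  have hpres := volume_measurePreserving_sumPiEquivProdPi_symm (fun _ : Fin m ⊕ Fin n => ℝ)
  unfold gaussianMeasure
  have : SigmaFinite ((volume : Measure (Fin n → ℝ)).withDensity (gaussianPdf (diagonal k))) :=
    SigmaFinite.withDensity_of_ne_top (ae_of_all _ fun _ => ENNReal.ofReal_ne_top)
  rw [prod_withDensity (measurable_gaussianPdf _) (measurable_gaussianPdf _)]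
  ext s hs
  rw [Measure.map_apply (MeasurableEquiv.measurable _) hs, withDensity_apply _ hs,
    withDensity_apply _ ((MeasurableEquiv.measurable _) hs),
    ← hpres.setLIntegral_comp_preimage hs (measurable_gaussianPdf _)]
  refine lintegral_congr fun z => ?_
  rw [← gaussianPdf_diagonal_sumElim l k hl hk]
  congr 1

section RelativeEntropy

variable {X : Type*} [MeasurableSpace X] {α β : Measure X} [IsFiniteMeasure α] [IsFiniteMeasure β]

lemma rnDeriv_prod_self (hαβ : α ≪ β) :
    (α.prod α).rnDeriv (β.prod β) =ᵐ[α.prod α]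
      fun z => α.rnDeriv β z.1 * α.rnDeriv β z.2 := by
  have hac : α.prod α ≪ β.prod β := hαβ.prod hαβ
  refine hac.ae_le ?_
  have hm := Measure.measurable_rnDeriv α β
  have h1 : α.prod α = (β.prod β).withDensity
      fun z => α.rnDeriv β z.1 * α.rnDeriv β z.2 := by
    rw [← prod_withDensity hm hm, Measure.withDensity_rnDeriv_eq α β hαβ]
  have h2 := Measure.rnDeriv_withDensity (β.prod β)
    (f := fun z => α.rnDeriv β z.1 * α.rnDeriv β z.2)
    ((hm.comp measurable_fst).mul (hm.comp measurable_snd))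
  rwa [← h1] at h2

lemma toReal_rnDeriv_pos_ae (hαβ : α ≪ β) : ∀ᵐ x ∂α, 0 < (α.rnDeriv β x).toReal := by
  filter_upwards [Measure.rnDeriv_pos hαβ, hαβ.ae_le (Measure.rnDeriv_ne_top α β)] with x h1 h2
  exact ENNReal.toReal_pos h1.ne' h2

lemma log_rnDeriv_prod_self (hαβ : α ≪ β) :
    (fun z => Real.log ((α.prod α).rnDeriv (β.prod β) z).toReal) =ᵐ[α.prod α]
      fun z => Real.log (α.rnDeriv β z.1).toReal + Real.log (α.rnDeriv β z.2).toReal := by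
  have h1 := Measure.quasiMeasurePreserving_fst (μ := α) (ν := α) |>.ae (toReal_rnDeriv_pos_ae hαβ)
  have h2 := Measure.quasiMeasurePreserving_snd (μ := α) (ν := α) |>.ae (toReal_rnDeriv_pos_ae hαβ)
  filter_upwards [rnDeriv_prod_self hαβ, h1, h2] with z hz hz1 hz2
  rw [hz, ENNReal.toReal_mul, Real.log_mul hz1.ne' hz2.ne']

lemma integrable_log_rnDeriv_prod_self (hαβ : α ≪ β)
    (hint : Integrable (fun x => Real.log (α.rnDeriv β x).toReal) α) :
    Integrable (fun z => Real.log ((α.prod α).rnDeriv (β.prod β) z).toReal) (α.prod α) :=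
  (integrable_congr (log_rnDeriv_prod_self hαβ)).mpr
    ((hint.comp_fst α).add (hint.comp_snd α))

lemma integrable_log_rnDeriv_of_prod_self (hαβ : α ≪ β)
    (hint : Integrable (fun z => Real.log ((α.prod α).rnDeriv (β.prod β) z).toReal)
      (α.prod α)) :
    Integrable (fun x => Real.log (α.rnDeriv β x).toReal) α := by
  rcases eq_or_ne α 0 with h0 | h0
  · rw [h0]; exact integrable_zero_measure
  have h1 := ((integrable_congr (log_rnDeriv_prod_self hαβ)).mp hint).prod_right_ae
  have : NeZero α := ⟨h0⟩
  obtain ⟨x, hx⟩ := h1.exists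
  exact (hx.sub (integrable_const (Real.log (α.rnDeriv β x).toReal))).congr
    (ae_of_all _ fun y => by simp)

lemma KLgen_prod_self (hαβ : α ≪ β)
    (hint : Integrable (fun x => Real.log (α.rnDeriv β x).toReal) α) :
    KLgen (α.prod α) (β.prod β)
      = 2 * (α Set.univ).toReal * ∫ x, Real.log (α.rnDeriv β x).toReal ∂α
        + (β Set.univ).toReal ^ 2 - (α Set.univ).toReal ^ 2 := by
  unfold KLgen
  rw [integral_congr_ae (log_rnDeriv_prod_self hαβ),
    integral_add (hint.comp_fst α) (hint.comp_snd α),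
    integral_fun_fst (f := fun x => Real.log (α.rnDeriv β x).toReal),
    integral_fun_snd (f := fun x => Real.log (α.rnDeriv β x).toReal),
    ← Set.univ_prod_univ, Measure.prod_prod, Measure.prod_prod]
  simp only [ENNReal.toReal_mul, smul_eq_mul, Measure.real]
  ring

variable {f : X → ℝ}

lemma integrable_div_rnDeriv (hαβ : α ≪ β) (hf : Measurable f) (hf0 : ∀ x, 0 < f x)
    (hint : Integrable f β) :
    Integrable (fun x => f x / (α.rnDeriv β x).toReal) α ∧
      ∫ x, f x / (α.rnDeriv β x).toReal ∂α ≤ ∫ x, f x ∂β := by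
  have hm := Measure.measurable_rnDeriv α β
  have hmeas : Measurable fun x => f x / (α.rnDeriv β x).toReal := hf.div hm.ennreal_toReal
  have hle : ∫⁻ x, ENNReal.ofReal (f x / (α.rnDeriv β x).toReal) ∂α
      ≤ ∫⁻ x, ENNReal.ofReal (f x) ∂β := by
    rw [← lintegral_rnDeriv_mul hαβ (hmeas.ennreal_ofReal.aemeasurable)]
    refine lintegral_mono_ae ?_
    filter_upwards [Measure.rnDeriv_ne_top α β] with x hx
    rcases eq_or_ne (α.rnDeriv β x) 0 with h0 | h0
    · simp [h0]
    have hpos := ENNReal.toReal_pos h0 hx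
    conv_lhs => rw [← ENNReal.ofReal_toReal hx]
    rw [← ENNReal.ofReal_mul hpos.le, ENNReal.toReal_ofReal hpos.le,
      mul_div_cancel₀ _ hpos.ne']
  have hnn : ∀ x, 0 ≤ f x / (α.rnDeriv β x).toReal := fun x =>
    div_nonneg (hf0 x).le ENNReal.toReal_nonneg
  have htop : ∫⁻ x, ENNReal.ofReal (f x) ∂β ≠ ∞ := by
    rw [← ofReal_integral_eq_lintegral_ofReal hint (ae_of_all _ fun x => (hf0 x).le)]
    exact ENNReal.ofReal_ne_top
  refine ⟨⟨hmeas.aestronglyMeasurable, ?_⟩, ?_⟩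
  · rw [hasFiniteIntegral_iff_ofReal (ae_of_all _ hnn)]
    exact hle.trans_lt htop.lt_top
  · rw [integral_eq_lintegral_of_nonneg_ae (ae_of_all _ hnn) hmeas.aestronglyMeasurable,
      integral_eq_lintegral_of_nonneg_ae (ae_of_all _ fun x => (hf0 x).le)
        hf.aestronglyMeasurable]
    exact ENNReal.toReal_mono htop hle

lemma log_le_log_rnDeriv_add (hαβ : α ≪ β) (hf0 : ∀ x, 0 < f x) :
    ∀ᵐ x ∂α, Real.log (f x)
      ≤ Real.log (α.rnDeriv β x).toReal + f x / (α.rnDeriv β x).toReal - 1 := by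
  filter_upwards [toReal_rnDeriv_pos_ae hαβ] with x hx
  have := Real.log_le_sub_one_of_pos (div_pos (hf0 x) hx)
  rw [Real.log_div (hf0 x).ne' hx.ne'] at this
  linarith

lemma integrable_log_of_le {c : ℝ} (hαβ : α ≪ β) (hf : Measurable f) (hf0 : ∀ x, 0 < f x)
    (hint : Integrable f β) (hlog : Integrable (fun x => Real.log (α.rnDeriv β x).toReal) α)
    (hc : ∀ x, c ≤ Real.log (f x)) :
    Integrable (fun x => Real.log (f x)) α := by
  have h1 : Integrable (fun x => Real.log (α.rnDeriv β x).toReal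
      + f x / (α.rnDeriv β x).toReal - 1) α :=
    (hlog.add (integrable_div_rnDeriv hαβ hf hf0 hint).1).sub (integrable_const 1)
  exact integrable_of_le_of_le (Real.measurable_log.comp hf).aestronglyMeasurable
    (ae_of_all _ hc) (log_le_log_rnDeriv_add hαβ hf0) (integrable_const c) h1

/-- Gibbs' inequality for finite measures. -/
lemma integral_log_le_integral_log_rnDeriv (hαβ : α ≪ β) (hf : Measurable f)
    (hf0 : ∀ x, 0 < f x) (hint : Integrable f β)
    (hlog : Integrable (fun x => Real.log (α.rnDeriv β x).toReal) α)
    (hlogf : Integrable (fun x => Real.log (f x)) α) :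
    ∫ x, Real.log (f x) ∂α ≤ ∫ x, Real.log (α.rnDeriv β x).toReal ∂α
      + ∫ x, f x ∂β - (α Set.univ).toReal := by
  have hdiv := integrable_div_rnDeriv hαβ hf hf0 hint
  have hsum : Integrable (fun x => Real.log (α.rnDeriv β x).toReal
      + f x / (α.rnDeriv β x).toReal) α := hlog.add hdiv.1
  have h1 := integral_mono_ae (g := fun x => Real.log (α.rnDeriv β x).toReal
      + f x / (α.rnDeriv β x).toReal - 1) hlogf (hsum.sub (integrable_const (1 : ℝ)))
    (log_le_log_rnDeriv_add hαβ hf0)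
  rw [integral_sub hsum (integrable_const _), integral_add hlog hdiv.1] at h1
  simp only [integral_const, smul_eq_mul, mul_one, Measure.real] at h1
  linarith [hdiv.2]

end RelativeEntropy

section GaussianEntropy

variable {ι : Type*}

/-- Matrix of second moments of a measure on `ι → ℝ`. -/
noncomputable def secondMoment (α : Measure (ι → ℝ)) : Matrix ι ι ℝ :=
  Matrix.of fun i j => ∫ x, x i * x j ∂α

variable [Fintype ι]

lemma quadratic_eq_sum (T : Matrix ι ι ℝ) (x : ι → ℝ) :
    x ⬝ᵥ (T *ᵥ x) = ∑ i, ∑ j, T i j * (x i * x j) := by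
  simp only [dotProduct, mulVec, Finset.mul_sum]
  exact Finset.sum_congr rfl fun i _ => Finset.sum_congr rfl fun j _ => by ring

section

variable {α : Measure (ι → ℝ)}

lemma integrable_quadratic (hα : ∀ i j, Integrable (fun x : ι → ℝ => x i * x j) α)
    (T : Matrix ι ι ℝ) : Integrable (fun x : ι → ℝ => x ⬝ᵥ (T *ᵥ x)) α := by
  simp only [quadratic_eq_sum]
  exact integrable_finsetSum _ fun i _ => integrable_finsetSum _ fun j _ => (hα i j).const_mul _

lemma integral_quadratic (hα : ∀ i j, Integrable (fun x : ι → ℝ => x i * x j) α)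
    (T : Matrix ι ι ℝ) :
    ∫ x, x ⬝ᵥ (T *ᵥ x) ∂α = ∑ i, ∑ j, T i j * secondMoment α i j := by
  simp only [quadratic_eq_sum]
  refine (integral_finsetSum _ fun i _ =>
    integrable_finsetSum _ fun j _ => (hα i j).const_mul _).trans ?_
  refine Finset.sum_congr rfl fun i _ => ?_
  refine (integral_finsetSum _ fun j _ => (hα i j).const_mul _).trans ?_
  exact Finset.sum_congr rfl fun j _ => integral_const_mul _ _

end

variable [DecidableEq ι]

/-- Logarithm of the density of `N(0, T)` with respect to `N(0, diag l)`. -/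
noncomputable def logRatio (l : ι → ℝ) (T : Matrix ι ι ℝ) (x : ι → ℝ) : ℝ :=
  ((∑ i, Real.log (l i) - Real.log T.det) + (∑ i, x i * x i / l i - x ⬝ᵥ (T⁻¹ *ᵥ x))) / 2

/-- Twice the relative entropy of `N(0, T)` with respect to `N(0, diag l)`. -/
noncomputable def gaussianEntropy (l : ι → ℝ) (T : Matrix ι ι ℝ) : ℝ :=
  ∑ i, T i i / l i - Real.log T.det + ∑ i, Real.log (l i) - Fintype.card ι

lemma measurable_logRatio (l : ι → ℝ) (T : Matrix ι ι ℝ) : Measurable (logRatio l T) := by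
  refine Continuous.measurable ?_
  unfold logRatio
  simp only [dotProduct, mulVec]
  fun_prop

lemma gaussianPdf_eq_mul_exp_logRatio {l : ι → ℝ} (hl : ∀ i, 0 < l i) {T : Matrix ι ι ℝ}
    (hT : T.PosDef) (x : ι → ℝ) :
    gaussianPdf T x
      = gaussianPdf (diagonal l) x * ENNReal.ofReal (Real.exp (logRatio l T x)) := by
  have hinv : (diagonal l)⁻¹ = diagonal (fun i => (l i)⁻¹) := by
    refine inv_eq_right_inv ?_
    rw [diagonal_mul_diagonal, ← diagonal_one]
    congr 1; ext i; exact mul_inv_cancel₀ (hl i).ne'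
  have hquad : x ⬝ᵥ ((diagonal l)⁻¹ *ᵥ x) = ∑ i, x i * x i / l i := by
    rw [hinv]
    simp only [dotProduct, mulVec_diagonal]
    exact Finset.sum_congr rfl fun i _ => by ring
  have hdl : 0 < (diagonal l).det := by
    rw [det_diagonal]; exact Finset.prod_pos fun i _ => hl i
  have hlog : ∑ i, Real.log (l i) = Real.log (diagonal l).det := by
    rw [det_diagonal, Real.log_prod fun i _ => (hl i).ne']
  have hsqrt : ∀ d : ℝ, 0 < d → Real.sqrt ((2 * Real.pi) ^ Fintype.card ι * d)
      = Real.sqrt ((2 * Real.pi) ^ Fintype.card ι) * Real.exp (Real.log d / 2) := by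
    intro d hd
    rw [Real.sqrt_mul (by positivity), Real.exp_half, Real.exp_log hd]
  unfold gaussianPdf
  rw [← ENNReal.ofReal_mul (by positivity)]
  congr 1
  rw [hsqrt _ hT.det_pos, hsqrt _ hdl, hquad, div_mul_eq_mul_div, ← Real.exp_add, logRatio, hlog]
  rw [div_eq_div_iff (by positivity) (by positivity), mul_left_comm, mul_left_comm (Real.exp _),
    ← Real.exp_add, ← Real.exp_add]
  congr 2
  ring

lemma smul_gaussianMeasure_eq_withDensity {l : ι → ℝ} (hl : ∀ i, 0 < l i) {T : Matrix ι ι ℝ}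
    (hT : T.PosDef) {a c : ℝ} (ha : 0 < a) (hc : 0 < c) :
    ENNReal.ofReal a • gaussianMeasure T
      = (ENNReal.ofReal c • gaussianMeasure (diagonal l)).withDensity
        fun x => ENNReal.ofReal (a / c * Real.exp (logRatio l T x)) := by
  have hm : Measurable fun x => ENNReal.ofReal (Real.exp (logRatio l T x)) :=
    (Real.measurable_exp.comp (measurable_logRatio l T)).ennreal_ofReal
  have h1 : gaussianMeasure T = (gaussianMeasure (diagonal l)).withDensity
      fun x => ENNReal.ofReal (Real.exp (logRatio l T x)) := by
    unfold gaussianMeasure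
    rw [← withDensity_mul _ (measurable_gaussianPdf _) hm]
    congr 1
    ext x
    exact gaussianPdf_eq_mul_exp_logRatio hl hT x
  simp_rw [ENNReal.ofReal_mul (div_pos ha hc).le]
  rw [withDensity_smul_measure, h1]
  have h2 := withDensity_smul (μ := gaussianMeasure (diagonal l)) (ENNReal.ofReal (a / c)) hm
  simp only [Pi.smul_def, smul_eq_mul] at h2
  rw [h2, smul_smul, ← ENNReal.ofReal_mul hc.le, mul_div_cancel₀ _ hc.ne']

lemma integrable_exp_logRatio {l : ι → ℝ} (hl : ∀ i, 0 < l i) {T : Matrix ι ι ℝ}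
    (hT : T.PosDef) {a c : ℝ} (ha : 0 < a) (hc : 0 < c) :
    Integrable (fun x => a / c * Real.exp (logRatio l T x))
        (ENNReal.ofReal c • gaussianMeasure (diagonal l)) ∧
      ∫ x, a / c * Real.exp (logRatio l T x)
        ∂(ENNReal.ofReal c • gaussianMeasure (diagonal l)) = a := by
  have hm : Measurable fun x => a / c * Real.exp (logRatio l T x) :=
    (Real.measurable_exp.comp (measurable_logRatio l T)).const_mul _
  have hnn : ∀ x, 0 ≤ a / c * Real.exp (logRatio l T x) := fun x => by positivity
  have hprob := isProbabilityMeasure_gaussianMeasure hT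
  have h1 : ∫⁻ x, ENNReal.ofReal (a / c * Real.exp (logRatio l T x))
      ∂(ENNReal.ofReal c • gaussianMeasure (diagonal l)) = ENNReal.ofReal a := by
    rw [← setLIntegral_univ, ← withDensity_apply _ MeasurableSet.univ,
      ← smul_gaussianMeasure_eq_withDensity hl hT ha hc]
    simp
  refine ⟨⟨hm.aestronglyMeasurable, ?_⟩, ?_⟩
  · rw [hasFiniteIntegral_iff_ofReal (ae_of_all _ hnn), h1]
    exact ENNReal.ofReal_lt_top
  · rw [integral_eq_lintegral_of_nonneg_ae (ae_of_all _ hnn) hm.aestronglyMeasurable, h1,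
      ENNReal.toReal_ofReal ha.le]

lemma isFiniteMeasure_smul_gaussianMeasure {T : Matrix ι ι ℝ} (hT : T.PosDef) (c : ℝ) :
    IsFiniteMeasure (ENNReal.ofReal c • gaussianMeasure T) := by
  have := isProbabilityMeasure_gaussianMeasure hT
  exact Measure.smul_finite _ ENNReal.ofReal_ne_top

variable {α : Measure (ι → ℝ)} [IsFiniteMeasure α]

lemma integrable_logRatio (hα : ∀ i j, Integrable (fun x : ι → ℝ => x i * x j) α)
    (l : ι → ℝ) (T : Matrix ι ι ℝ) : Integrable (logRatio l T) α :=
  ((integrable_const _).add ((integrable_finsetSum _ fun i _ => (hα i i).div_const _).sub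
    (integrable_quadratic hα _))).div_const 2

lemma integral_logRatio (hα : ∀ i j, Integrable (fun x : ι → ℝ => x i * x j) α)
    (l : ι → ℝ) {T : Matrix ι ι ℝ} (hT : T.PosDef)
    (hM : secondMoment α = (α Set.univ).toReal • T) :
    ∫ x, logRatio l T x ∂α = (α Set.univ).toReal * gaussianEntropy l T / 2 := by
  have hsum : Integrable (fun x : ι → ℝ => ∑ i, x i * x i / l i) α :=
    integrable_finsetSum _ fun i _ => (hα i i).div_const _
  have hq := integrable_quadratic hα T⁻¹
  have htr : ∑ i, ∑ j, T⁻¹ i j * secondMoment α i j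
      = (α Set.univ).toReal * Fintype.card ι := by
    rw [hM]
    have hsymm : ∀ i j, T i j = T j i := fun i j => by
      simpa using (hT.isHermitian.apply i j).symm
    have h1 : ∑ i, ∑ j, T⁻¹ i j * T i j = (T⁻¹ * T).trace := by
      simp only [Matrix.trace, Matrix.mul_apply, diag_apply]
      exact Finset.sum_congr rfl fun i _ => Finset.sum_congr rfl fun j _ => by rw [hsymm i j]
    rw [nonsing_inv_mul _ (isUnit_iff_ne_zero.mpr hT.det_pos.ne'), trace_one] at h1
    rw [← h1, Finset.mul_sum]
    refine Finset.sum_congr rfl fun i _ => ?_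
    rw [Finset.mul_sum]
    exact Finset.sum_congr rfl fun j _ => by simp only [Matrix.smul_apply, smul_eq_mul]; ring
  have hdiag : ∫ x, ∑ i, x i * x i / l i ∂α = (α Set.univ).toReal * ∑ i, T i i / l i := by
    rw [integral_finsetSum _ fun i _ => (hα i i).div_const _, Finset.mul_sum]
    refine Finset.sum_congr rfl fun i _ => ?_
    have : ∫ x, x i * x i ∂α = secondMoment α i i := rfl
    rw [integral_div, this, hM]
    simp only [Matrix.smul_apply, smul_eq_mul]; ring
  have hdiff : Integrable (fun x : ι → ℝ => ∑ i, x i * x i / l i - x ⬝ᵥ (T⁻¹ *ᵥ x)) α :=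
    hsum.sub hq
  unfold logRatio gaussianEntropy
  rw [integral_div, integral_add (integrable_const _) hdiff, integral_sub hsum hq,
    integral_quadratic hα, htr, hdiag]
  simp only [integral_const, Measure.real, smul_eq_mul]
  ring

lemma integrable_mul_of_integrable_log_rnDeriv {l : ι → ℝ} (hl : ∀ i, 0 < l i) {c : ℝ}
    (hc : 0 < c) (hac : α ≪ ENNReal.ofReal c • gaussianMeasure (diagonal l))
    (hlog : Integrable (fun x => Real.log
      (α.rnDeriv (ENNReal.ofReal c • gaussianMeasure (diagonal l)) x).toReal) α) (i j : ι) :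
    Integrable (fun x : ι → ℝ => x i * x j) α := by
  have hD : (diagonal l).PosDef := PosDef.diagonal hl
  have hfin := isFiniteMeasure_smul_gaussianMeasure hD c
  have h2l : ∀ i, 0 < 2 * l i := fun i => by linarith [hl i]
  have hD2 : (diagonal fun i => 2 * l i).PosDef := PosDef.diagonal h2l
  have hinv : (diagonal fun i => 2 * l i)⁻¹ = diagonal (fun i => (2 * l i)⁻¹) := by
    refine inv_eq_right_inv ?_
    rw [diagonal_mul_diagonal, ← diagonal_one]
    congr 1; ext i; exact mul_inv_cancel₀ (h2l i).ne'
  obtain ⟨k, hk⟩ : ∃ k : ℝ, ∀ x : ι → ℝ, logRatio l (diagonal fun i => 2 * l i) x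
      = k + ∑ i, x i * x i / l i / 4 := by
    refine ⟨(∑ i, Real.log (l i) - Real.log (diagonal fun i => 2 * l i).det) / 2, fun x => ?_⟩
    have : ∑ i, x i * x i / l i - x ⬝ᵥ ((diagonal fun i => 2 * l i)⁻¹ *ᵥ x)
        = 2 * ∑ i, x i * x i / l i / 4 := by
      rw [hinv]
      simp only [dotProduct, mulVec_diagonal]
      rw [← Finset.sum_sub_distrib, Finset.mul_sum]
      refine Finset.sum_congr rfl fun i _ => ?_
      have := (hl i).ne'
      field_simp
      ring
    rw [logRatio, this]
    ring
  have hint := integrable_exp_logRatio hl hD2 one_pos one_pos (a := 1) (c := 1)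
  have hint' := (integrable_exp_logRatio hl hD2 hc hc).1
  simp only [div_self hc.ne', one_mul] at hint'
  have hterm : ∀ (x : ι → ℝ) (i : ι), 0 ≤ x i * x i / l i / 4 := fun x i =>
    div_nonneg (div_nonneg (mul_self_nonneg _) (hl i).le) (by norm_num)
  have h1 := integrable_log_of_le (c := k) hac
    (Real.measurable_exp.comp (measurable_logRatio l (diagonal fun i => 2 * l i)))
    (fun x => Real.exp_pos _) hint' hlog (fun x => by
      simp only [Function.comp, Real.log_exp, hk]
      linarith [Finset.sum_nonneg fun i (_ : i ∈ Finset.univ) => hterm x i])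
  simp only [Function.comp, Real.log_exp, hk] at h1
  have h3 : Integrable (fun x : ι → ℝ => ∑ i, x i * x i / l i / 4) α := by
    refine (h1.sub (integrable_const k)).congr (ae_of_all _ fun x => ?_)
    simp
  have hsq : ∀ i, Integrable (fun x : ι → ℝ => x i * x i) α := by
    intro i
    refine (h3.const_mul (4 * l i)).mono' (Measurable.aestronglyMeasurable (by fun_prop))
      (ae_of_all _ fun x => ?_)
    rw [Real.norm_of_nonneg (mul_self_nonneg _)]
    have := Finset.single_le_sum (fun i _ => hterm x i) (Finset.mem_univ i)
    calc x i * x i = 4 * l i * (x i * x i / l i / 4) := by have := (hl i).ne'; field_simp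
      _ ≤ _ := mul_le_mul_of_nonneg_left this (by linarith [hl i])
  refine ((hsq i).add (hsq j)).mono' (Measurable.aestronglyMeasurable (by fun_prop))
    (ae_of_all _ fun x => ?_)
  simp only [Pi.add_apply, Real.norm_eq_abs, abs_mul]
  nlinarith [sq_nonneg (|x i| - |x j|), abs_mul_abs_self (x i), abs_mul_abs_self (x j),
    mul_self_nonneg (x i), mul_self_nonneg (x j)]

lemma le_KLgen_prod_gaussian {l : ι → ℝ} (hl : ∀ i, 0 < l i) {c : ℝ}
    (hc : 0 < c) (hac : α ≪ ENNReal.ofReal c • gaussianMeasure (diagonal l))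
    (hlog : Integrable (fun x => Real.log
      (α.rnDeriv (ENNReal.ofReal c • gaussianMeasure (diagonal l)) x).toReal) α)
    (ha : 0 < (α Set.univ).toReal) {T : Matrix ι ι ℝ} (hT : T.PosDef)
    (hM : secondMoment α = (α Set.univ).toReal • T) :
    (α Set.univ).toReal ^ 2 * gaussianEntropy l T
      + ((α Set.univ).toReal ^ 2 * Real.log ((α Set.univ).toReal ^ 2 / c ^ 2)
        - (α Set.univ).toReal ^ 2 + c ^ 2)
      ≤ KLgen (α.prod α) ((ENNReal.ofReal c • gaussianMeasure (diagonal l)).prod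
          (ENNReal.ofReal c • gaussianMeasure (diagonal l))) := by
  have hD : (diagonal l).PosDef := PosDef.diagonal hl
  have hfin := isFiniteMeasure_smul_gaussianMeasure hD c
  have hprob := isProbabilityMeasure_gaussianMeasure hD
  have hα := integrable_mul_of_integrable_log_rnDeriv hl hc hac hlog
  rw [KLgen_prod_self hac hlog]
  set a := (α Set.univ).toReal with hadef
  have hlogh : ∀ x : ι → ℝ, Real.log (a / c * Real.exp (logRatio l T x))
      = Real.log (a / c) + logRatio l T x := fun x => by
    rw [Real.log_mul (div_pos ha hc).ne' (Real.exp_pos _).ne', Real.log_exp]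
  have hR := integrable_logRatio hα l T
  have h1 := integral_log_le_integral_log_rnDeriv hac
    ((Real.measurable_exp.comp (measurable_logRatio l T)).const_mul (a / c))
    (fun x => by have := div_pos ha hc; simp only [Function.comp]; positivity)
    (integrable_exp_logRatio hl hT ha hc).1 hlog
    (by simp only [Function.comp, hlogh]; exact (integrable_const _).add hR)
  simp only [Function.comp, hlogh] at h1
  rw [(integrable_exp_logRatio hl hT ha hc).2, integral_add (integrable_const _) hR,
    integral_logRatio hα l hT hM] at h1
  simp only [integral_const, Measure.real, smul_eq_mul, ← hadef] at h1
  have h2 : Real.log (a ^ 2 / c ^ 2) = 2 * Real.log (a / c) := by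
    rw [← div_pow, Real.log_pow]; norm_num
  have h3 : ((ENNReal.ofReal c • gaussianMeasure (diagonal l)) Set.univ).toReal = c := by
    simp [hc.le]
  rw [h2, h3]
  nlinarith [mul_le_mul_of_nonneg_left h1 ha.le]

lemma rnDeriv_smul_gaussianMeasure {l : ι → ℝ} (hl : ∀ i, 0 < l i) {T : Matrix ι ι ℝ}
    (hT : T.PosDef) {a c : ℝ} (ha : 0 < a) (hc : 0 < c) :
    ENNReal.ofReal a • gaussianMeasure T ≪ ENNReal.ofReal c • gaussianMeasure (diagonal l) ∧
    (fun x => Real.log ((ENNReal.ofReal a • gaussianMeasure T).rnDeriv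
      (ENNReal.ofReal c • gaussianMeasure (diagonal l)) x).toReal)
      =ᵐ[ENNReal.ofReal a • gaussianMeasure T] fun x => Real.log (a / c) + logRatio l T x := by
  have hfin := isFiniteMeasure_smul_gaussianMeasure (PosDef.diagonal hl) c
  have heq := smul_gaussianMeasure_eq_withDensity hl hT ha hc
  have hac : ENNReal.ofReal a • gaussianMeasure T
      ≪ ENNReal.ofReal c • gaussianMeasure (diagonal l) := by
    rw [heq]; exact withDensity_absolutelyContinuous _ _
  refine ⟨hac, ?_⟩
  have hm : Measurable fun x => a / c * Real.exp (logRatio l T x) :=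
    (Real.measurable_exp.comp (measurable_logRatio l T)).const_mul _
  have h1 := Measure.rnDeriv_withDensity
    (ENNReal.ofReal c • gaussianMeasure (diagonal l)) hm.ennreal_ofReal
  rw [← heq] at h1
  filter_upwards [hac.ae_le h1] with x hx
  rw [hx, ENNReal.toReal_ofReal (by positivity),
    Real.log_mul (div_pos ha hc).ne' (Real.exp_pos _).ne', Real.log_exp]

lemma integrable_mul_smul_gaussianMeasure {T : Matrix ι ι ℝ} (hT : T.PosDef) (a : ℝ) (i j : ι) :
    Integrable (fun x : ι → ℝ => x i * x j) (ENNReal.ofReal a • gaussianMeasure T) :=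
  (integrable_mul_gaussianMeasure hT i j).smul_measure ENNReal.ofReal_ne_top

lemma secondMoment_smul_gaussianMeasure {T : Matrix ι ι ℝ} (hT : T.PosDef) {a : ℝ} (ha : 0 < a) :
    secondMoment (ENNReal.ofReal a • gaussianMeasure T) = a • T := by
  ext i j
  simp only [secondMoment, of_apply, integral_smul_measure, ENNReal.toReal_ofReal ha.le,
    integral_mul_gaussianMeasure hT, Matrix.smul_apply]

lemma smul_gaussianMeasure_univ {T : Matrix ι ι ℝ} (hT : T.PosDef) {a : ℝ} (ha : 0 < a) :
    ((ENNReal.ofReal a • gaussianMeasure T) Set.univ).toReal = a := by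
  have := isProbabilityMeasure_gaussianMeasure hT
  simp [ha.le]

lemma integrable_log_rnDeriv_smul_gaussianMeasure {l : ι → ℝ} (hl : ∀ i, 0 < l i)
    {T : Matrix ι ι ℝ} (hT : T.PosDef) {a c : ℝ} (ha : 0 < a) (hc : 0 < c) :
    Integrable (fun x => Real.log ((ENNReal.ofReal a • gaussianMeasure T).rnDeriv
      (ENNReal.ofReal c • gaussianMeasure (diagonal l)) x).toReal)
      (ENNReal.ofReal a • gaussianMeasure T) := by
  have := isFiniteMeasure_smul_gaussianMeasure hT a
  refine (integrable_congr (rnDeriv_smul_gaussianMeasure hl hT ha hc).2).mpr ?_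
  exact (integrable_const _).add
    (integrable_logRatio (integrable_mul_smul_gaussianMeasure hT a) l T)

lemma KLgen_prod_gaussian_eq {l : ι → ℝ} (hl : ∀ i, 0 < l i) {T : Matrix ι ι ℝ}
    (hT : T.PosDef) {a c : ℝ} (ha : 0 < a) (hc : 0 < c) :
    KLgen ((ENNReal.ofReal a • gaussianMeasure T).prod (ENNReal.ofReal a • gaussianMeasure T))
      ((ENNReal.ofReal c • gaussianMeasure (diagonal l)).prod
          (ENNReal.ofReal c • gaussianMeasure (diagonal l)))
      = a ^ 2 * gaussianEntropy l T + (a ^ 2 * Real.log (a ^ 2 / c ^ 2) - a ^ 2 + c ^ 2) := by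
  have := isFiniteMeasure_smul_gaussianMeasure hT a
  have hfin := isFiniteMeasure_smul_gaussianMeasure (PosDef.diagonal hl) c
  have hα := integrable_mul_smul_gaussianMeasure hT a
  obtain ⟨hac, hae⟩ := rnDeriv_smul_gaussianMeasure hl hT ha hc
  rw [KLgen_prod_self hac (integrable_log_rnDeriv_smul_gaussianMeasure hl hT ha hc),
    integral_congr_ae hae, integral_add (integrable_const _) (integrable_logRatio hα l T),
    integral_logRatio hα l hT (by
      rw [secondMoment_smul_gaussianMeasure hT ha, smul_gaussianMeasure_univ hT ha]),
    smul_gaussianMeasure_univ hT ha, smul_gaussianMeasure_univ (PosDef.diagonal hl) hc,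
    integral_const, Measure.real, smul_gaussianMeasure_univ hT ha]
  have h2 : Real.log (a ^ 2 / c ^ 2) = 2 * Real.log (a / c) := by
    rw [← div_pow, Real.log_pow]; norm_num
  rw [h2, smul_eq_mul]
  ring

end GaussianEntropy

lemma secondMoment_symm {ι : Type*} (α : Measure (ι → ℝ)) (i j : ι) :
    secondMoment α i j = secondMoment α j i := by
  simp only [secondMoment, of_apply, mul_comm]

section Moments

variable {ι : Type*} [Fintype ι]

lemma dotProduct_vecMulVec_mulVec (v x : ι → ℝ) :
    x ⬝ᵥ (vecMulVec v v *ᵥ x) = (v ⬝ᵥ x) ^ 2 := by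
  rw [quadratic_eq_sum, dotProduct, sq, Finset.sum_mul_sum]
  refine Finset.sum_congr rfl fun i _ => Finset.sum_congr rfl fun j _ => ?_
  rw [vecMulVec_apply]
  ring

lemma integral_sq_dotProduct {α : Measure (ι → ℝ)}
    (hα : ∀ i j, Integrable (fun x : ι → ℝ => x i * x j) α) (v : ι → ℝ) :
    Integrable (fun x => (v ⬝ᵥ x) ^ 2) α ∧
      ∫ x, (v ⬝ᵥ x) ^ 2 ∂α = v ⬝ᵥ (secondMoment α *ᵥ v) := by
  have h1 := integrable_quadratic hα (vecMulVec v v)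
  have h2 := integral_quadratic hα (vecMulVec v v)
  simp only [dotProduct_vecMulVec_mulVec] at h1 h2
  refine ⟨h1, h2.trans ?_⟩
  rw [quadratic_eq_sum]
  refine Finset.sum_congr rfl fun i _ => Finset.sum_congr rfl fun j _ => ?_
  rw [vecMulVec_apply, mul_comm]

/-- The second moment matrix of a nonzero absolutely continuous measure is positive definite. -/
lemma posDef_secondMoment {α : Measure (ι → ℝ)} (hac : α ≪ volume) (h0 : α ≠ 0)
    (hα : ∀ i j, Integrable (fun x : ι → ℝ => x i * x j) α) : (secondMoment α).PosDef := by
  refine PosDef.of_dotProduct_mulVec_pos ?_ fun v hv => ?_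
  · ext i j
    simpa using secondMoment_symm α j i
  obtain ⟨hi, he⟩ := integral_sq_dotProduct hα v
  rw [star_trivial, ← he]
  refine lt_of_le_of_ne (integral_nonneg fun x => sq_nonneg _) fun h => ?_
  rw [eq_comm, integral_eq_zero_iff_of_nonneg (fun x => sq_nonneg _) hi] at h
  have hker : volume (LinearMap.ker (dotProductBilin ℝ ℝ v) : Set (ι → ℝ)) = 0 := by
    refine Measure.addHaar_submodule _ _ fun htop => hv ?_
    have : v ∈ LinearMap.ker (dotProductBilin ℝ ℝ v) := htop ▸ Submodule.mem_top
    exact dotProduct_self_eq_zero.1 this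
  have h2 : α (LinearMap.ker (dotProductBilin ℝ ℝ v) : Set (ι → ℝ)) = 0 := hac hker
  have h3 : ∀ᵐ x ∂α, x ∈ (LinearMap.ker (dotProductBilin ℝ ℝ v) : Set (ι → ℝ)) := by
    filter_upwards [h] with x hx
    exact pow_eq_zero_iff two_ne_zero |>.1 hx
  refine h0 (Measure.measure_univ_eq_zero.1 ?_)
  exact (measure_congr (ae_eq_univ.2 h3)).symm.trans h2

lemma integral_integral_sq_sum {α : Measure (ι → ℝ)}
    (hα : ∀ i j, Integrable (fun x : ι → ℝ => x i * x j) α) (s : ι → ℝ) :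
    ∫ x, ∫ y, (∑ i, s i * x i * y i) ^ 2 ∂α ∂α
      = ∑ i, ∑ j, s i * s j * secondMoment α i j ^ 2 := by
  have h1 : ∀ x : ι → ℝ, ∫ y, (∑ i, s i * x i * y i) ^ 2 ∂α
      = x ⬝ᵥ ((of fun i j => s i * s j * secondMoment α i j) *ᵥ x) := fun x => by
    refine (integral_sq_dotProduct hα fun i => s i * x i).2.trans ?_
    rw [quadratic_eq_sum, quadratic_eq_sum]
    refine Finset.sum_congr rfl fun i _ => Finset.sum_congr rfl fun j _ => ?_
    rw [of_apply]
    ring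
  simp only [h1]
  rw [integral_quadratic hα]
  refine Finset.sum_congr rfl fun i _ => Finset.sum_congr rfl fun j _ => ?_
  rw [of_apply]
  ring

lemma integrable_prod_sq_sum {α : Measure (ι → ℝ)} [SFinite α]
    (hα : ∀ i j, Integrable (fun x : ι → ℝ => x i * x j) α) (s : ι → ℝ) :
    Integrable (fun z : (ι → ℝ) × (ι → ℝ) => (∑ i, s i * z.1 i * z.2 i) ^ 2) (α.prod α) := by
  have h : (fun z : (ι → ℝ) × (ι → ℝ) => (∑ i, s i * z.1 i * z.2 i) ^ 2)
      = fun z => ∑ i, ∑ j, s i * s j * ((z.1 i * z.1 j) * (z.2 i * z.2 j)) := by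
    ext z
    rw [sq, Finset.sum_mul_sum]
    refine Finset.sum_congr rfl fun i _ => Finset.sum_congr rfl fun j _ => ?_
    ring
  rw [h]
  exact integrable_finsetSum _ fun i _ => integrable_finsetSum _ fun j _ =>
    ((hα i j).mul_prod (hα i j)).const_mul _

end Moments

section Transport

variable {X Y : Type*} [MeasurableSpace X] [MeasurableSpace Y]

lemma integrable_log_rnDeriv_map_equiv_iff (e : X ≃ᵐ Y) {α β : Measure X} [IsFiniteMeasure α]
    [IsFiniteMeasure β] (hαβ : α ≪ β) :
    Integrable (fun y => Real.log ((α.map e).rnDeriv (β.map e) y).toReal) (α.map e) ↔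
      Integrable (fun x => Real.log (α.rnDeriv β x).toReal) α := by
  rw [integrable_map_equiv]
  refine integrable_congr ?_
  filter_upwards [hαβ.ae_le (e.measurableEmbedding.rnDeriv_map α β)] with x hx
  simp [hx]

lemma integral_log_rnDeriv_map_equiv (e : X ≃ᵐ Y) {α β : Measure X} [IsFiniteMeasure α]
    [IsFiniteMeasure β] (hαβ : α ≪ β) :
    ∫ y, Real.log ((α.map e).rnDeriv (β.map e) y).toReal ∂(α.map e)
      = ∫ x, Real.log (α.rnDeriv β x).toReal ∂α := by
  rw [integral_map_equiv]
  refine integral_congr_ae ?_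
  filter_upwards [hαβ.ae_le (e.measurableEmbedding.rnDeriv_map α β)] with x hx
  simp [hx]

lemma absolutelyContinuous_map_equiv_iff (e : X ≃ᵐ Y) {α β : Measure X} :
    α.map e ≪ β.map e ↔ α ≪ β := by
  refine ⟨fun h => ?_, fun h => h.map e.measurable⟩
  have := h.map e.symm.measurable
  rwa [e.map_symm_map, e.map_symm_map] at this

lemma KLgen_prod_map_equiv (e : X ≃ᵐ Y) {α β : Measure X} [IsFiniteMeasure α]
    [IsFiniteMeasure β] (hαβ : α ≪ β)
    (hint : Integrable (fun x => Real.log (α.rnDeriv β x).toReal) α) :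
    KLgen ((α.map e).prod (α.map e)) ((β.map e).prod (β.map e))
      = KLgen (α.prod α) (β.prod β) := by
  have : IsFiniteMeasure (α.map e) := Measure.isFiniteMeasure_map α e
  have : IsFiniteMeasure (β.map e) := Measure.isFiniteMeasure_map β e
  rw [KLgen_prod_self hαβ hint, KLgen_prod_self ((absolutelyContinuous_map_equiv_iff e).2 hαβ)
    ((integrable_log_rnDeriv_map_equiv_iff e hαβ).2 hint), integral_log_rnDeriv_map_equiv e hαβ,
    e.map_apply, e.map_apply, Set.preimage_univ]

end Transport

lemma mass_objective_minimal {ε τ mμ mν Υ P M : ℝ} (hε : 0 < ε) (hτ : 0 < τ) (hmμ : 0 < mμ)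
    (hmν : 0 < mν)
    (hP : P = (mμ * mν) ^ (2 * τ / (2 * τ + ε)) * (mμ * mν) ^ (2 * ε / (2 * τ + ε))
      * Real.exp (-Υ / (2 * τ + ε)))
    (kl : ℝ → ℝ → ℝ) (hkl : ∀ p q, kl p q = p * Real.log (p / q) - p + q) (hM : 0 ≤ M) :
    P * Υ + τ * (kl P (mμ ^ 2) + kl P (mν ^ 2)) + ε * kl P (mμ ^ 2 * mν ^ 2)
      ≤ M * Υ + τ * (kl M (mμ ^ 2) + kl M (mν ^ 2)) + ε * kl M (mμ ^ 2 * mν ^ 2) := by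
  have hmm : 0 < mμ * mν := mul_pos hmμ hmν
  have hc : 0 < 2 * τ + ε := by positivity
  have hP0 : 0 < P := by rw [hP]; positivity
  have hlogP : (2 * τ + ε) * Real.log P
      = (2 * τ + 2 * ε) * (Real.log mμ + Real.log mν) - Υ := by
    rw [hP, Real.log_mul (by positivity) (by positivity), Real.log_mul (by positivity)
      (by positivity), Real.log_exp, Real.log_rpow hmm, Real.log_rpow hmm,
      Real.log_mul hmμ.ne' hmν.ne']
    field_simp
    ring
  have key : ∀ Q : ℝ, 0 ≤ Q →
      Q * Υ + τ * (kl Q (mμ ^ 2) + kl Q (mν ^ 2)) + ε * kl Q (mμ ^ 2 * mν ^ 2)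
        = (2 * τ + ε) * (Q * Real.log Q - Q - Q * Real.log P)
          + (τ * (mμ ^ 2 + mν ^ 2) + ε * (mμ ^ 2 * mν ^ 2)) := by
    intro Q hQ
    rcases hQ.eq_or_lt with rfl | hQ
    · simp [hkl]
    · rw [hkl, hkl, hkl, Real.log_div hQ.ne' (by positivity), Real.log_div hQ.ne' (by positivity),
        Real.log_div hQ.ne' (by positivity), Real.log_mul (by positivity) (by positivity),
        Real.log_pow, Real.log_pow]
      push_cast
      linear_combination Q * hlogP
  rw [key P hP0.le, key M hM]
  have h : 0 ≤ M * Real.log M - M - M * Real.log P + P := by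
    rcases hM.eq_or_lt with rfl | hM
    · simpa using hP0.le
    · have h1 := Real.log_le_sub_one_of_pos (div_pos hP0 hM)
      rw [Real.log_div hP0.ne' hM.ne'] at h1
      have h2 := mul_le_mul_of_nonneg_left h1 hM.le
      rw [mul_sub, mul_sub, mul_div_cancel₀ _ hM.ne'] at h2
      linarith
  have := mul_nonneg hc.le h
  nlinarith

section Assembly

variable {m n : ℕ}

lemma gaussianObjective_eq (ε τ : ℝ) (lμ : Fin m → ℝ) (lν : Fin n → ℝ)
    (A : Matrix (Fin m) (Fin m) ℝ) (B : Matrix (Fin n) (Fin n) ℝ) (K : Matrix (Fin m) (Fin n) ℝ) :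
    gaussianObjective ε τ lμ lν A B K
      = ((∑ i, ∑ j, A i j ^ 2) + (∑ i, ∑ j, B i j ^ 2) - 2 * ∑ i, ∑ j, K i j ^ 2)
        + τ * gaussianEntropy lμ A + τ * gaussianEntropy lν B
        + ε * gaussianEntropy (Sum.elim lμ lν) (fromBlocks A K Kᵀ B) := by
  simp only [gaussianObjective, gaussianEntropy, Fintype.sum_sum_type, fromBlocks_apply₁₁,
    fromBlocks_apply₂₂, Sum.elim_inl, Sum.elim_inr, Fintype.card_sum, Fintype.card_fin]
  push_cast
  ring

/-- The sign vector for which `∑ i, s i * x i * y i` is the difference of the inner products. -/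
def signVec (m n : ℕ) : Fin m ⊕ Fin n → ℝ := Sum.elim (fun _ => 1) (fun _ => -1)

lemma dotProduct_sub_dotProduct (x y : Fin m ⊕ Fin n → ℝ) :
    ((MeasurableEquiv.sumPiEquivProdPi (fun _ => ℝ) x).1
        ⬝ᵥ (MeasurableEquiv.sumPiEquivProdPi (fun _ => ℝ) y).1)
      - ((MeasurableEquiv.sumPiEquivProdPi (fun _ => ℝ) x).2
        ⬝ᵥ (MeasurableEquiv.sumPiEquivProdPi (fun _ => ℝ) y).2)
      = ∑ i, signVec m n i * x i * y i := by
  simp [signVec, Fintype.sum_sum_type, dotProduct, sub_eq_add_neg,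
    MeasurableEquiv.sumPiEquivProdPi]

lemma integral_cost_map {α : Measure (Fin m ⊕ Fin n → ℝ)}
    (hα : ∀ i j, Integrable (fun x : Fin m ⊕ Fin n → ℝ => x i * x j) α)
    {a : ℝ} {A : Matrix (Fin m) (Fin m) ℝ} {B : Matrix (Fin n) (Fin n) ℝ}
    {K : Matrix (Fin m) (Fin n) ℝ} (hM : secondMoment α = a • fromBlocks A K Kᵀ B) :
    ∫ p, ∫ q, ((p.1 ⬝ᵥ q.1) - (p.2 ⬝ᵥ q.2)) ^ 2
        ∂(α.map (MeasurableEquiv.sumPiEquivProdPi (fun _ : Fin m ⊕ Fin n => ℝ)))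
        ∂(α.map (MeasurableEquiv.sumPiEquivProdPi (fun _ : Fin m ⊕ Fin n => ℝ)))
      = a ^ 2 * ((∑ i, ∑ j, A i j ^ 2) + (∑ i, ∑ j, B i j ^ 2) - 2 * ∑ i, ∑ j, K i j ^ 2) := by
  simp only [integral_map_equiv, dotProduct_sub_dotProduct]
  rw [integral_integral_sq_sum hα, hM]
  have hK : ∑ j : Fin n, ∑ i : Fin m, K i j ^ 2 = ∑ i, ∑ j, K i j ^ 2 := Finset.sum_comm
  simp only [Fintype.sum_sum_type, signVec, Sum.elim_inl, Sum.elim_inr, Matrix.smul_apply,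
    fromBlocks_apply₁₁, fromBlocks_apply₁₂, fromBlocks_apply₂₁, fromBlocks_apply₂₂, smul_eq_mul,
    transpose_apply, mul_pow, one_mul, mul_one, neg_mul, mul_neg,
    Finset.sum_neg_distrib, ← Finset.mul_sum, Finset.sum_add_distrib, hK]
  ring

lemma integrable_cost_map {α : Measure (Fin m ⊕ Fin n → ℝ)} [IsFiniteMeasure α]
    (hα : ∀ i j, Integrable (fun x : Fin m ⊕ Fin n → ℝ => x i * x j) α) :
    Integrable (fun pq : ((Fin m → ℝ) × (Fin n → ℝ)) × ((Fin m → ℝ) × (Fin n → ℝ)) =>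
        ((pq.1.1 ⬝ᵥ pq.2.1) - (pq.1.2 ⬝ᵥ pq.2.2)) ^ 2)
      ((α.map (MeasurableEquiv.sumPiEquivProdPi (fun _ : Fin m ⊕ Fin n => ℝ))).prod
        (α.map (MeasurableEquiv.sumPiEquivProdPi (fun _ : Fin m ⊕ Fin n => ℝ)))) := by
  set E := MeasurableEquiv.sumPiEquivProdPi (fun _ : Fin m ⊕ Fin n => ℝ) with hE
  have h1 : (α.map E).prod (α.map E) = (α.prod α).map (E.prodCongr E) :=
    Measure.map_prod_map α α E.measurable E.measurable
  rw [h1, integrable_map_equiv]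
  refine (integrable_prod_sq_sum hα (signVec m n)).congr (Filter.Eventually.of_forall fun z => ?_)
  exact congrArg (· ^ 2) (dotProduct_sub_dotProduct z.1 z.2).symm

lemma map_fst_map_equiv (α : Measure (Fin m ⊕ Fin n → ℝ)) :
    (α.map (MeasurableEquiv.sumPiEquivProdPi (fun _ : Fin m ⊕ Fin n => ℝ))).map Prod.fst
      = α.map (fun x => x ∘ Sum.inl) :=
  Measure.map_map measurable_fst (MeasurableEquiv.measurable _)

lemma map_snd_map_equiv (α : Measure (Fin m ⊕ Fin n → ℝ)) :
    (α.map (MeasurableEquiv.sumPiEquivProdPi (fun _ : Fin m ⊕ Fin n => ℝ))).map Prod.snd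
      = α.map (fun x => x ∘ Sum.inr) :=
  Measure.map_map measurable_snd (MeasurableEquiv.measurable _)

lemma secondMoment_map_comp {ι κ : Type*} (α : Measure (ι → ℝ)) (e : κ → ι) :
    secondMoment (α.map (fun x => x ∘ e)) = (secondMoment α).submatrix e e := by
  ext i j
  have he : Measurable (fun x : ι → ℝ => x ∘ e) :=
    measurable_pi_lambda _ fun k => measurable_pi_apply (e k)
  simp only [secondMoment, of_apply, submatrix_apply]
  rw [integral_map he.aemeasurable]
  · rfl
  · exact ((measurable_pi_apply i).mul (measurable_pi_apply j)).aestronglyMeasurable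

lemma toReal_map_univ {X Y : Type*} [MeasurableSpace X] [MeasurableSpace Y] (α : Measure X)
    {f : X → Y} (hf : Measurable f) : ((α.map f) Set.univ).toReal = (α Set.univ).toReal := by
  rw [Measure.map_apply hf .univ, Set.preimage_univ]

lemma prod_smul_gaussianMeasure {lμ : Fin m → ℝ} {lν : Fin n → ℝ} (hlμ : ∀ i, 0 < lμ i)
    (hlν : ∀ j, 0 < lν j) {mμ mν : ℝ} (hmμ : 0 < mμ) :
    (ENNReal.ofReal mμ • gaussianMeasure (diagonal lμ)).prod
        (ENNReal.ofReal mν • gaussianMeasure (diagonal lν))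
      = (ENNReal.ofReal (mμ * mν) • gaussianMeasure (diagonal (Sum.elim lμ lν))).map
        (MeasurableEquiv.sumPiEquivProdPi (fun _ : Fin m ⊕ Fin n => ℝ)) := by
  have hμ := isProbabilityMeasure_gaussianMeasure (PosDef.diagonal hlμ)
  have hν := isProbabilityMeasure_gaussianMeasure (PosDef.diagonal hlν)
  rw [Measure.prod_smul_left, Measure.prod_smul_right, smul_smul, ← ENNReal.ofReal_mul hmμ.le,
    ← map_prod_gaussianMeasure_diagonal lμ lν hlμ hlν, Measure.map_smul,
    MeasurableEquiv.map_map_symm]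

end Assembly

section Objective

variable {m n : ℕ}

lemma ac_volume_of_ac_smul_gaussianMeasure {ι : Type*} [Fintype ι] [DecidableEq ι]
    {α : Measure (ι → ℝ)} {S : Matrix ι ι ℝ} {c : ℝ}
    (hac : α ≪ ENNReal.ofReal c • gaussianMeasure S) : α ≪ volume :=
  hac.trans (Measure.smul_absolutelyContinuous.trans (withDensity_absolutelyContinuous _ _))

lemma KLgen_prod_zero {X : Type*} [MeasurableSpace X] (β : Measure X) [IsFiniteMeasure β] :
    KLgen ((0 : Measure X).prod 0) (β.prod β) = (β Set.univ).toReal ^ 2 := by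
  have h : (0 : Measure X) ≪ β := Measure.AbsolutelyContinuous.zero β
  rw [KLgen_prod_self h integrable_zero_measure]
  simp

lemma le_objective_map {ε τ mμ mν Υ : ℝ} (hε : 0 < ε) (hτ : 0 < τ) (hmμ : 0 < mμ) (hmν : 0 < mν)
    {lμ : Fin m → ℝ} {lν : Fin n → ℝ} (hlμ : ∀ i, 0 < lμ i) (hlν : ∀ j, 0 < lν j)
    (kl : ℝ → ℝ → ℝ) (hkl : ∀ p q, kl p q = p * Real.log (p / q) - p + q)
    (hΥ : ∀ A B K, A.PosDef → B.PosDef → (fromBlocks A K Kᵀ B).PosDef →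
      Υ ≤ gaussianObjective ε τ lμ lν A B K)
    {α : Measure (Fin m ⊕ Fin n → ℝ)} [IsFiniteMeasure α]
    {μ : Measure (Fin m → ℝ)} {ν : Measure (Fin n → ℝ)} {β : Measure (Fin m ⊕ Fin n → ℝ)}
    (hμ : μ = ENNReal.ofReal mμ • gaussianMeasure (diagonal lμ))
    (hν : ν = ENNReal.ofReal mν • gaussianMeasure (diagonal lν))
    (hβ : β = ENNReal.ofReal (mμ * mν) • gaussianMeasure (diagonal (Sum.elim lμ lν)))
    (acμ : α.map (fun x => x ∘ Sum.inl) ≪ μ) (acν : α.map (fun x => x ∘ Sum.inr) ≪ ν)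
    (acβ : α ≪ β)
    (intμ : Integrable (fun x => Real.log ((α.map fun x => x ∘ Sum.inl).rnDeriv μ x).toReal)
      (α.map fun x => x ∘ Sum.inl))
    (intν : Integrable (fun x => Real.log ((α.map fun x => x ∘ Sum.inr).rnDeriv ν x).toReal)
      (α.map fun x => x ∘ Sum.inr))
    (intβ : Integrable (fun x => Real.log (α.rnDeriv β x).toReal) α) :
    (α Set.univ).toReal ^ 2 * Υ
        + τ * (kl ((α Set.univ).toReal ^ 2) (mμ ^ 2) + kl ((α Set.univ).toReal ^ 2) (mν ^ 2))
        + ε * kl ((α Set.univ).toReal ^ 2) (mμ ^ 2 * mν ^ 2)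
      ≤ (∫ p, ∫ q, ((p.1 ⬝ᵥ q.1) - (p.2 ⬝ᵥ q.2)) ^ 2
          ∂(α.map (MeasurableEquiv.sumPiEquivProdPi (fun _ : Fin m ⊕ Fin n => ℝ)))
          ∂(α.map (MeasurableEquiv.sumPiEquivProdPi (fun _ : Fin m ⊕ Fin n => ℝ))))
        + τ * KLgen ((α.map fun x => x ∘ Sum.inl).prod (α.map fun x => x ∘ Sum.inl)) (μ.prod μ)
        + τ * KLgen ((α.map fun x => x ∘ Sum.inr).prod (α.map fun x => x ∘ Sum.inr)) (ν.prod ν)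
        + ε * KLgen (α.prod α) (β.prod β) := by
  have hl : ∀ i, 0 < Sum.elim lμ lν i := by rintro (i | j) <;> simp [hlμ, hlν]
  have hmm : 0 < mμ * mν := mul_pos hmμ hmν
  have m1 : Measurable (fun x : Fin m ⊕ Fin n → ℝ => x ∘ (Sum.inl : Fin m → Fin m ⊕ Fin n)) :=
    measurable_pi_lambda _ fun k => measurable_pi_apply _
  have m2 : Measurable (fun x : Fin m ⊕ Fin n → ℝ => x ∘ (Sum.inr : Fin n → Fin m ⊕ Fin n)) :=
    measurable_pi_lambda _ fun k => measurable_pi_apply _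
  rcases eq_or_ne α 0 with rfl | hα
  · have fμ : IsFiniteMeasure μ := hμ ▸ isFiniteMeasure_smul_gaussianMeasure (PosDef.diagonal hlμ) _
    have fν : IsFiniteMeasure ν := hν ▸ isFiniteMeasure_smul_gaussianMeasure (PosDef.diagonal hlν) _
    have fβ : IsFiniteMeasure β := hβ ▸ isFiniteMeasure_smul_gaussianMeasure (PosDef.diagonal hl) _
    simp only [Measure.map_zero]
    rw [KLgen_prod_zero μ, KLgen_prod_zero ν, KLgen_prod_zero β, hμ, hν, hβ,
      smul_gaussianMeasure_univ (PosDef.diagonal hlμ) hmμ,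
      smul_gaussianMeasure_univ (PosDef.diagonal hlν) hmν,
      smul_gaussianMeasure_univ (PosDef.diagonal hl) hmm, hkl, hkl, hkl]
    apply le_of_eq
    simp
    ring
  have fμ : IsFiniteMeasure (α.map (fun x => x ∘ (Sum.inl : Fin m → Fin m ⊕ Fin n))) :=
    Measure.isFiniteMeasure_map α _
  have fν : IsFiniteMeasure (α.map (fun x => x ∘ (Sum.inr : Fin n → Fin m ⊕ Fin n))) :=
    Measure.isFiniteMeasure_map α _
  subst hμ hν hβ
  have ha : 0 < (α Set.univ).toReal :=
    ENNReal.toReal_pos (Measure.measure_univ_ne_zero.2 hα) (measure_ne_top _ _)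
  have hsm := integrable_mul_of_integrable_log_rnDeriv hl hmm acβ intβ
  have hpd := posDef_secondMoment (ac_volume_of_ac_smul_gaussianMeasure acβ) hα hsm
  set a := (α Set.univ).toReal with ha_def
  set S := a⁻¹ • secondMoment α with hS
  have hSpd : S.PosDef := hpd.smul (inv_pos.2 ha)
  have hM : secondMoment α = a • S := by rw [hS, smul_inv_smul₀ ha.ne']
  have hblock : fromBlocks S.toBlocks₁₁ S.toBlocks₁₂ S.toBlocks₁₂ᵀ S.toBlocks₂₂ = S := by
    have : S.toBlocks₁₂ᵀ = S.toBlocks₂₁ := by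
      ext i j
      simp [hS, toBlocks₁₂, toBlocks₂₁, secondMoment_symm α (Sum.inl j) (Sum.inr i)]
    rw [this, fromBlocks_toBlocks]
  have hA : (S.toBlocks₁₁).PosDef := hSpd.submatrix Sum.inl_injective
  have hB : (S.toBlocks₂₂).PosDef := hSpd.submatrix Sum.inr_injective
  have hle := hΥ _ _ S.toBlocks₁₂ hA hB (by rwa [hblock])
  rw [gaussianObjective_eq, hblock] at hle
  have u1 := toReal_map_univ α m1
  have u2 := toReal_map_univ α m2
  rw [← ha_def] at u1 u2
  have k1 := le_KLgen_prod_gaussian hlμ hmμ acμ intμ (u1 ▸ ha) hA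
    (by rw [secondMoment_map_comp, hM, u1]; rfl)
  have k2 := le_KLgen_prod_gaussian hlν hmν acν intν (u2 ▸ ha) hB
    (by rw [secondMoment_map_comp, hM, u2]; rfl)
  have k3 := le_KLgen_prod_gaussian hl hmm acβ intβ ha hSpd hM
  rw [u1] at k1
  rw [u2] at k2
  rw [← ha_def, mul_pow] at k3
  rw [integral_cost_map hsm (hM.trans (by rw [hblock])), hkl, hkl, hkl]
  have := mul_le_mul_of_nonneg_left hle (sq_nonneg a)
  have := mul_le_mul_of_nonneg_left k1 hτ.le
  have := mul_le_mul_of_nonneg_left k2 hτ.le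
  have := mul_le_mul_of_nonneg_left k3 hε.le
  linarith

lemma map_comp_smul_gaussianMeasure {ι κ : Type*} [Fintype ι] [DecidableEq ι] [Fintype κ]
    [DecidableEq κ] {S : Matrix ι ι ℝ} (hS : S.PosDef) (a : ℝ) (e : κ → ι)
    (he : Function.Injective e) :
    (ENNReal.ofReal a • gaussianMeasure S).map (fun x => x ∘ e)
      = ENNReal.ofReal a • gaussianMeasure (S.submatrix e e) := by
  rw [Measure.map_smul, map_comp_gaussianMeasure hS e he]

end Objective

/-- closed form of the entropic unbalanced inner-product Gromov–Wasserstein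
problem between the unbalanced Gaussians `μ = mμ·N(0, diag lμ)` and `ν = mν·N(0, diag lν)`.
With `(xv k, yv k)` the minimizers of `g_{ε,τ,+}(·,·; lμ_k, lν_k)` (`k ≤ n`), `xv k` the
minimizers of `h_{ε,τ}(·; lμ_k)` (`n < k ≤ m`), `Υ*` the corresponding optimal value and
`mπ²` the optimal mass, the infimum of
`E_γ[(⟨X,X'⟩-⟨Y,Y'⟩)²] + τ KL⊗(γx‖μ) + τ KL⊗(γy‖ν) + ε KL⊗(γ‖μ⊗ν)` over finite positive
measures `γ` equals `mπ² Υ* + τ (kl(mπ²‖mμ²) + kl(mπ²‖mν²)) + ε kl(mπ²‖mμ²mν²)` and is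
attained at the scaled Gaussian `mπ·N(0, [[diag xv, K*],[K*ᵀ, diag yv]])`. -/
theorem entropic_unbalanced_IGW_gaussian_closed_form
    (m n : ℕ) (hn : 1 ≤ n) (hmn : n ≤ m)
    (ε τ : ℝ) (hε : 0 < ε) (hτ : 0 < τ)
    (mμ mν : ℝ) (hmμ : 0 < mμ) (hmν : 0 < mν)
    (lμ : Fin m → ℝ) (lν : Fin n → ℝ)
    (hlμpos : ∀ i, 0 < lμ i) (hlνpos : ∀ j, 0 < lν j)
    (hlμmono : ∀ i j : Fin m, i ≤ j → lμ j ≤ lμ i)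
    (hlνmono : ∀ i j : Fin n, i ≤ j → lν j ≤ lν i)
    (g : ℝ → ℝ → ℝ → ℝ → ℝ)
    (hg : ∀ x y a b, g x y a b = x ^ 2 + y ^ 2
      + (τ + ε) * (x / a + y / b - Real.log (x * y / (a * b)) - 2)
      - 2 * max (x * y - ε / 2) 0
      + ε * max (Real.log (x * y) - Real.log (ε / 2)) 0)
    (h : ℝ → ℝ → ℝ)
    (hh : ∀ x a, h x a = x ^ 2 + (τ + ε) * (x / a - Real.log (x / a) - 1))
    (xv : Fin m → ℝ) (yv : Fin n → ℝ)
    (hxvpos : ∀ i, 0 < xv i) (hyvpos : ∀ j, 0 < yv j)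
    (hgmin : ∀ k : Fin n, ∀ x y : ℝ, 0 < x → 0 < y →
      g (xv (Fin.castLE hmn k)) (yv k) (lμ (Fin.castLE hmn k)) (lν k)
        ≤ g x y (lμ (Fin.castLE hmn k)) (lν k))
    (hhmin : ∀ k : Fin m, n ≤ (k : ℕ) → ∀ x : ℝ, 0 < x → h (xv k) (lμ k) ≤ h x (lμ k))
    (Υ : ℝ)
    (hΥ : Υ = ∑ k : Fin n, g (xv (Fin.castLE hmn k)) (yv k) (lμ (Fin.castLE hmn k)) (lν k)
      + ∑ k ∈ Finset.univ.filter (fun k : Fin m => n ≤ (k : ℕ)), h (xv k) (lμ k))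
    (mπ2 : ℝ)
    (hmπ2 : mπ2 = (mμ * mν) ^ (2 * τ / (2 * τ + ε)) * (mμ * mν) ^ (2 * ε / (2 * τ + ε))
      * Real.exp (-Υ / (2 * τ + ε)))
    (kl : ℝ → ℝ → ℝ) (hkl : ∀ p q, kl p q = p * Real.log (p / q) - p + q) :
    let Sμ : Matrix (Fin m) (Fin m) ℝ := Matrix.diagonal lμ
    let Sν : Matrix (Fin n) (Fin n) ℝ := Matrix.diagonal lν
    let μ : Measure (Fin m → ℝ) := (ENNReal.ofReal mμ) • gaussianMeasure Sμ
    let ν : Measure (Fin n → ℝ) := (ENNReal.ofReal mν) • gaussianMeasure Sν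
    -- quadratic KL divergence `KL⊗(α‖β) = KL(α⊗α‖β⊗β)`
    let KLt : {X : Type} → [inst : MeasurableSpace X] → Measure X → Measure X → ℝ :=
      fun {X} _ α β => KLgen (α.prod α) (β.prod β)
    let obj : Measure ((Fin m → ℝ) × (Fin n → ℝ)) → ℝ := fun γ =>
      (∫ p, ∫ q, ((p.1 ⬝ᵥ q.1) - (p.2 ⬝ᵥ q.2)) ^ 2 ∂γ ∂γ)
        + τ * KLt (γ.map Prod.fst) μ + τ * KLt (γ.map Prod.snd) ν
        + ε * KLt γ (μ.prod ν)
    -- admissible measures: finite positive measures for which the objective is honestly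
    -- defined (finite cost and finite quadratic KL divergences)
    let adm : Set (Measure ((Fin m → ℝ) × (Fin n → ℝ))) :=
      {γ | IsFiniteMeasure γ ∧
        (γ.map Prod.fst) ≪ μ ∧ (γ.map Prod.snd) ≪ ν ∧ γ ≪ μ.prod ν ∧
        Integrable (fun x => Real.log
          ((((γ.map Prod.fst).prod (γ.map Prod.fst)).rnDeriv (μ.prod μ) x).toReal))
          ((γ.map Prod.fst).prod (γ.map Prod.fst)) ∧
        Integrable (fun x => Real.log
          ((((γ.map Prod.snd).prod (γ.map Prod.snd)).rnDeriv (ν.prod ν) x).toReal))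
          ((γ.map Prod.snd).prod (γ.map Prod.snd)) ∧
        Integrable (fun x => Real.log
          (((γ.prod γ).rnDeriv ((μ.prod ν).prod (μ.prod ν)) x).toReal)) (γ.prod γ) ∧
        Integrable (fun pq : ((Fin m → ℝ) × (Fin n → ℝ)) × ((Fin m → ℝ) × (Fin n → ℝ)) =>
          ((pq.1.1 ⬝ᵥ pq.2.1) - (pq.1.2 ⬝ᵥ pq.2.2)) ^ 2) (γ.prod γ)}
    let Kst : Matrix (Fin m) (Fin n) ℝ :=
      Matrix.of fun i j => if (i : ℕ) = (j : ℕ) then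
        Real.sqrt (max (1 - ε / (2 * xv i * yv j)) 0 * (xv i * yv j)) else 0
    let γstar : Measure ((Fin m → ℝ) × (Fin n → ℝ)) :=
      (ENNReal.ofReal (Real.sqrt mπ2)) •
        ((gaussianMeasure (Matrix.fromBlocks (Matrix.diagonal xv) Kst Kstᵀ
          (Matrix.diagonal yv))).map (MeasurableEquiv.sumPiEquivProdPi (fun _ => ℝ)))
    let RHS : ℝ := mπ2 * Υ + τ * (kl mπ2 (mμ ^ 2) + kl mπ2 (mν ^ 2))
      + ε * kl mπ2 (mμ ^ 2 * mν ^ 2)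
    γstar ∈ adm ∧ obj γstar = RHS ∧ ∀ γ ∈ adm, RHS ≤ obj γ := by
  intro Sμ Sν μ ν KLt obj adm Kst γstar RHS
  set E := MeasurableEquiv.sumPiEquivProdPi (fun _ : Fin m ⊕ Fin n => ℝ) with hE
  have hl : ∀ i, 0 < Sum.elim lμ lν i := by rintro (i | j) <;> simp [hlμpos, hlνpos]
  have hmm : 0 < mμ * mν := mul_pos hmμ hmν
  have hP : 0 < mπ2 := by rw [hmπ2]; positivity
  have fμ : IsFiniteMeasure μ := isFiniteMeasure_smul_gaussianMeasure (PosDef.diagonal hlμpos) _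
  have fν : IsFiniteMeasure ν := isFiniteMeasure_smul_gaussianMeasure (PosDef.diagonal hlνpos) _
  set β : Measure (Fin m ⊕ Fin n → ℝ) :=
    ENNReal.ofReal (mμ * mν) • gaussianMeasure (diagonal (Sum.elim lμ lν)) with hβ
  have fβ : IsFiniteMeasure β := isFiniteMeasure_smul_gaussianMeasure (PosDef.diagonal hl) _
  have hμν : μ.prod ν = β.map E := prod_smul_gaussianMeasure hlμpos hlνpos hmμ
  have hobj : ∀ α : Measure (Fin m ⊕ Fin n → ℝ), IsFiniteMeasure α → α ≪ β →
      Integrable (fun x => Real.log (α.rnDeriv β x).toReal) α →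
      obj (α.map E) = (∫ p, ∫ q, ((p.1 ⬝ᵥ q.1) - (p.2 ⬝ᵥ q.2)) ^ 2 ∂(α.map E) ∂(α.map E))
        + τ * KLgen ((α.map fun x => x ∘ Sum.inl).prod (α.map fun x => x ∘ Sum.inl)) (μ.prod μ)
        + τ * KLgen ((α.map fun x => x ∘ Sum.inr).prod (α.map fun x => x ∘ Sum.inr)) (ν.prod ν)
        + ε * KLgen (α.prod α) (β.prod β) := by
    intro α fα acβ intβ
    change _ + τ * KLgen (((α.map E).map Prod.fst).prod ((α.map E).map Prod.fst)) (μ.prod μ)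
        + τ * KLgen (((α.map E).map Prod.snd).prod ((α.map E).map Prod.snd)) (ν.prod ν)
        + ε * KLgen ((α.map E).prod (α.map E)) ((μ.prod ν).prod (μ.prod ν)) = _
    rw [hμν, KLgen_prod_map_equiv E acβ intβ, map_fst_map_equiv, map_snd_map_equiv]
  have hS := posDef_optimal hmn xv yv hε hxvpos hyvpos
  set S := fromBlocks (diagonal xv) (optimalCross ε xv yv) (optimalCross ε xv yv)ᵀ (diagonal yv)
    with hSdef
  have hsq : 0 < Real.sqrt mπ2 := Real.sqrt_pos.2 hP
  set α : Measure (Fin m ⊕ Fin n → ℝ) := ENNReal.ofReal (Real.sqrt mπ2) • gaussianMeasure S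
    with hα
  have fα : IsFiniteMeasure α := isFiniteMeasure_smul_gaussianMeasure hS _
  have hγα : γstar = α.map E := (Measure.map_smul _ _ _).symm
  have hα1 : α.map (fun x => x ∘ Sum.inl)
      = ENNReal.ofReal (Real.sqrt mπ2) • gaussianMeasure (diagonal xv) :=
    map_comp_smul_gaussianMeasure hS _ _ Sum.inl_injective
  have hα2 : α.map (fun x => x ∘ Sum.inr)
      = ENNReal.ofReal (Real.sqrt mπ2) • gaussianMeasure (diagonal yv) :=
    map_comp_smul_gaussianMeasure hS _ _ Sum.inr_injective
  have acα : α ≪ β := (rnDeriv_smul_gaussianMeasure hl hS hsq hmm).1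
  have intα : Integrable (fun x => Real.log (α.rnDeriv β x).toReal) α :=
    integrable_log_rnDeriv_smul_gaussianMeasure hl hS hsq hmm
  have hsm : ∀ i j, Integrable (fun x : Fin m ⊕ Fin n → ℝ => x i * x j) α :=
    integrable_mul_smul_gaussianMeasure hS _
  refine ⟨?_, ?_, ?_⟩
  · rw [hγα]
    have fαE : IsFiniteMeasure (α.map E) := Measure.isFiniteMeasure_map _ _
    have fx := isFiniteMeasure_smul_gaussianMeasure (PosDef.diagonal hxvpos) (Real.sqrt mπ2)
    have fy := isFiniteMeasure_smul_gaussianMeasure (PosDef.diagonal hyvpos) (Real.sqrt mπ2)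
    have acx : ENNReal.ofReal (Real.sqrt mπ2) • gaussianMeasure (diagonal xv) ≪ μ :=
      (rnDeriv_smul_gaussianMeasure hlμpos (PosDef.diagonal hxvpos) hsq hmμ).1
    have acy : ENNReal.ofReal (Real.sqrt mπ2) • gaussianMeasure (diagonal yv) ≪ ν :=
      (rnDeriv_smul_gaussianMeasure hlνpos (PosDef.diagonal hyvpos) hsq hmν).1
    have acE := (absolutelyContinuous_map_equiv_iff E).2 acα
    simp only [adm, Set.mem_ofPred_eq]
    rw [hμν, map_fst_map_equiv, map_snd_map_equiv, hα1, hα2]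
    exact ⟨fαE, acx, acy, acE,
      integrable_log_rnDeriv_prod_self acx (integrable_log_rnDeriv_smul_gaussianMeasure hlμpos
        (PosDef.diagonal hxvpos) hsq hmμ),
      integrable_log_rnDeriv_prod_self acy (integrable_log_rnDeriv_smul_gaussianMeasure hlνpos
        (PosDef.diagonal hyvpos) hsq hmν),
      integrable_log_rnDeriv_prod_self acE ((integrable_log_rnDeriv_map_equiv_iff E acα).2 intα),
      integrable_cost_map hsm⟩
  · have k1 := KLgen_prod_gaussian_eq hlμpos (PosDef.diagonal hxvpos) hsq hmμ
    have k2 := KLgen_prod_gaussian_eq hlνpos (PosDef.diagonal hyvpos) hsq hmν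
    have k3 := KLgen_prod_gaussian_eq hl hS hsq hmm
    have hopt := gaussianObjective_optimal hmn τ lμ lν xv yv hε hlμpos hlνpos g hg h hh hxvpos
      hyvpos
    rw [← hΥ, gaussianObjective_eq, ← hSdef] at hopt
    rw [hγα, hobj α fα acα intα, integral_cost_map hsm (secondMoment_smul_gaussianMeasure hS hsq),
      hα1, hα2, k1, k2, k3, Real.sq_sqrt hP.le, mul_pow]
    simp only [RHS, hkl, ← hopt]
    ring
  · rintro γ ⟨fγ, acμ, acν, acβ, intμ, intν, intβ, -⟩
    obtain ⟨α, rfl⟩ : ∃ α : Measure (Fin m ⊕ Fin n → ℝ), γ = α.map E :=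
      ⟨γ.map E.symm, (E.map_map_symm).symm⟩
    have fα : IsFiniteMeasure α := by
      have := Measure.isFiniteMeasure_map (α.map E) E.symm
      rwa [E.map_symm_map] at this
    have f1 : IsFiniteMeasure ((α.map E).map Prod.fst) := Measure.isFiniteMeasure_map _ _
    have f2 : IsFiniteMeasure ((α.map E).map Prod.snd) := Measure.isFiniteMeasure_map _ _
    replace intμ := integrable_log_rnDeriv_of_prod_self acμ intμ
    replace intν := integrable_log_rnDeriv_of_prod_self acν intν
    replace intβ := integrable_log_rnDeriv_of_prod_self acβ intβ
    rw [map_fst_map_equiv] at acμ intμ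
    rw [map_snd_map_equiv] at acν intν
    rw [hμν] at acβ intβ
    rw [absolutelyContinuous_map_equiv_iff] at acβ
    rw [integrable_log_rnDeriv_map_equiv_iff E acβ] at intβ
    rw [hobj α fα acβ intβ]
    refine (mass_objective_minimal hε hτ hmμ hmν hmπ2 kl hkl
      (sq_nonneg (α Set.univ).toReal)).trans ?_
    refine le_objective_map hε hτ hmμ hmν hlμpos hlνpos kl hkl (fun A B K hA hB hK => ?_)
      rfl rfl rfl acμ acν acβ intμ intν intβ
    rw [hΥ]
    exact le_gaussianObjective hmn ε τ lμ lν hε hτ hlμpos hlνpos hlμmono hlνmono g hg h hh xv yv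
      hgmin hhmin A B K hA hB hK
end

section
/- Let τ, ε > 0, let {a_i}_{i=1}^{m} and {b_j}_{j=1}^{n} (n ≤ m) be positive non-increasing sequences, and define D({x_i},{y_j}) := Σ_{i=1}^{m} x_i² + Σ_{j=1}^{n} y_j² + (τ+ε)·( Σ_{i=1}^{m} (x_i/a_i − log x_i) + Σ_{j=1}^{n} (y_j/b_j − log y_j) ) − 2 Σ_{k=1}^{n} [x_k y_k − ε/2]^+ + ε Σ_{k=1}^{n} [log(x_k y_k) − log(ε/2)]^+ over positive sequences x_1,…,x_m > 0 and y_1,…,y_n > 0. If ({x̃_i},{ỹ_j}) is a minimizer of D, then the sequences (x̃_i)_{i=1}^{m} and (ỹ_j)_{j=1}^{n} are non-increasing. -/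
open Finset

/-- The gain `2 [s - ε/2]⁺ - ε [log s - log (ε/2)]⁺` by which a product `s = x y` lowers the
objective. -/
noncomputable def couplingGain (ε s : ℝ) : ℝ :=
  2 * max (s - ε / 2) 0 - ε * max (Real.log s - Real.log (ε / 2)) 0

/-- The part of the objective contributed by one coupled pair, with linear coefficients `A`, `B`. -/
noncomputable def pairCost (τ ε A B x y : ℝ) : ℝ :=
  x ^ 2 + y ^ 2 - (τ + ε) * (Real.log x + Real.log y) + A * x + B * y - couplingGain ε (x * y)

lemma couplingGain_of_le {ε s : ℝ} (hs : 0 < s) (h : s ≤ ε / 2) : couplingGain ε s = 0 := by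
  have := Real.log_le_log hs h
  rw [couplingGain, max_eq_right (by linarith), max_eq_right (by linarith)]
  ring

lemma couplingGain_of_ge {ε s : ℝ} (hε : 0 < ε) (h : ε / 2 ≤ s) :
    couplingGain ε s = 2 * s - ε - ε * (Real.log s - Real.log (ε / 2)) := by
  have := Real.log_le_log (by positivity) h
  rw [couplingGain, max_eq_left (by linarith), max_eq_left (by linarith)]
  ring

lemma mul_log_sub_log_le {ε s t : ℝ} (hε : 0 < ε) (hs : ε / 2 ≤ s) (hst : s ≤ t) :
    ε * (Real.log t - Real.log s) ≤ 2 * (t - s) := by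
  have hs0 : 0 < s := by linarith
  have ht0 : 0 < t := by linarith
  have h := Real.log_le_sub_one_of_pos (div_pos ht0 hs0)
  rw [Real.log_div ht0.ne' hs0.ne'] at h
  have h1 : ε * (t / s - 1) ≤ 2 * (t - s) := by
    have : t / s - 1 = (t - s) / s := by field_simp
    rw [this, mul_div_assoc', div_le_iff₀ hs0]
    nlinarith
  nlinarith

lemma couplingGain_mono {ε s t : ℝ} (hε : 0 < ε) (hs : 0 < s) (hst : s ≤ t) :
    couplingGain ε s ≤ couplingGain ε t := by
  rcases le_total s (ε / 2) with h | h
  · rw [couplingGain_of_le hs h]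
    rcases le_total t (ε / 2) with h' | h'
    · rw [couplingGain_of_le (by linarith) h']
    · rw [couplingGain_of_ge hε h']
      linarith [mul_log_sub_log_le hε le_rfl h']
  · rw [couplingGain_of_ge hε h, couplingGain_of_ge hε (h.trans hst)]
    linarith [mul_log_sub_log_le hε h hst]

lemma couplingGain_add_le_of_ge {ε p q r t : ℝ} (hε : 0 < ε) (hp : ε / 2 ≤ p)
    (hpr : p ≤ r) (hpt : p ≤ t) (h : p * q = r * t) :
    couplingGain ε r + couplingGain ε t ≤ couplingGain ε p + couplingGain ε q := by
  have hp0 : 0 < p := by linarith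
  have hr0 : 0 < r := by linarith
  have ht0 : 0 < t := by linarith
  have hrq : r ≤ q := by
    by_contra! hlt
    nlinarith
  have hq0 : 0 < q := by linarith
  have hsum : r + t ≤ p + q := by
    have : 0 ≤ (r - p) * (t - p) := mul_nonneg (by linarith) (by linarith)
    have : p * (r + t) ≤ p * (p + q) := by nlinarith
    exact le_of_mul_le_mul_left this hp0
  have hlog : Real.log p + Real.log q = Real.log r + Real.log t := by
    rw [← Real.log_mul hp0.ne' hq0.ne', ← Real.log_mul hr0.ne' ht0.ne', h]
  rw [couplingGain_of_ge hε hp, couplingGain_of_ge hε (hp.trans hpr),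
    couplingGain_of_ge hε (hp.trans hpt), couplingGain_of_ge hε (by linarith)]
  linear_combination 2 * hsum + ε * hlog

lemma couplingGain_add_le {ε p q r t : ℝ} (hε : 0 < ε) (hp : 0 < p)
    (hpr : p ≤ r) (hpt : p ≤ t) (h : p * q = r * t) :
    couplingGain ε r + couplingGain ε t ≤ couplingGain ε p + couplingGain ε q := by
  rcases le_total (ε / 2) p with hp' | hp'
  · exact couplingGain_add_le_of_ge hε hp' hpr hpt h
  have hr0 : 0 < r := by linarith
  have ht0 : 0 < t := by linarith
  have hrq : r ≤ q := by
    by_contra! hlt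
    nlinarith
  have htq : t ≤ q := by
    by_contra! hlt
    nlinarith
  rw [couplingGain_of_le hp hp']
  rcases le_total r (ε / 2) with hr | hr
  · rw [couplingGain_of_le hr0 hr]
    linarith [couplingGain_mono hε ht0 htq]
  rcases le_total t (ε / 2) with ht | ht
  · rw [couplingGain_of_le ht0 ht]
    linarith [couplingGain_mono hε hr0 hrq]
  have hε2 : 0 < ε / 2 := by positivity
  have h1 := couplingGain_add_le_of_ge (q := r * t / (ε / 2)) hε le_rfl hr ht
    (mul_div_cancel₀ _ hε2.ne')
  rw [couplingGain_of_le hε2 le_rfl] at h1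
  have hq0 : 0 < q := by linarith
  have h2 : r * t / (ε / 2) ≤ q := by
    rw [div_le_iff₀ hε2, ← h]
    nlinarith
  linarith [couplingGain_mono hε (by positivity) h2]

lemma couplingGain_mul_supermodular {ε x₁ y₁ x₂ y₂ : ℝ} (hε : 0 < ε)
    (hx₁ : 0 < x₁) (hy₁ : 0 < y₁) (hx₂ : 0 < x₂) (hy₂ : 0 < y₂) :
    couplingGain ε (x₁ * y₁) + couplingGain ε (x₂ * y₂) ≤
      couplingGain ε (max x₁ x₂ * max y₁ y₂) + couplingGain ε (min x₁ x₂ * min y₁ y₂) := by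
  rcases le_total x₁ x₂ with hx | hx <;> rcases le_total y₁ y₂ with hy | hy <;> simp only [hx, hy,
    max_eq_left, max_eq_right, min_eq_left, min_eq_right]
  · linarith
  · have := couplingGain_add_le (p := x₁ * y₂) (q := x₂ * y₁) (r := x₁ * y₁) (t := x₂ * y₂) hε
      (by positivity) (by gcongr) (by gcongr) (by ring)
    linarith
  · have := couplingGain_add_le (p := x₂ * y₁) (q := x₁ * y₂) (r := x₁ * y₁) (t := x₂ * y₂) hε
      (by positivity) (by gcongr) (by gcongr) (by ring)
    linarith
  · linarith

lemma log_add_log_le_two_mul_log_midpoint {x y : ℝ} (hx : 0 < x) (hy : 0 < y) :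
    Real.log x + Real.log y ≤ 2 * Real.log ((x + y) / 2) := by
  have h : Real.log (x * y) ≤ Real.log (((x + y) / 2) ^ 2) :=
    Real.log_le_log (by positivity) (by nlinarith [sq_nonneg (x - y)])
  rw [Real.log_mul hx.ne' hy.ne', Real.log_pow] at h
  exact_mod_cast h

lemma log_add_log_lt_two_mul_log_midpoint {x y : ℝ} (hx : 0 < x) (hy : 0 < y) (hxy : x ≠ y) :
    Real.log x + Real.log y < 2 * Real.log ((x + y) / 2) := by
  have h : Real.log (x * y) < Real.log (((x + y) / 2) ^ 2) :=
    Real.log_lt_log (by positivity) (by nlinarith [sq_pos_of_ne_zero (sub_ne_zero.2 hxy)])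
  rw [Real.log_mul hx.ne' hy.ne', Real.log_pow] at h
  exact_mod_cast h

/-- A jointly convex function whose partial infimum over `0 < d`, `d ^ 2 ≤ x * y` is `pairCost`. -/
noncomputable def liftedCost (τ ε A B x y d : ℝ) : ℝ :=
  (x - y) ^ 2 + 2 * d ^ 2 - 2 * ε * Real.log d - τ * (Real.log x + Real.log y) + A * x + B * y

lemma pairCost_le_liftedCost {τ ε A B x y d : ℝ} (hε : 0 < ε) (hx : 0 < x) (hy : 0 < y)
    (hd : 0 < d) (hdxy : d ^ 2 ≤ x * y) :
    pairCost τ ε A B x y ≤ liftedCost τ ε A B x y d := by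
  have hd2 : Real.log (d ^ 2) = 2 * Real.log d := by simp
  have hl := Real.log_mul hx.ne' hy.ne'
  have hε2 : 0 < ε / 2 := by positivity
  unfold pairCost liftedCost
  rcases le_total (x * y) (ε / 2) with h | h
  · rw [couplingGain_of_le (by positivity) h]
    have h2 : ε * (Real.log (d ^ 2) - Real.log (x * y)) ≤ -2 * (x * y - d ^ 2) := by
      have h3 := Real.log_le_sub_one_of_pos (div_pos (pow_pos hd 2) (mul_pos hx hy))
      rw [Real.log_div (by positivity) (by positivity)] at h3
      have h4 : ε * (d ^ 2 / (x * y) - 1) ≤ -2 * (x * y - d ^ 2) := by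
        have : d ^ 2 / (x * y) - 1 = (d ^ 2 - x * y) / (x * y) := by field_simp
        rw [this, mul_div_assoc', div_le_iff₀ (by positivity)]
        nlinarith
      nlinarith
    rw [hd2, hl] at h2
    linarith
  · rw [couplingGain_of_ge hε h, hl]
    have h3 := Real.log_le_sub_one_of_pos (div_pos (pow_pos hd 2) hε2)
    rw [Real.log_div (by positivity) (by positivity), hd2] at h3
    have h4 : ε * (2 * Real.log d - Real.log (ε / 2)) ≤ ε * (d ^ 2 / (ε / 2) - 1) := by gcongr
    have h5 : ε * (d ^ 2 / (ε / 2) - 1) = 2 * d ^ 2 - ε := by field_simp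
    linarith

lemma exists_liftedCost_eq {ε x y : ℝ} (τ A B : ℝ) (hε : 0 < ε) (hx : 0 < x) (hy : 0 < y) :
    ∃ d, 0 < d ∧ d ^ 2 ≤ x * y ∧ liftedCost τ ε A B x y d = pairCost τ ε A B x y := by
  have hl := Real.log_mul hx.ne' hy.ne'
  have hxy := mul_pos hx hy
  have hε2 : 0 < ε / 2 := by positivity
  unfold pairCost liftedCost
  rcases le_total (x * y) (ε / 2) with h | h
  · refine ⟨√(x * y), by positivity, (Real.sq_sqrt hxy.le).le, ?_⟩
    rw [couplingGain_of_le hxy h, Real.sq_sqrt hxy.le, Real.log_sqrt hxy.le, hl]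
    ring
  · refine ⟨√(ε / 2), by positivity, by rwa [Real.sq_sqrt hε2.le], ?_⟩
    rw [couplingGain_of_ge hε h, Real.sq_sqrt hε2.le, Real.log_sqrt hε2.le, hl]
    ring

lemma pairCost_midpoint_lt {τ ε A B x₁ y₁ x₂ y₂ : ℝ} (hτ : 0 < τ) (hε : 0 < ε)
    (hx₁ : 0 < x₁) (hy₁ : 0 < y₁) (hx₂ : 0 < x₂) (hy₂ : 0 < y₂) (hne : x₁ ≠ x₂ ∨ y₁ ≠ y₂) :
    2 * pairCost τ ε A B ((x₁ + x₂) / 2) ((y₁ + y₂) / 2) <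
      pairCost τ ε A B x₁ y₁ + pairCost τ ε A B x₂ y₂ := by
  obtain ⟨d₁, hd₁, hle₁, he₁⟩ := exists_liftedCost_eq τ A B hε hx₁ hy₁
  obtain ⟨d₂, hd₂, hle₂, he₂⟩ := exists_liftedCost_eq τ A B hε hx₂ hy₂
  have hdd : 2 * (d₁ * d₂) ≤ x₁ * y₂ + x₂ * y₁ := by
    have h1 : d₁ ^ 2 * d₂ ^ 2 ≤ (x₁ * y₁) * (x₂ * y₂) := by gcongr
    refine abs_le_of_sq_le_sq' ?_ (by positivity) |>.2
    nlinarith [sq_nonneg (x₁ * y₂ - x₂ * y₁)]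
  have hmid : ((d₁ + d₂) / 2) ^ 2 ≤ ((x₁ + x₂) / 2) * ((y₁ + y₂) / 2) := by nlinarith
  have hle := pairCost_le_liftedCost (τ := τ) (A := A) (B := B) hε
    (by positivity : 0 < (x₁ + x₂) / 2) (by positivity : 0 < (y₁ + y₂) / 2)
    (by positivity : 0 < (d₁ + d₂) / 2) hmid
  have hlog : Real.log x₁ + Real.log x₂ + (Real.log y₁ + Real.log y₂) <
      2 * Real.log ((x₁ + x₂) / 2) + 2 * Real.log ((y₁ + y₂) / 2) := by
    rcases hne with h | h
    · exact add_lt_add_of_lt_of_le (log_add_log_lt_two_mul_log_midpoint hx₁ hx₂ h)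
        (log_add_log_le_two_mul_log_midpoint hy₁ hy₂)
    · exact add_lt_add_of_le_of_lt (log_add_log_le_two_mul_log_midpoint hx₁ hx₂)
        (log_add_log_lt_two_mul_log_midpoint hy₁ hy₂ h)
  have hlogd := log_add_log_le_two_mul_log_midpoint hd₁ hd₂
  rw [← he₁, ← he₂]
  refine lt_of_le_of_lt (mul_le_mul_of_nonneg_left hle (by norm_num)) ?_
  unfold liftedCost
  have h1 := mul_lt_mul_of_pos_left hlog hτ
  have h2 := mul_le_mul_of_nonneg_left hlogd hε.le
  nlinarith [sq_nonneg (d₁ - d₂), sq_nonneg ((x₁ - y₁) - (x₂ - y₂))]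

lemma pairCost_minimizer_unique {τ ε A B x y u v : ℝ} (hτ : 0 < τ) (hε : 0 < ε)
    (hx : 0 < x) (hy : 0 < y) (hu : 0 < u) (hv : 0 < v)
    (hmin : ∀ s t, 0 < s → 0 < t → pairCost τ ε A B x y ≤ pairCost τ ε A B s t)
    (hle : pairCost τ ε A B u v ≤ pairCost τ ε A B x y) : x = u ∧ y = v := by
  by_contra hne
  have := pairCost_midpoint_lt (A := A) (B := B) hτ hε hx hy hu hv (by tauto)
  linarith [hmin ((x + u) / 2) ((y + v) / 2) (by positivity) (by positivity)]

lemma pairCost_minimizer_mono {τ ε A₁ B₁ A₂ B₂ x₁ y₁ x₂ y₂ : ℝ} (hτ : 0 < τ) (hε : 0 < ε)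
    (hx₁ : 0 < x₁) (hy₁ : 0 < y₁) (hx₂ : 0 < x₂) (hy₂ : 0 < y₂) (hA : A₁ ≤ A₂) (hB : B₁ ≤ B₂)
    (hmin₁ : ∀ s t, 0 < s → 0 < t → pairCost τ ε A₁ B₁ x₁ y₁ ≤ pairCost τ ε A₁ B₁ s t)
    (hmin₂ : ∀ s t, 0 < s → 0 < t → pairCost τ ε A₂ B₂ x₂ y₂ ≤ pairCost τ ε A₂ B₂ s t) :
    x₂ ≤ x₁ ∧ y₂ ≤ y₁ := by
  have hsum : ∀ (f : ℝ → ℝ) (p q : ℝ), f (max p q) + f (min p q) = f p + f q := by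
    intro f p q
    rcases le_total p q with h | h <;> simp [h, add_comm]
  have hg := couplingGain_mul_supermodular hε hx₁ hy₁ hx₂ hy₂
  have h2 := hmin₂ (min x₁ x₂) (min y₁ y₂) (lt_min hx₁ hx₂) (lt_min hy₁ hy₂)
  have key : pairCost τ ε A₁ B₁ (max x₁ x₂) (max y₁ y₂) ≤ pairCost τ ε A₁ B₁ x₁ y₁ := by
    have e1 := hsum (fun p => p ^ 2 - (τ + ε) * Real.log p) x₁ x₂
    have e2 := hsum (fun p => p ^ 2 - (τ + ε) * Real.log p) y₁ y₂
    have e3 := hsum (fun p => A₂ * p) x₁ x₂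
    have e4 := hsum (fun p => B₂ * p) y₁ y₂
    have l1 := mul_nonneg (sub_nonneg.2 hA) (sub_nonneg.2 (le_max_left x₁ x₂))
    have l2 := mul_nonneg (sub_nonneg.2 hB) (sub_nonneg.2 (le_max_left y₁ y₂))
    unfold pairCost at h2 ⊢
    linarith
  obtain ⟨hx, hy⟩ := pairCost_minimizer_unique hτ hε hx₁ hy₁ (lt_max_of_lt_left hx₁)
    (lt_max_of_lt_left hy₁) hmin₁ key
  exact ⟨hx ▸ le_max_right _ _, hy ▸ le_max_right _ _⟩

/-- The part of the objective contributed by one uncoupled entry, with linear coefficient `A`. -/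
noncomputable def singleCost (c A x : ℝ) : ℝ := x ^ 2 - c * Real.log x + A * x

lemma singleCost_minimizer_mono {c A₁ A₂ x₁ x₂ : ℝ} (hc : 0 < c) (hx₁ : 0 < x₁) (hx₂ : 0 < x₂)
    (hA : A₁ ≤ A₂) (hmin₁ : ∀ s, 0 < s → singleCost c A₁ x₁ ≤ singleCost c A₁ s)
    (hmin₂ : ∀ s, 0 < s → singleCost c A₂ x₂ ≤ singleCost c A₂ s) : x₂ ≤ x₁ := by
  by_contra! hlt
  have h1 := hmin₁ _ (by positivity : 0 < (x₁ + x₂) / 2)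
  have h2 := hmin₂ x₁ hx₁
  have hl := mul_lt_mul_of_pos_left (log_add_log_lt_two_mul_log_midpoint hx₁ hx₂ hlt.ne) hc
  have l1 := mul_nonneg (sub_nonneg.2 hA) (sub_nonneg.2 hlt.le)
  unfold singleCost at h1 h2
  nlinarith [sq_nonneg (x₁ - x₂)]

lemma pairCost_singleCost_minimizer_mono {τ ε A₁ B₁ A₂ x₁ y₁ x₂ : ℝ} (hτ : 0 < τ) (hε : 0 < ε)
    (hx₁ : 0 < x₁) (hy₁ : 0 < y₁) (hx₂ : 0 < x₂) (hA : A₁ ≤ A₂)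
    (hmin₁ : ∀ s t, 0 < s → 0 < t → pairCost τ ε A₁ B₁ x₁ y₁ ≤ pairCost τ ε A₁ B₁ s t)
    (hmin₂ : ∀ s, 0 < s → singleCost (τ + ε) A₂ x₂ ≤ singleCost (τ + ε) A₂ s) : x₂ ≤ x₁ := by
  by_contra! hlt
  have h2 := hmin₂ x₁ hx₁
  have hg := couplingGain_mono hε (mul_pos hx₁ hy₁) (mul_le_mul_of_nonneg_right hlt.le hy₁.le)
  have l1 := mul_nonneg (sub_nonneg.2 hA) (sub_nonneg.2 hlt.le)
  have key : pairCost τ ε A₁ B₁ x₂ y₁ ≤ pairCost τ ε A₁ B₁ x₁ y₁ := by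
    unfold singleCost at h2
    unfold pairCost
    linarith
  exact hlt.ne (pairCost_minimizer_unique hτ hε hx₁ hy₁ hx₂ hy₁ hmin₁ key).1

lemma Fintype.sum_sub_sum_eq_of_forall_ne {ι : Type*} [Fintype ι] {f g : ι → ℝ} (i : ι)
    (h : ∀ j, j ≠ i → f j = g j) : ∑ j, f j - ∑ j, g j = f i - g i := by
  rw [← Finset.sum_sub_distrib]
  exact Fintype.sum_eq_single i fun j hj => sub_eq_zero.2 (h j hj)

/-- let `a : Fin m → ℝ` and `b : Fin n → ℝ` (`n ≤ m`) be positive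
non-increasing sequences and let `D` be the objective
`D(x,y) = ∑ x_i² + ∑ y_j² + (τ+ε)(∑ (x_i/a_i - log x_i) + ∑ (y_j/b_j - log y_j))
  - 2 ∑ₖ [x_k y_k - ε/2]⁺ + ε ∑ₖ [log(x_k y_k) - log(ε/2)]⁺`.
If `(x̃, ỹ)` minimizes `D` over positive sequences, then `x̃` and `ỹ` are non-increasing. -/
theorem minimizer_of_D_antitone
    (m n : ℕ) (hmn : n ≤ m) (τ ε : ℝ) (hτ : 0 < τ) (hε : 0 < ε)
    (a : Fin m → ℝ) (b : Fin n → ℝ)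
    (hapos : ∀ i, 0 < a i) (hbpos : ∀ j, 0 < b j)
    (hamono : ∀ i j : Fin m, i ≤ j → a j ≤ a i)
    (hbmono : ∀ i j : Fin n, i ≤ j → b j ≤ b i)
    (D : (Fin m → ℝ) → (Fin n → ℝ) → ℝ)
    (hD : ∀ x y, D x y = ∑ i, (x i) ^ 2 + ∑ j, (y j) ^ 2
      + (τ + ε) * (∑ i, (x i / a i - Real.log (x i)) + ∑ j, (y j / b j - Real.log (y j)))
      - 2 * ∑ k : Fin n, max (x (Fin.castLE hmn k) * y k - ε / 2) 0
      + ε * ∑ k : Fin n, max (Real.log (x (Fin.castLE hmn k) * y k) - Real.log (ε / 2)) 0)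
    (xt : Fin m → ℝ) (yt : Fin n → ℝ)
    (hxtpos : ∀ i, 0 < xt i) (hytpos : ∀ j, 0 < yt j)
    (hmin : ∀ x y, (∀ i, 0 < x i) → (∀ j, 0 < y j) → D xt yt ≤ D x y) :
    (∀ i j : Fin m, i ≤ j → xt j ≤ xt i) ∧ (∀ i j : Fin n, i ≤ j → yt j ≤ yt i) := by
  have hc : 0 < τ + ε := by positivity
  have hD' : ∀ x y, D x y = ∑ i, singleCost (τ + ε) ((τ + ε) / a i) (x i)
      + ∑ j, singleCost (τ + ε) ((τ + ε) / b j) (y j)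
      - ∑ k : Fin n, couplingGain ε (x (Fin.castLE hmn k) * y k) := by
    intro x y
    rw [hD]
    simp only [singleCost, couplingGain, sum_add_distrib, sum_sub_distrib, ← mul_sum,
      div_mul_eq_mul_div, mul_div_assoc]
    ring
  have hpair : ∀ k : Fin n, ∀ s t, 0 < s → 0 < t →
      pairCost τ ε ((τ + ε) / a (Fin.castLE hmn k)) ((τ + ε) / b k)
        (xt (Fin.castLE hmn k)) (yt k) ≤
      pairCost τ ε ((τ + ε) / a (Fin.castLE hmn k)) ((τ + ε) / b k) s t := by
    intro k s t hs ht
    have h := hmin (Function.update xt (Fin.castLE hmn k) s) (Function.update yt k t)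
      (fun i => by by_cases hi : i = Fin.castLE hmn k <;> simp [hi, hs, hxtpos])
      (fun j => by by_cases hj : j = k <;> simp [hj, ht, hytpos])
    rw [hD', hD'] at h
    have e1 := Fintype.sum_sub_sum_eq_of_forall_ne
      (f := fun i => singleCost (τ + ε) ((τ + ε) / a i)
        (Function.update xt (Fin.castLE hmn k) s i))
      (g := fun i => singleCost (τ + ε) ((τ + ε) / a i) (xt i)) (Fin.castLE hmn k)
      (fun j hj => by simp [hj])
    have e2 := Fintype.sum_sub_sum_eq_of_forall_ne
      (f := fun j => singleCost (τ + ε) ((τ + ε) / b j) (Function.update yt k t j))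
      (g := fun j => singleCost (τ + ε) ((τ + ε) / b j) (yt j)) k (fun j hj => by simp [hj])
    have e3 := Fintype.sum_sub_sum_eq_of_forall_ne
      (f := fun l => couplingGain ε (Function.update xt (Fin.castLE hmn k) s (Fin.castLE hmn l)
        * Function.update yt k t l))
      (g := fun l => couplingGain ε (xt (Fin.castLE hmn l) * yt l)) k
      (fun j hj => by simp [hj])
    simp only [Function.update_self] at e1 e2 e3
    simp only [singleCost] at e1 e2 h
    unfold pairCost
    linarith
  have hsingle : ∀ i : Fin m, n ≤ i → ∀ s, 0 < s →
      singleCost (τ + ε) ((τ + ε) / a i) (xt i) ≤ singleCost (τ + ε) ((τ + ε) / a i) s := by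
    intro i hi s hs
    have h := hmin (Function.update xt i s) yt
      (fun l => by by_cases hl : l = i <;> simp [hl, hs, hxtpos]) hytpos
    have hne : ∀ k : Fin n, Fin.castLE hmn k ≠ i := by
      intro k hk
      have := congrArg Fin.val hk
      simp at this
      omega
    rw [hD', hD'] at h
    have e1 := Fintype.sum_sub_sum_eq_of_forall_ne
      (f := fun l => singleCost (τ + ε) ((τ + ε) / a l) (Function.update xt i s l))
      (g := fun l => singleCost (τ + ε) ((τ + ε) / a l) (xt l)) i (fun j hj => by simp [hj])
    simp only [Function.update_self] at e1
    simp only [ne_eq, hne, not_false_eq_true, Function.update_of_ne] at h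
    linarith
  have hA : ∀ i j : Fin m, i ≤ j → (τ + ε) / a i ≤ (τ + ε) / a j := fun i j hij =>
    div_le_div_of_nonneg_left hc.le (hapos j) (hamono i j hij)
  have hB : ∀ i j : Fin n, i ≤ j → (τ + ε) / b i ≤ (τ + ε) / b j := fun i j hij =>
    div_le_div_of_nonneg_left hc.le (hbpos j) (hbmono i j hij)
  have hcoupled : ∀ i j : Fin n, i ≤ j →
      xt (Fin.castLE hmn j) ≤ xt (Fin.castLE hmn i) ∧ yt j ≤ yt i := fun i j hij =>
    pairCost_minimizer_mono hτ hε (hxtpos _) (hytpos _) (hxtpos _) (hytpos _)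
      (hA _ _ hij) (hB _ _ hij) (hpair i) (hpair j)
  refine ⟨fun i j hij => ?_, fun i j hij => (hcoupled i j hij).2⟩
  rcases lt_or_ge (j : ℕ) n with hj | hj
  · exact (hcoupled ⟨i, lt_of_le_of_lt hij hj⟩ ⟨j, hj⟩ hij).1
  rcases lt_or_ge (i : ℕ) n with hi | hi
  · exact pairCost_singleCost_minimizer_mono hτ hε (hxtpos i) (hytpos ⟨i, hi⟩) (hxtpos j)
      (hA i j hij) (hpair ⟨i, hi⟩) (hsingle j hj)
  · exact singleCost_minimizer_mono hc (hxtpos i) (hxtpos j) (hA i j hij) (hsingle i hi)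
      (hsingle j hj)
end

section
/- For ℓ = 1,…,n let μ_ℓ = N(0,Σ_ℓ) be a centered Gaussian measure on R^{m_ℓ} with Σ_ℓ = diag(λ_{ℓ,1},…,λ_{ℓ,m_ℓ}) diagonal with positive non-increasing entries, let α_1,…,α_n > 0 with Σ_ℓ α_ℓ = 1, and let d be a positive integer with d ≤ max_ℓ m_ℓ. Then the IGW barycenter problem inf over probability measures μ on R^d and couplings π_ℓ ∈ Π(μ_ℓ, μ) of Σ_{ℓ=1}^{n} α_ℓ · E_{π_ℓ}[(⟨X_ℓ,X_ℓ′⟩ − ⟨Y,Y′⟩)²] is attained at the Gaussian measure μ* = N(0,Σ_{μ*}), where Σ_{μ*} = diag(λ_{μ*,1},…,λ_{μ*,d}) with λ_{μ*,j} = Σ_{ℓ=1}^{n} α_ℓ λ_{ℓ,j} · 1_{j ≤ m_ℓ}. -/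
open MeasureTheory Matrix ENNReal

section Auxiliary

open ProbabilityTheory Finset

section Rearrangement

/-- Linear programming dual certificate for the rearrangement inequality: the potential
`u i = ∑_{i ≤ j < N} b j (a j - a (j+1))`. -/
theorem exists_dual_potentials {a b : ℕ → ℝ} (ha : Antitone a) (hb : Antitone b)
    (ha0 : ∀ i, 0 ≤ a i) (hb0 : ∀ i, 0 ≤ b i) (N : ℕ) (haN : a N = 0) :
    ∃ u v : ℕ → ℝ, (∀ i ≤ N, 0 ≤ u i) ∧ (∀ i ≤ N, 0 ≤ v i) ∧
      (∀ i ≤ N, ∀ k ≤ N, a i * b k ≤ u i + v k) ∧ ∀ i ≤ N, u i + v i = a i * b i := by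
  let U : ℕ → ℝ := fun i => ∑ j ∈ range i, b j * (a j - a (j + 1))
  let V : ℕ → ℝ := fun i => ∑ j ∈ range i, a (j + 1) * (b j - b (j + 1))
  have hU : ∀ i k, i ≤ k → b k * (a i - a k) ≤ U k - U i := by
    intro i k hik
    induction k, hik using Nat.le_induction with
    | base => simp
    | succ k hik ih =>
      simp only [U, sum_range_succ] at ih ⊢
      nlinarith [mul_nonneg (sub_nonneg.2 (hb k.le_succ)) (sub_nonneg.2 (ha hik)),
        mul_nonneg (sub_nonneg.2 (hb k.le_succ)) (sub_nonneg.2 (ha k.le_succ))]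
  have hV : ∀ i k, i ≤ k → a k * (b i - b k) ≤ V k - V i := by
    intro i k hik
    induction k, hik using Nat.le_induction with
    | base => simp
    | succ k hik ih =>
      simp only [V, sum_range_succ] at ih ⊢
      nlinarith [mul_nonneg (sub_nonneg.2 (ha k.le_succ)) (sub_nonneg.2 (hb hik)),
        mul_nonneg (sub_nonneg.2 (ha k.le_succ)) (sub_nonneg.2 (hb k.le_succ))]
  have hUV : ∀ i, U i + V i = a 0 * b 0 - a i * b i := by
    intro i
    induction i with
    | zero => simp [U, V]
    | succ i ih =>
      simp only [U, V, sum_range_succ] at ih ⊢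
      linarith
  have hsum : ∀ i, U N - U i + (V N - V i) = a i * b i := by
    intro i
    have h1 := hUV i
    have h2 := hUV N
    rw [haN] at h2
    linarith
  refine ⟨fun i => U N - U i, fun i => V N - V i, fun i hi => ?_, fun i hi => ?_,
    fun i hi k hk => ?_, fun i _ => hsum i⟩
  · exact (mul_nonneg (hb0 N) (sub_nonneg.2 (ha hi))).trans (hU i N hi)
  · exact (mul_nonneg (ha0 N) (sub_nonneg.2 (hb hi))).trans (hV i N hi)
  · rcases le_total i k with h | h
    · linarith [hsum k, hU i k h]
    · linarith [hsum i, hV k i h]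

/-- Rearrangement inequality for doubly substochastic matrices, in normalized form. -/
theorem sum_mul_le_of_doublySubstochastic {m d : ℕ} {a : Fin m → ℝ} {b : Fin d → ℝ}
    (ha : Antitone a) (hb : Antitone b) (ha0 : ∀ i, 0 ≤ a i) (hb0 : ∀ k, 0 ≤ b k)
    {P : Fin m → Fin d → ℝ} (hP : ∀ i k, 0 ≤ P i k) (hrow : ∀ i, ∑ k, P i k ≤ 1)
    (hcol : ∀ k, ∑ i, P i k ≤ 1) :
    ∑ i, ∑ k, a i * b k * P i k ≤
      ∑ k : Fin d, b k * (if h : (k : ℕ) < m then a ⟨k, h⟩ else 0) := by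
  have ext_anti : ∀ {r : ℕ} {c : Fin r → ℝ}, Antitone c → (∀ i, 0 ≤ c i) →
      Antitone (fun j : ℕ => if h : j < r then c ⟨j, h⟩ else 0) := by
    intro r c hc hc0 i j hij
    dsimp only
    split_ifs with h1 h2 h2
    · exact hc hij
    · omega
    · exact hc0 _
    · exact le_rfl
  let A : ℕ → ℝ := fun j => if h : j < m then a ⟨j, h⟩ else 0
  let B : ℕ → ℝ := fun j => if h : j < d then b ⟨j, h⟩ else 0
  have hA0 : ∀ i, 0 ≤ A i := fun i => by dsimp only [A]; split_ifs <;> simp [ha0]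
  have hB0 : ∀ i, 0 ≤ B i := fun i => by dsimp only [B]; split_ifs <;> simp [hb0]
  have hAe : ∀ i : Fin m, A i = a i := fun i => by simp [A]
  have hBe : ∀ i : Fin d, B i = b i := fun i => by simp [B]
  obtain ⟨u, v, hu, hv, huv, hdiag⟩ := exists_dual_potentials (ext_anti ha ha0)
    (ext_anti hb hb0) hA0 hB0 (m + d) (by simp)
  calc ∑ i, ∑ k, a i * b k * P i k
      ≤ ∑ i : Fin m, ∑ k : Fin d, (u i + v k) * P i k := by
        refine sum_le_sum fun i _ => sum_le_sum fun k _ => ?_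
        refine mul_le_mul_of_nonneg_right ?_ (hP i k)
        rw [← hAe, ← hBe]
        exact huv i (by omega) k (by omega)
    _ = ∑ i : Fin m, u i * ∑ k, P i k + ∑ k : Fin d, v k * ∑ i, P i k := by
        simp_rw [add_mul, sum_add_distrib, mul_sum]
        congr 1
        exact sum_comm
    _ ≤ ∑ i : Fin m, u i + ∑ k : Fin d, v k := by
        refine add_le_add (sum_le_sum fun i _ => ?_) (sum_le_sum fun k _ => ?_)
        · exact mul_le_of_le_one_right (hu i (by omega)) (hrow i)
        · exact mul_le_of_le_one_right (hv k (by omega)) (hcol k)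
    _ ≤ ∑ j ∈ range (m + d), u j + ∑ j ∈ range (m + d), v j := by
        rw [Fin.sum_univ_eq_sum_range u, Fin.sum_univ_eq_sum_range v]
        refine add_le_add
          (sum_le_sum_of_subset_of_nonneg (range_mono (by omega)) fun i hi _ => hu i ?_)
          (sum_le_sum_of_subset_of_nonneg (range_mono (by omega)) fun i hi _ => hv i ?_)
        all_goals exact (mem_range.1 hi).le
    _ = ∑ j ∈ range (m + d), A j * B j := by
        rw [← sum_add_distrib]
        exact sum_congr rfl fun j hj => hdiag j (mem_range.1 hj).le
    _ = ∑ j ∈ range d, A j * B j := by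
        refine (sum_subset (range_mono (by omega)) fun j _ hj => ?_).symm
        have : B j = 0 := dif_neg (by simpa using hj)
        rw [this, mul_zero]
    _ = ∑ k : Fin d, b k * (if h : (k : ℕ) < m then a ⟨k, h⟩ else 0) := by
        rw [← Fin.sum_univ_eq_sum_range (fun j => A j * B j)]
        exact sum_congr rfl fun k _ => by rw [hBe, mul_comm]

end Rearrangement

section CrossMoments

variable {Ω : Type*} [MeasurableSpace Ω] {P : Measure Ω}

/-- Bessel's inequality for an orthogonal (not necessarily normalized, possibly degenerate)
family in `L²`. -/
theorem sum_sq_integral_mul_div_le {κ : Type*} [Fintype κ] [DecidableEq κ] {f : Ω → ℝ}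
    {g : κ → Ω → ℝ} {s : κ → ℝ} (hf : MemLp f 2 P) (hg : ∀ k, MemLp (g k) 2 P)
    (hgg : ∀ k l, ∫ x, g k x * g l x ∂P = if k = l then s k else 0) :
    ∑ k, (∫ x, f x * g k x ∂P) ^ 2 / s k ≤ ∫ x, f x * f x ∂P := by
  let D : κ → ℝ := fun k => ∫ x, f x * g k x ∂P
  let c : κ → ℝ := fun k => D k / s k
  have hfg : ∀ k, Integrable (fun x => f x * g k x) P := fun k => hf.integrable_mul (hg k)
  have hggi : ∀ k l, Integrable (fun x => g k x * g l x) P :=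
    fun k l => (hg k).integrable_mul (hg l)
  have key : ∫ x, (f x - ∑ k, c k * g k x) ^ 2 ∂P =
      ∫ x, f x * f x ∂P - ∑ k, D k ^ 2 / s k := by
    have h1 : ∀ x, (f x - ∑ k, c k * g k x) ^ 2 = f x * f x -
        ∑ k, 2 * c k * (f x * g k x) + ∑ k, ∑ l, c k * c l * (g k x * g l x) := by
      intro x
      have e1 : ∑ k, 2 * c k * (f x * g k x) = 2 * f x * ∑ k, c k * g k x := by
        rw [mul_sum]; exact sum_congr rfl fun k _ => by ring
      have e2 : ∑ k, ∑ l, c k * c l * (g k x * g l x) = (∑ k, c k * g k x) ^ 2 := by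
        rw [sq, sum_mul_sum]
        exact sum_congr rfl fun k _ => sum_congr rfl fun l _ => by ring
      rw [e1, e2]; ring
    simp_rw [h1]
    rw [integral_add, integral_sub, integral_finsetSum, integral_finsetSum]
    · simp_rw [integral_const_mul]
      have : ∀ k, ∫ x, ∑ l, c k * c l * (g k x * g l x) ∂P = D k ^ 2 / s k := by
        intro k
        rw [integral_finsetSum _ fun l _ => (hggi k l).const_mul _]
        simp_rw [integral_const_mul, hgg]
        simp only [mul_ite, mul_zero, sum_ite_eq, mem_univ, if_true, c]
        by_cases hs : s k = 0
        · simp [hs]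
        · field_simp
      simp_rw [this]
      rw [sub_add, ← sum_sub_distrib]
      congr 1
      refine sum_congr rfl fun k _ => ?_
      simp only [c, D]
      ring
    · exact fun k _ => integrable_finsetSum _ fun l _ => (hggi k l).const_mul _
    · exact fun k _ => (hfg k).const_mul _
    · exact hf.integrable_mul hf
    · exact integrable_finsetSum _ fun k _ => (hfg k).const_mul _
    · exact (hf.integrable_mul hf).sub (integrable_finsetSum _ fun k _ => (hfg k).const_mul _)
    · exact integrable_finsetSum _ fun k _ => integrable_finsetSum _ fun l _ =>
        (hggi k l).const_mul _
  have h0 : 0 ≤ ∫ x, (f x - ∑ k, c k * g k x) ^ 2 ∂P := integral_nonneg fun x => sq_nonneg _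
  rw [key] at h0
  linarith

/-- The squared Hilbert–Schmidt norm of the cross second moments of two orthogonal families is
at most the sum of the products of the ordered second moments. -/
theorem sum_sq_integral_mul_le {m d : ℕ} {a : Fin m → ℝ} {s : Fin d → ℝ}
    (ha : Antitone a) (hs : Antitone s) (ha0 : ∀ i, 0 < a i) (hs0 : ∀ k, 0 ≤ s k)
    {f : Fin m → Ω → ℝ} {g : Fin d → Ω → ℝ}
    (hf : ∀ i, MemLp (f i) 2 P) (hg : ∀ k, MemLp (g k) 2 P)
    (hff : ∀ i j, ∫ x, f i x * f j x ∂P = if i = j then a i else 0)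
    (hgg : ∀ k l, ∫ x, g k x * g l x ∂P = if k = l then s k else 0) :
    ∑ i, ∑ k, (∫ x, f i x * g k x ∂P) ^ 2 ≤
      ∑ k : Fin d, s k * (if h : (k : ℕ) < m then a ⟨k, h⟩ else 0) := by
  let D : Fin m → Fin d → ℝ := fun i k => ∫ x, f i x * g k x ∂P
  have hrow : ∀ i, ∑ k, D i k ^ 2 / s k ≤ a i := fun i => by
    simpa [hff] using sum_sq_integral_mul_div_le (hf i) hg hgg
  have hcol : ∀ k, ∑ i, D i k ^ 2 / a i ≤ s k := fun k => by
    have := sum_sq_integral_mul_div_le (hg k) hf hff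
    simp_rw [mul_comm (g k _) (f _ _)] at this
    simpa [hgg] using this
  have hD : ∀ i k, s k = 0 → D i k = 0 := by
    intro i k hk
    have h1 : D i k ^ 2 / a i ≤ 0 := hk ▸ (single_le_sum
      (fun j _ => div_nonneg (sq_nonneg (D j k)) (ha0 j).le) (mem_univ i)).trans (hcol k)
    have h2 : D i k ^ 2 ≤ 0 := by
      rw [div_le_iff₀ (ha0 i)] at h1; linarith
    exact pow_eq_zero_iff two_ne_zero |>.1 (le_antisymm h2 (sq_nonneg _))
  have := sum_mul_le_of_doublySubstochastic (P := fun i k => D i k ^ 2 / (a i * s k)) ha hs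
    (fun i => (ha0 i).le) hs0
    (fun i k => div_nonneg (sq_nonneg _) (mul_nonneg (ha0 i).le (hs0 k)))
    (fun i => by
      have e : ∑ k, D i k ^ 2 / (a i * s k) = (∑ k, D i k ^ 2 / s k) / a i := by
        rw [sum_div]; exact sum_congr rfl fun k _ => by rw [div_div, mul_comm]
      rw [e]
      exact div_le_one_of_le₀ (hrow i) (ha0 i).le)
    (fun k => by
      have e : ∑ i, D i k ^ 2 / (a i * s k) = (∑ i, D i k ^ 2 / a i) / s k := by
        rw [sum_div]; exact sum_congr rfl fun i _ => by rw [div_div]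
      rw [e]
      exact div_le_one_of_le₀ (hcol k) (hs0 k))
  refine le_trans (le_of_eq ?_) this
  refine sum_congr rfl fun i _ => sum_congr rfl fun k _ => ?_
  change D i k ^ 2 = _
  by_cases hk : s k = 0
  · simp [hk, hD i k hk]
  · have := (ha0 i).ne'
    field_simp

/-- Independent-copy expansion of the square of a bilinear form. -/
theorem integral_integral_sq_sum_s13 [SFinite P] {ι : Type*} [Fintype ι] (ε : ι → ℝ)
    {f : ι → Ω → ℝ} (hf : ∀ i, MemLp (f i) 2 P) :
    Integrable (fun pq : Ω × Ω => (∑ i, ε i * (f i pq.1 * f i pq.2)) ^ 2) (P.prod P) ∧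
    ∫ p, ∫ q, (∑ i, ε i * (f i p * f i q)) ^ 2 ∂P ∂P =
      ∑ i, ∑ j, ε i * ε j * (∫ x, f i x * f j x ∂P) ^ 2 := by
  have hfi : ∀ i j, Integrable (fun x => f i x * f j x) P :=
    fun i j => (hf i).integrable_mul (hf j)
  have h1 : ∀ p q, (∑ i, ε i * (f i p * f i q)) ^ 2 =
      ∑ i, ∑ j, ε i * ε j * ((f i p * f j p) * (f i q * f j q)) := by
    intro p q
    rw [sq, sum_mul_sum]
    exact sum_congr rfl fun k _ => sum_congr rfl fun l _ => by ring
  simp_rw [h1]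
  refine ⟨integrable_finsetSum _ fun i _ => integrable_finsetSum _ fun j _ =>
    ((hfi i j).mul_prod (hfi i j)).const_mul _, ?_⟩
  have h2 : ∀ p, ∫ q, ∑ i, ∑ j, ε i * ε j * ((f i p * f j p) * (f i q * f j q)) ∂P =
      ∑ i, ∑ j, ε i * ε j * ((∫ x, f i x * f j x ∂P) * (f i p * f j p)) := by
    intro p
    rw [integral_finsetSum _ fun i _ => integrable_finsetSum _ fun j _ =>
      ((hfi i j).const_mul _).const_mul _]
    refine sum_congr rfl fun i _ => ?_
    rw [integral_finsetSum _ fun j _ => ((hfi i j).const_mul _).const_mul _]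
    refine sum_congr rfl fun j _ => ?_
    rw [integral_const_mul, integral_const_mul]
    ring
  simp_rw [h2]
  rw [integral_finsetSum _ fun i _ => integrable_finsetSum _ fun j _ =>
    ((hfi i j).const_mul _).const_mul _]
  refine sum_congr rfl fun i _ => ?_
  rw [integral_finsetSum _ fun j _ => ((hfi i j).const_mul _).const_mul _]
  refine sum_congr rfl fun j _ => ?_
  rw [integral_const_mul, integral_const_mul]
  ring

/-- The inner-product Gromov–Wasserstein functional in terms of orthogonal coordinates. -/
theorem integral_integral_sq_sub [SFinite P] {ι κ : Type*} [Fintype ι] [DecidableEq ι]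
    [Fintype κ] [DecidableEq κ] {a : ι → ℝ} {s : κ → ℝ} {f : ι → Ω → ℝ} {g : κ → Ω → ℝ}
    (hf : ∀ i, MemLp (f i) 2 P) (hg : ∀ k, MemLp (g k) 2 P)
    (hff : ∀ i j, ∫ x, f i x * f j x ∂P = if i = j then a i else 0)
    (hgg : ∀ k l, ∫ x, g k x * g l x ∂P = if k = l then s k else 0) :
    Integrable (fun pq : Ω × Ω =>
      (∑ i, f i pq.1 * f i pq.2 - ∑ k, g k pq.1 * g k pq.2) ^ 2) (P.prod P) ∧
    ∫ p, ∫ q, (∑ i, f i p * f i q - ∑ k, g k p * g k q) ^ 2 ∂P ∂P =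
      ∑ i, a i ^ 2 + ∑ k, s k ^ 2 - 2 * ∑ i, ∑ k, (∫ x, f i x * g k x ∂P) ^ 2 := by
  have := integral_integral_sq_sum_s13 (P := P) (Sum.elim (fun _ : ι => (1 : ℝ)) fun _ : κ => -1)
    (f := Sum.elim f g) (by rintro (i | k) <;> simp [hf, hg])
  simp only [Fintype.sum_sum_type, Sum.elim_inl, Sum.elim_inr, one_mul, neg_mul,
    sum_neg_distrib, ← sub_eq_add_neg, mul_neg] at this
  refine ⟨this.1, this.2.trans ?_⟩
  have hcomm : ∑ k, ∑ i, (∫ x, g k x * f i x ∂P) ^ 2 = ∑ i, ∑ k, (∫ x, f i x * g k x ∂P) ^ 2 := by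
    rw [sum_comm]
    simp_rw [mul_comm]
  simp_rw [hff, hgg, ite_pow, zero_pow two_ne_zero, sum_ite_eq, mem_univ, if_true,
    sum_sub_distrib, sum_neg_distrib, hcomm]
  ring

end CrossMoments

section SecondMoments

variable {Ω : Type*} [MeasurableSpace Ω] {P : Measure Ω}

/-- If the inner product of two independent copies of a random vector is square integrable,
then so is the random vector. -/
theorem memLp_coord_of_integrable_sq_dotProduct [SFinite P] {d : ℕ} {Y : Ω → Fin d → ℝ}
    (hY : Measurable Y)
    (h : Integrable (fun pq : Ω × Ω => (Y pq.1 ⬝ᵥ Y pq.2) ^ 2) (P.prod P)) (i : Fin d) :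
    MemLp (fun x => Y x i) 2 P := by
  let V : Submodule ℝ (EuclideanSpace ℝ (Fin d)) :=
    { carrier := {v | MemLp (fun x => v.ofLp ⬝ᵥ Y x) 2 P}
      add_mem' := fun {v w} hv hw => by
        simpa [add_dotProduct] using! MemLp.add hv hw
      zero_mem' := by simp
      smul_mem' := fun c v hv => by
        simpa [smul_dotProduct] using! MemLp.const_mul hv c }
  have hmem : ∀ᵐ p ∂P, WithLp.toLp 2 (Y p) ∈ V := by
    filter_upwards [h.prod_right_ae] with p hp
    have hm : Measurable fun x => Y p ⬝ᵥ Y x := by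
      unfold dotProduct; fun_prop
    exact (memLp_two_iff_integrable_sq hm.aestronglyMeasurable).2 hp
  let e : EuclideanSpace ℝ (Fin d) := EuclideanSpace.single i 1
  have hPe : V.starProjection e ∈ V := Submodule.starProjection_apply_mem V e
  refine MemLp.ae_eq ?_ hPe
  filter_upwards [hmem] with p hp
  have h1 := V.inner_starProjection_left_eq_right e (WithLp.toLp 2 (Y p))
  rw [Submodule.starProjection_eq_self_iff.2 hp] at h1
  simpa [e, EuclideanSpace.inner_eq_star_dotProduct, dotProduct_comm] using! h1

/-- Principal axes of a square integrable random vector, ordered by decreasing second moment. -/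
theorem exists_principal_axes {d : ℕ} {Y : Ω → Fin d → ℝ}
    (hY : ∀ i, MemLp (fun x => Y x i) 2 P) :
    ∃ (s : Fin d → ℝ) (b : Fin d → Fin d → ℝ), Antitone s ∧ (∀ k, 0 ≤ s k) ∧
      (∀ y z : Fin d → ℝ, y ⬝ᵥ z = ∑ k, (b k ⬝ᵥ y) * (b k ⬝ᵥ z)) ∧
      ∀ k l, ∫ x, (b k ⬝ᵥ Y x) * (b l ⬝ᵥ Y x) ∂P = if k = l then s k else 0 := by
  let S : Matrix (Fin d) (Fin d) ℝ := Matrix.of fun i j => ∫ x, Y x i * Y x j ∂P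
  have hS : S.IsHermitian := by
    ext i j
    simp [S, Matrix.conjTranspose_apply, mul_comm]
  have hT := Matrix.isSymmetric_toEuclideanLin_iff.2 hS
  have hn : Module.finrank ℝ (EuclideanSpace ℝ (Fin d)) = d := by simp
  let B := hT.eigenvectorBasis hn
  let s := hT.eigenvalues hn
  have hint : ∀ u v : Fin d → ℝ, ∫ x, (u ⬝ᵥ Y x) * (v ⬝ᵥ Y x) ∂P = u ⬝ᵥ (S *ᵥ v) := by
    intro u v
    have h1 : ∀ x, (u ⬝ᵥ Y x) * (v ⬝ᵥ Y x) = ∑ i, ∑ j, u i * v j * (Y x i * Y x j) := by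
      intro x
      simp only [dotProduct, sum_mul_sum]
      exact sum_congr rfl fun _ _ => sum_congr rfl fun _ _ => by ring
    have hi : ∀ i j, Integrable (fun x => u i * v j * (Y x i * Y x j)) P :=
      fun i j => ((hY i).integrable_mul (hY j)).const_mul _
    simp_rw [h1]
    rw [integral_finsetSum _ fun i _ => integrable_finsetSum _ fun j _ => hi i j]
    simp only [dotProduct, Matrix.mulVec, mul_sum]
    refine sum_congr rfl fun i _ => ?_
    rw [integral_finsetSum _ fun j _ => hi i j]
    refine sum_congr rfl fun j _ => ?_
    rw [integral_const_mul]
    simp only [S, Matrix.of_apply]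
    ring
  have horth : ∀ k l, ∫ x, ((B k).ofLp ⬝ᵥ Y x) * ((B l).ofLp ⬝ᵥ Y x) ∂P =
      if k = l then s k else 0 := by
    intro k l
    have h1 : S *ᵥ (B l).ofLp = s l • (B l).ofLp :=
      congrArg WithLp.ofLp (hT.apply_eigenvectorBasis hn l)
    have h2 : (B k).ofLp ⬝ᵥ (B l).ofLp = if k = l then 1 else 0 := by
      have := orthonormal_iff_ite.1 B.orthonormal k l
      rwa [EuclideanSpace.inner_eq_star_dotProduct, star_trivial, dotProduct_comm] at this
    rw [hint, h1, dotProduct_smul, h2]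
    split_ifs with h <;> simp [h]
  refine ⟨s, fun k => (B k).ofLp, hT.eigenvalues_antitone hn, fun k => ?_, fun y z => ?_, horth⟩
  · have := horth k k
    rw [if_pos rfl] at this
    rw [← this]
    exact integral_nonneg fun x => mul_self_nonneg _
  · have := B.sum_inner_mul_inner (WithLp.toLp 2 y) (WithLp.toLp 2 z)
    simp only [EuclideanSpace.inner_eq_star_dotProduct, star_trivial] at this
    rw [dotProduct_comm y z, ← this]
    exact sum_congr rfl fun k _ => by rw [dotProduct_comm z]

end SecondMoments

section Gaussian

/-- A centered Gaussian with diagonal covariance is a product of one-dimensional Gaussians. -/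
theorem gaussianMeasure_diagonal {ι : Type*} [Fintype ι] [DecidableEq ι] {c : ι → ℝ}
    (hc : ∀ i, 0 < c i) :
    gaussianMeasure (Matrix.diagonal c) =
      Measure.pi fun i => gaussianReal 0 (c i).toNNReal := by
  have hdens : ∀ x : ι → ℝ, gaussianPdf (Matrix.diagonal c) x =
      ENNReal.ofReal (∏ i, gaussianPDFReal 0 (c i).toNNReal (x i)) := by
    intro x
    unfold gaussianPdf
    congr 1
    have hinv : (Matrix.diagonal c)⁻¹ = Matrix.diagonal fun i => (c i)⁻¹ := by
      refine Matrix.inv_eq_right_inv ?_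
      rw [Matrix.diagonal_mul_diagonal, ← Matrix.diagonal_one]
      congr 1
      ext i
      exact mul_inv_cancel₀ (hc i).ne'
    have hdet : (2 * Real.pi) ^ Fintype.card ι * (Matrix.diagonal c).det =
        ∏ i, (2 * Real.pi * c i) := by
      rw [Matrix.det_diagonal, prod_mul_distrib, prod_const, card_univ]
    rw [hinv, hdet, Real.sqrt_prod _ fun i _ => by have := hc i; positivity]
    simp only [gaussianPDFReal, sub_zero, Real.coe_toNNReal _ (hc _).le]
    rw [prod_mul_distrib, ← Real.exp_sum, div_eq_mul_inv, mul_comm, ← Finset.prod_inv_distrib]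
    congr 2
    simp only [dotProduct, Matrix.mulVec_diagonal, ← sum_neg_distrib, sum_div]
    refine sum_congr rfl fun i _ => ?_
    have := (hc i).ne'
    field_simp
  have hv : ∀ i, (c i).toNNReal ≠ 0 := fun i => by simpa using hc i
  refine (Measure.pi_eq fun t ht => ?_).symm
  have hpos : ∀ i x, 0 ≤ gaussianPDFReal 0 (c i).toNNReal x :=
    fun i x => gaussianPDFReal_nonneg _ _ _
  rw [gaussianMeasure, withDensity_apply _ (MeasurableSet.univ_pi ht)]
  simp_rw [hdens, gaussianReal_apply_eq_integral _ (hv _)]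
  rw [volume_pi, Measure.restrict_pi_pi, ← ofReal_integral_eq_lintegral_ofReal,
    integral_fintype_prod_eq_prod (fun i x => gaussianPDFReal 0 (c i).toNNReal x),
    ENNReal.ofReal_prod_of_nonneg]
  · exact fun i _ => integral_nonneg (hpos i)
  · exact Integrable.fintype_prod_dep fun i => (integrable_gaussianPDFReal _ _).restrict
  · exact ae_of_all _ fun x => prod_nonneg fun i _ => hpos i (x i)

variable {Ω : Type*} [MeasurableSpace Ω] {P : Measure Ω}

/-- Second moments of a centered Gaussian vector with diagonal covariance. -/
theorem memLp_and_integral_mul_of_map_eq_gaussianMeasure {ι : Type*} [Fintype ι] [DecidableEq ι]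
    {c : ι → ℝ} (hc : ∀ i, 0 < c i) {X : Ω → ι → ℝ} (hX : Measurable X)
    (h : P.map X = gaussianMeasure (Matrix.diagonal c)) :
    (∀ i, MemLp (fun x => X x i) 2 P) ∧
      ∀ i j, ∫ x, X x i * X x j ∂P = if i = j then c i else 0 := by
  rw [gaussianMeasure_diagonal hc] at h
  let ν : ι → Measure ℝ := fun i => gaussianReal 0 (c i).toNNReal
  have hL : ∀ i, MemLp (fun x : ι → ℝ => x i) 2 (Measure.pi ν) := fun i =>
    (memLp_id_gaussianReal (μ := 0) (v := (c i).toNNReal) 2).comp_measurePreserving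
      (measurePreserving_eval ν i)
  have hmean : ∀ i, ∫ x : ι → ℝ, x i ∂(Measure.pi ν) = 0 := fun i => by
    rw [integral_comp_eval (μ := ν) (f := fun x => x) (by fun_prop)]
    simp [ν]
  have hvar : ∀ i, ∫ x : ι → ℝ, x i * x i ∂(Measure.pi ν) = c i := fun i => by
    rw [integral_comp_eval (μ := ν) (f := fun x => x * x) (by fun_prop)]
    have := variance_fun_id_gaussianReal (μ := 0) (v := (c i).toNNReal)
    rw [variance_of_integral_eq_zero (by fun_prop) (by simp), Real.coe_toNNReal _ (hc i).le] at this
    rw [← this]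
    simp [ν, sq]
  have hind : iIndepFun (fun i (x : ι → ℝ) => x i) (Measure.pi ν) :=
    iIndepFun_pi (X := fun _ x => x) fun _ => aemeasurable_id
  have hmom : ∀ i j, ∫ x : ι → ℝ, x i * x j ∂(Measure.pi ν) = if i = j then c i else 0 := by
    intro i j
    split_ifs with hij
    · subst hij; exact hvar i
    · rw [(hind.indepFun hij).integral_fun_mul_eq_mul_integral
        (hL i).aestronglyMeasurable (hL j).aestronglyMeasurable, hmean, zero_mul]
  refine ⟨fun i => ?_, fun i j => ?_⟩
  · have := hL i
    rw [← h] at this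
    exact this.comp_of_map hX.aemeasurable
  · rw [← hmom, ← h, integral_map hX.aemeasurable (by fun_prop)]

/-- Rescaling distinct coordinates of a standard Gaussian vector. -/
theorem map_sqrt_mul_coord_eq_gaussianMeasure {N k : ℕ} {c : Fin k → ℝ} (hc : ∀ i, 0 < c i)
    {e : Fin k → Fin N} (he : Function.Injective e) :
    (Measure.pi fun _ : Fin N => gaussianReal 0 1).map (fun w i => √(c i) * w (e i)) =
      gaussianMeasure (Matrix.diagonal c) := by
  have hind : iIndepFun (fun i (w : Fin N → ℝ) => √(c i) * w (e i))
      (Measure.pi fun _ : Fin N => gaussianReal 0 1) :=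
    ((iIndepFun_pi (X := fun _ (x : ℝ) => x) fun _ => aemeasurable_id).precomp he).comp
      (fun i (x : ℝ) => √(c i) * x) (fun i => by fun_prop)
  rw [gaussianMeasure_diagonal hc, hind.map_fun_eq_pi_map fun i =>
    Measurable.aemeasurable (by fun_prop)]
  congr 1
  ext1 i
  have h1 : (Measure.pi fun _ : Fin N => gaussianReal 0 1).map (fun w => w (e i)) =
      gaussianReal 0 1 := (measurePreserving_eval (fun _ : Fin N => gaussianReal 0 1) (e i)).map_eq
  have h2 := gaussianReal_map_const_mul (μ := 0) (v := 1) (√(c i))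
  rw [← h1, Measure.map_map (by fun_prop) (by fun_prop)] at h2
  refine h2.trans ?_
  rw [mul_zero, mul_one]
  congr 1
  ext
  simp [Real.sq_sqrt (hc i).le, (hc i).le]

/-- Two Gaussians with diagonal covariances on spaces of possibly different dimensions admit a
coupling whose matching coordinates are fully correlated, all others being uncorrelated. -/
theorem exists_diagonal_coupling {m d : ℕ} {a : Fin m → ℝ} {c : Fin d → ℝ}
    (ha : ∀ i, 0 < a i) (hc : ∀ k, 0 < c k) :
    ∃ γ : Measure ((Fin m → ℝ) × (Fin d → ℝ)), IsProbabilityMeasure γ ∧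
      γ.map Prod.fst = gaussianMeasure (Matrix.diagonal a) ∧
      γ.map Prod.snd = gaussianMeasure (Matrix.diagonal c) ∧
      ∑ i, ∑ k, (∫ p, p.1 i * p.2 k ∂γ) ^ 2 =
        ∑ k : Fin d, c k * (if h : (k : ℕ) < m then a ⟨k, h⟩ else 0) := by
  let ν : Measure (Fin (m + d) → ℝ) := Measure.pi fun _ => gaussianReal 0 1
  let X : (Fin (m + d) → ℝ) → Fin m → ℝ := fun w i => √(a i) * w (i.castLE (by omega))
  let Y : (Fin (m + d) → ℝ) → Fin d → ℝ := fun w k => √(c k) * w (k.castLE (by omega))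
  have hX : Measurable X := by fun_prop
  have hY : Measurable Y := by fun_prop
  have hmom : ∀ i j, ∫ w, w i * w j ∂ν = if i = j then (1 : ℝ) else 0 :=
    (memLp_and_integral_mul_of_map_eq_gaussianMeasure (c := fun _ : Fin (m + d) => (1 : ℝ))
      (fun _ => one_pos) measurable_id (P := ν)
      (by rw [Measure.map_id, gaussianMeasure_diagonal fun _ => one_pos]; simp [ν])).2
  refine ⟨ν.map fun w => (X w, Y w), Measure.isProbabilityMeasure_map (by fun_prop), ?_, ?_, ?_⟩
  · rw [Measure.map_map measurable_fst (by fun_prop)]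
    exact map_sqrt_mul_coord_eq_gaussianMeasure ha (Fin.castLE_injective _)
  · rw [Measure.map_map measurable_snd (by fun_prop)]
    exact map_sqrt_mul_coord_eq_gaussianMeasure hc (Fin.castLE_injective _)
  · have hcross : ∀ i k, (∫ p, p.1 i * p.2 k ∂(ν.map fun w => (X w, Y w))) ^ 2 =
        if (i : ℕ) = k then a i * c k else 0 := by
      intro i k
      rw [integral_map (by fun_prop) (Measurable.aestronglyMeasurable (by fun_prop))]
      have : ∀ w, X w i * Y w k = √(a i) * √(c k) *
          (w (i.castLE (by omega)) * w (k.castLE (by omega))) := fun w => by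
        simp only [X, Y]; ring
      simp_rw [this]
      rw [integral_const_mul, hmom]
      simp only [Fin.ext_iff, Fin.val_castLE]
      split_ifs
      · rw [mul_one, mul_pow, Real.sq_sqrt (ha i).le, Real.sq_sqrt (hc k).le]
      · simp
    simp_rw [hcross]
    rw [sum_comm]
    refine sum_congr rfl fun k _ => ?_
    split_ifs with h
    · rw [sum_eq_single ⟨k, h⟩]
      · simp [mul_comm]
      · intro i _ hi
        exact if_neg fun h' => hi (Fin.ext h')
      · simp
    · rw [mul_zero]
      exact sum_eq_zero fun i _ => if_neg (by omega)

end Gaussian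

section GromovWasserstein

variable {m d : ℕ} {a : Fin m → ℝ} {γ : Measure ((Fin m → ℝ) × (Fin d → ℝ))}

/-- A coupling with finite inner-product Gromov–Wasserstein cost against a Gaussian has a square
integrable second marginal. -/
theorem memLp_snd_of_integrable_sq_sub [IsProbabilityMeasure γ] (ha : ∀ i, 0 < a i)
    (hfst : γ.map Prod.fst = gaussianMeasure (Matrix.diagonal a))
    (hint : Integrable (fun pq : ((Fin m → ℝ) × (Fin d → ℝ)) × ((Fin m → ℝ) × (Fin d → ℝ)) =>
      ((pq.1.1 ⬝ᵥ pq.2.1) - (pq.1.2 ⬝ᵥ pq.2.2)) ^ 2) (γ.prod γ)) (k : Fin d) :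
    MemLp (fun p : (Fin m → ℝ) × (Fin d → ℝ) => p.2 k) 2 γ := by
  have hX := (memLp_and_integral_mul_of_map_eq_gaussianMeasure ha measurable_fst hfst).1
  have hXX := (integral_integral_sq_sum_s13 (fun _ => (1 : ℝ)) hX).1
  simp only [one_mul] at hXX
  have hm1 : Measurable fun pq : ((Fin m → ℝ) × (Fin d → ℝ)) × ((Fin m → ℝ) × (Fin d → ℝ)) =>
      pq.1.1 ⬝ᵥ pq.2.1 := by
    unfold dotProduct; fun_prop
  have hm2 : Measurable fun pq : ((Fin m → ℝ) × (Fin d → ℝ)) × ((Fin m → ℝ) × (Fin d → ℝ)) =>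
      pq.1.2 ⬝ᵥ pq.2.2 := by
    unfold dotProduct; fun_prop
  have h1 := (memLp_two_iff_integrable_sq hm1.aestronglyMeasurable).2 hXX
  have h2 := (memLp_two_iff_integrable_sq (hm1.sub hm2).aestronglyMeasurable).2 hint
  refine memLp_coord_of_integrable_sq_dotProduct (Y := Prod.snd) measurable_snd ?_ k
  refine (memLp_two_iff_integrable_sq hm2.aestronglyMeasurable).1 ?_
  convert h1.sub h2 using 1
  ext pq
  simp

/-- Lower bound for the inner-product Gromov–Wasserstein cost of a coupling in terms of the
ordered second moments of its marginals. -/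
theorem le_integral_integral_sq_sub [IsProbabilityMeasure γ] (ha : ∀ i, 0 < a i)
    (hanti : Antitone a) (hfst : γ.map Prod.fst = gaussianMeasure (Matrix.diagonal a))
    (hsnd : ∀ k, MemLp (fun y : Fin d → ℝ => y k) 2 (γ.map Prod.snd))
    {s : Fin d → ℝ} {b : Fin d → Fin d → ℝ} (hs : Antitone s) (hs0 : ∀ k, 0 ≤ s k)
    (hb : ∀ y z : Fin d → ℝ, y ⬝ᵥ z = ∑ k, (b k ⬝ᵥ y) * (b k ⬝ᵥ z))
    (hbs : ∀ k l, ∫ y, (b k ⬝ᵥ y) * (b l ⬝ᵥ y) ∂(γ.map Prod.snd) = if k = l then s k else 0) :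
    ∑ i, a i ^ 2 + ∑ k, s k ^ 2 -
        2 * ∑ k : Fin d, s k * (if h : (k : ℕ) < m then a ⟨k, h⟩ else 0) ≤
      ∫ p, ∫ q, ((p.1 ⬝ᵥ q.1) - (p.2 ⬝ᵥ q.2)) ^ 2 ∂γ ∂γ := by
  obtain ⟨hX, hXX⟩ := memLp_and_integral_mul_of_map_eq_gaussianMeasure ha measurable_fst hfst
  have hY : ∀ k, MemLp (fun p : (Fin m → ℝ) × (Fin d → ℝ) => b k ⬝ᵥ p.2) 2 γ := fun k =>
    memLp_finsetSum _ fun j _ => ((hsnd j).comp_of_map measurable_snd.aemeasurable).const_mul _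
  have hm : ∀ k, Measurable fun y : Fin d → ℝ => b k ⬝ᵥ y := fun k => by
    unfold dotProduct; fun_prop
  have hYY : ∀ k l, ∫ p : (Fin m → ℝ) × (Fin d → ℝ), (b k ⬝ᵥ p.2) * (b l ⬝ᵥ p.2) ∂γ =
      if k = l then s k else 0 := fun k l => by
    rw [← hbs]
    exact (integral_map measurable_snd.aemeasurable
      ((hm k).mul (hm l)).aestronglyMeasurable).symm
  have h1 := (integral_integral_sq_sub hX hY hXX hYY).2
  have h2 := sum_sq_integral_mul_le hanti hs ha hs0 hX hY hXX hYY
  simp_rw [← hb] at h1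
  refine le_of_le_of_eq ?_ h1.symm
  linarith

end GromovWasserstein

end Auxiliary


/-- the inner-product Gromov–Wasserstein barycenter of the centered Gaussians
`μ_ℓ = N(0, diag (lam ℓ))` on `ℝ^{m ℓ}` with weights `α_ℓ` (and target dimension
`d ≤ max_ℓ m_ℓ`) is attained at the Gaussian `N(0, diag lstar)` with
`lstar_j = ∑_ℓ α_ℓ lam_{ℓ,j} 1_{j ≤ m_ℓ}`: there are couplings of each `μ_ℓ` with the
Gaussian barycenter whose objective value is a lower bound for the objective of any
probability measure `μ` on `ℝ^d` together with any couplings `γ_ℓ ∈ Π(μ_ℓ, μ)`. -/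
theorem IGW_barycenter_gaussian
    (n : ℕ) (hn : 0 < n) (m : Fin n → ℕ) (d : ℕ) (hd : 0 < d)
    (hdmax : ∃ ℓ, d ≤ m ℓ)
    (lam : (ℓ : Fin n) → Fin (m ℓ) → ℝ)
    (hlampos : ∀ ℓ i, 0 < lam ℓ i)
    (hlammono : ∀ ℓ, ∀ i j : Fin (m ℓ), i ≤ j → lam ℓ j ≤ lam ℓ i)
    (α : Fin n → ℝ) (hαpos : ∀ ℓ, 0 < α ℓ) (hαsum : ∑ ℓ, α ℓ = 1) :
    let μl : (ℓ : Fin n) → Measure (Fin (m ℓ) → ℝ) :=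
      fun ℓ => gaussianMeasure (Matrix.diagonal (lam ℓ))
    -- admissible families of couplings for a candidate barycenter `μ`
    let adm : Measure (Fin d → ℝ) →
        ((ℓ : Fin n) → Measure ((Fin (m ℓ) → ℝ) × (Fin d → ℝ))) → Prop :=
      fun μ γ => IsProbabilityMeasure μ ∧ ∀ ℓ, IsProbabilityMeasure (γ ℓ) ∧
        (γ ℓ).map Prod.fst = μl ℓ ∧ (γ ℓ).map Prod.snd = μ ∧
        Integrable (fun pq : ((Fin (m ℓ) → ℝ) × (Fin d → ℝ)) ×
            ((Fin (m ℓ) → ℝ) × (Fin d → ℝ)) =>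
          ((pq.1.1 ⬝ᵥ pq.2.1) - (pq.1.2 ⬝ᵥ pq.2.2)) ^ 2) ((γ ℓ).prod (γ ℓ))
    -- the IGW barycenter objective
    let obj : ((ℓ : Fin n) → Measure ((Fin (m ℓ) → ℝ) × (Fin d → ℝ))) → ℝ :=
      fun γ => ∑ ℓ, α ℓ *
        ∫ p, ∫ q, ((p.1 ⬝ᵥ q.1) - (p.2 ⬝ᵥ q.2)) ^ 2 ∂(γ ℓ) ∂(γ ℓ)
    let lstar : Fin d → ℝ :=
      fun j => ∑ ℓ, if hj : (j : ℕ) < m ℓ then α ℓ * lam ℓ ⟨j, hj⟩ else 0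
    let μstar : Measure (Fin d → ℝ) := gaussianMeasure (Matrix.diagonal lstar)
    ∃ γstar, adm μstar γstar ∧
      ∀ (μ : Measure (Fin d → ℝ)) (γ : (ℓ : Fin n) → Measure ((Fin (m ℓ) → ℝ) × (Fin d → ℝ))),
        adm μ γ → obj γstar ≤ obj γ := by
  intro μl adm obj lstar μstar
  let lpad : (ℓ : Fin n) → Fin d → ℝ :=
    fun ℓ j => if h : (j : ℕ) < m ℓ then lam ℓ ⟨j, h⟩ else 0
  have hlstar : ∀ j, lstar j = ∑ ℓ, α ℓ * lpad ℓ j := fun j =>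
    Finset.sum_congr rfl fun ℓ _ => by
      dsimp only [lpad]
      split_ifs <;> simp
  have hlstar_pos : ∀ j, 0 < lstar j := by
    intro j
    obtain ⟨ℓ₀, hℓ₀⟩ := hdmax
    rw [hlstar]
    refine Finset.sum_pos' (fun ℓ _ => mul_nonneg (hαpos ℓ).le ?_)
      ⟨ℓ₀, Finset.mem_univ _, mul_pos (hαpos ℓ₀) ?_⟩
    · dsimp only [lpad]
      split_ifs
      exacts [(hlampos _ _).le, le_rfl]
    · dsimp only [lpad]
      rw [dif_pos (j.2.trans_le hℓ₀)]
      exact hlampos _ _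
  have hsum : ∀ t : Fin d → ℝ,
      ∑ ℓ, α ℓ * (∑ i, lam ℓ i ^ 2 + ∑ k, t k ^ 2 - 2 * ∑ k, t k * lpad ℓ k) =
        ∑ ℓ, α ℓ * ∑ i, lam ℓ i ^ 2 + ∑ k, ((t k - lstar k) ^ 2 - lstar k ^ 2) := by
    intro t
    have h1 : ∑ ℓ, α ℓ * ∑ k, t k * lpad ℓ k = ∑ k, t k * lstar k := by
      simp_rw [hlstar, Finset.mul_sum]
      rw [Finset.sum_comm]
      exact Finset.sum_congr rfl fun k _ => Finset.sum_congr rfl fun ℓ _ => by ring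
    have h2 : ∑ ℓ, α ℓ * ∑ k, t k ^ 2 = ∑ k, t k ^ 2 := by
      rw [← Finset.sum_mul, hαsum, one_mul]
    have h3 : ∑ k, ((t k - lstar k) ^ 2 - lstar k ^ 2) =
        ∑ k, t k ^ 2 - 2 * ∑ k, t k * lstar k := by
      rw [Finset.mul_sum, ← Finset.sum_sub_distrib]
      exact Finset.sum_congr rfl fun k _ => by ring
    rw [h3, ← h1]
    nth_rewrite 2 [← h2]
    rw [Finset.mul_sum, ← Finset.sum_sub_distrib, ← Finset.sum_add_distrib]
    exact Finset.sum_congr rfl fun ℓ _ => by ring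
  choose γstar hprob hfst hsnd hcross using
    fun ℓ => exists_diagonal_coupling (hlampos ℓ) hlstar_pos
  have hcost := fun ℓ =>
    have := hprob ℓ
    have hX := memLp_and_integral_mul_of_map_eq_gaussianMeasure (hlampos ℓ) measurable_fst (hfst ℓ)
    have hY := memLp_and_integral_mul_of_map_eq_gaussianMeasure hlstar_pos measurable_snd (hsnd ℓ)
    integral_integral_sq_sub hX.1 hY.1 hX.2 hY.2
  refine ⟨γstar, ⟨?_, fun ℓ => ⟨hprob ℓ, hfst ℓ, hsnd ℓ, (hcost ℓ).1⟩⟩, ?_⟩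
  · have := hprob ⟨0, hn⟩
    dsimp only [μstar]
    rw [← hsnd ⟨0, hn⟩]
    exact Measure.isProbabilityMeasure_map measurable_snd.aemeasurable
  · rintro μ γ ⟨-, hγ⟩
    have hμ : ∀ k, MemLp (fun y : Fin d → ℝ => y k) 2 μ := by
      intro k
      obtain ⟨h1, h2, h3, h4⟩ := hγ ⟨0, hn⟩
      rw [← h3, memLp_map_measure_iff (Measurable.aestronglyMeasurable (by fun_prop))
        measurable_snd.aemeasurable]
      exact memLp_snd_of_integrable_sq_sub (hlampos _) h2 h4 k
    obtain ⟨s, b, hs, hs0, hb, hbs⟩ := exists_principal_axes hμ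
    calc obj γstar
        = ∑ ℓ, α ℓ * (∑ i, lam ℓ i ^ 2 + ∑ k, lstar k ^ 2 - 2 * ∑ k, lstar k * lpad ℓ k) :=
          Finset.sum_congr rfl fun ℓ _ => by
            rw [← hcross ℓ]
            exact congrArg (α ℓ * ·) (hcost ℓ).2
      _ ≤ ∑ ℓ, α ℓ * (∑ i, lam ℓ i ^ 2 + ∑ k, s k ^ 2 - 2 * ∑ k, s k * lpad ℓ k) := by
          rw [hsum, hsum]
          refine add_le_add le_rfl (Finset.sum_le_sum fun k _ => ?_)
          rw [sub_self]
          exact sub_le_sub_right (by simpa using sq_nonneg (s k - lstar k)) _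
      _ ≤ obj γ := by
          refine Finset.sum_le_sum fun ℓ _ => mul_le_mul_of_nonneg_left ?_ (hαpos ℓ).le
          obtain ⟨h1, h2, h3, -⟩ := hγ ℓ
          subst h3
          exact le_integral_integral_sq_sub (hlampos ℓ) (fun i j h => hlammono ℓ i j h) h2 hμ
            hs hs0 hb hbs
end
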